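/- Let k ≥ 6, let s be an integer with 1 ≤ s ≤ k(k−1), and let ε > 0. For all real numbers β₁, …, β_s and all sufficiently large N (in terms of k, s and ε), there exist integers n₁, …, n_s with 0 ≤ n_i ≤ N for each i and (n₁, …, n_s) ≠ (0, …, 0), such that ‖β₁ n₁^k + ⋯ + β_s n_s^k‖ ≤ C(k,s,ε) · N^{−s/(k(k−1)) + ε}, where C(k,s,ε) depends only on k, s and ε. -/

import Mathlib

/-- Distance from a real number to the nearest integer. -/
noncomputable def nearestIntDist (x : ℝ) : ℝ := |x - round x|

namespace SFP
open Finset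
open scoped BigOperators

lemma expect_eq {X : Type*} [Fintype X] (g : X → ℝ) :
    (𝔼 x, g x) = ∑ x, (Fintype.card X : ℝ)⁻¹ * g x := by
  rw [Fintype.expect_eq_sum_div_card, ← Finset.mul_sum]; ring

lemma minkAux {X : Type*} (T : Finset X) {ι : Type*} (s : Finset ι) (r : ℝ) (hr : 1 ≤ r)
    (g : ι → X → ℝ) (hg : ∀ i x, 0 ≤ g i x) :
    (∑ x ∈ T, (∑ i ∈ s, g i x) ^ r) ^ (1 / r) ≤ ∑ i ∈ s, (∑ x ∈ T, (g i x) ^ r) ^ (1 / r) := by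
  classical
  induction s using Finset.induction_on with
  | empty =>
    have h0 : r ≠ 0 := by linarith
    simp [Real.zero_rpow h0, Real.zero_rpow (inv_ne_zero h0)]
  | insert i s hi ih =>
    simp only [Finset.sum_insert hi]
    refine (Real.Lp_add_le_of_nonneg T hr (fun x _ => hg i x)
      (fun x _ => Finset.sum_nonneg fun j _ => hg j x)).trans ?_
    gcongr

lemma mink {X : Type*} [Fintype X] {ι : Type*} (s : Finset ι) (q : ℕ) (hq : 1 ≤ q)
    (w : X → ℝ) (hw : ∀ x, 0 ≤ w x) (g : ι → X → ℝ) (hg : ∀ i x, 0 ≤ g i x) :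
    (𝔼 x, w x * (∑ i ∈ s, g i x) ^ q) ^ (1 / (q : ℝ)) ≤
      ∑ i ∈ s, (𝔼 x, w x * (g i x) ^ q) ^ (1 / (q : ℝ)) := by
  have hq0 : (q : ℝ) ≠ 0 := by positivity
  have hc : (0 : ℝ) ≤ (Fintype.card X : ℝ)⁻¹ := by positivity
  have key : ∀ (y : ℝ) (x : X), 0 ≤ y → (Fintype.card X : ℝ)⁻¹ * (w x * y ^ q) =
      ((((Fintype.card X : ℝ)⁻¹ * w x) ^ (1 / (q : ℝ))) * y) ^ (q : ℝ) := by
    intro y x hy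
    have h1 : 0 ≤ (Fintype.card X : ℝ)⁻¹ * w x := mul_nonneg hc (hw x)
    rw [Real.mul_rpow (by positivity) hy, ← Real.rpow_mul h1, one_div,
      inv_mul_cancel₀ hq0, Real.rpow_one, Real.rpow_natCast]
    ring
  have h2 := minkAux (Finset.univ : Finset X) s (q : ℝ) (by exact_mod_cast hq)
    (fun i x => (((Fintype.card X : ℝ)⁻¹ * w x) ^ (1 / (q : ℝ))) * g i x)
    (fun i x => mul_nonneg (Real.rpow_nonneg (mul_nonneg hc (hw x)) _) (hg i x))
  simp only [expect_eq]
  simp only [← Finset.mul_sum s] at h2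
  convert h2 using 2
  · refine Finset.sum_congr rfl fun x _ => ?_
    exact key _ x (Finset.sum_nonneg fun j _ => hg j x)
  · congr 1
    refine Finset.sum_congr rfl fun x _ => ?_
    exact key _ x (hg _ x)

lemma holder {X : Type*} [Fintype X] (θ : ℝ) (h0 : 0 < θ) (h1 : θ < 1) (F G : X → ℝ)
    (hF : ∀ x, 0 ≤ F x) (hG : ∀ x, 0 ≤ G x) :
    (𝔼 x, (F x) ^ θ * (G x) ^ (1 - θ)) ≤ (𝔼 x, F x) ^ θ * (𝔼 x, G x) ^ (1 - θ) := by
  have hc : (0 : ℝ) ≤ (Fintype.card X : ℝ)⁻¹ := by positivity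
  have hconj : (1 / θ).HolderConjugate (1 / (1 - θ)) := by
    rw [Real.holderConjugate_iff]
    refine ⟨by rw [lt_div_iff₀ h0]; linarith, ?_⟩
    simp
  have h2 := Real.inner_le_Lp_mul_Lq_of_nonneg (Finset.univ : Finset X)
    (f := fun x => ((Fintype.card X : ℝ)⁻¹ * F x) ^ θ)
    (g := fun x => ((Fintype.card X : ℝ)⁻¹ * G x) ^ (1 - θ)) hconj
    (fun x _ => Real.rpow_nonneg (mul_nonneg hc (hF x)) _)
    (fun x _ => Real.rpow_nonneg (mul_nonneg hc (hG x)) _)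
  simp only [expect_eq]
  have h1' : (1 - θ) ≠ 0 := by linarith
  convert h2 using 1
  · refine Finset.sum_congr rfl fun x _ => ?_
    rw [Real.mul_rpow hc (hF x), Real.mul_rpow hc (hG x)]
    have : (Fintype.card X : ℝ)⁻¹ = (Fintype.card X : ℝ)⁻¹ ^ θ * (Fintype.card X : ℝ)⁻¹ ^ (1 - θ) := by
      rcases hc.eq_or_lt with h | h
      · rw [← h, Real.zero_rpow h0.ne']; simp
      · rw [← Real.rpow_add h]; simp
    nth_rewrite 1 [this]; ring
  · congr 1
    · rw [one_div_one_div]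
      congr 1
      refine Finset.sum_congr rfl fun x _ => ?_
      rw [← Real.rpow_mul (mul_nonneg hc (hF x)), mul_one_div_cancel h0.ne', Real.rpow_one]
    · rw [one_div_one_div]
      congr 1
      refine Finset.sum_congr rfl fun x _ => ?_
      rw [← Real.rpow_mul (mul_nonneg hc (hG x)), mul_one_div_cancel h1', Real.rpow_one]

/-- Fibred form of Minkowski. -/
lemma fiberMink {Y Z : Type*} [Fintype Y] [Fintype Z] {ι : Type*} (s : Finset ι) (q : ℕ)
    (hq : 1 ≤ q) (w : Y → ℝ) (hw : ∀ x, 0 ≤ w x) (u : Y → Z → ℝ) (v : ι → Y → Z → ℝ)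
    (hu : ∀ y z, 0 ≤ u y z) (hv : ∀ i y z, 0 ≤ v i y z) (D : ℝ) (hD : 0 ≤ D)
    (h : ∀ y, (𝔼 z, (u y z) ^ q) ^ (1 / (q : ℝ)) ≤
      D * ∑ i ∈ s, (𝔼 z, (v i y z) ^ q) ^ (1 / (q : ℝ))) :
    (𝔼 y, w y * 𝔼 z, (u y z) ^ q) ^ (1 / (q : ℝ)) ≤
      D * ∑ i ∈ s, (𝔼 y, w y * 𝔼 z, (v i y z) ^ q) ^ (1 / (q : ℝ)) := by
  have hq0 : (q : ℝ) ≠ 0 := by positivity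
  have hroot : ∀ a : ℝ, 0 ≤ a → (a ^ (1 / (q : ℝ))) ^ q = a := by
    intro a ha
    rw [← Real.rpow_natCast, ← Real.rpow_mul ha, one_div, inv_mul_cancel₀ hq0, Real.rpow_one]
  have hpos : ∀ i y, 0 ≤ (𝔼 z, (v i y z) ^ q) := fun i y =>
    Finset.expect_nonneg fun z _ => pow_nonneg (hv i y z) q
  have hpos' : ∀ y, 0 ≤ (𝔼 z, (u y z) ^ q) := fun y =>
    Finset.expect_nonneg fun z _ => pow_nonneg (hu y z) q
  have h1 := mink s q hq w hw (fun i y => D * (𝔼 z, (v i y z) ^ q) ^ (1 / (q : ℝ)))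
    (fun i y => mul_nonneg hD (Real.rpow_nonneg (hpos i y) _))
  rw [Finset.mul_sum]
  refine le_trans ?_ (h1.trans (le_of_eq ?_))
  · refine Real.rpow_le_rpow ?_ ?_ (by positivity)
    · exact Finset.expect_nonneg fun y _ => mul_nonneg (hw y) (hpos' y)
    · refine Finset.expect_le_expect fun y _ => ?_
      refine mul_le_mul_of_nonneg_left ?_ (hw y)
      rw [← hroot _ (hpos' y), ← Finset.mul_sum]
      exact pow_le_pow_left₀ (Real.rpow_nonneg (hpos' y) _) (h y) q
  · refine Finset.sum_congr rfl fun i _ => ?_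
    have : ∀ y, w y * (D * (𝔼 z, (v i y z) ^ q) ^ (1 / (q : ℝ))) ^ q =
        D ^ q * (w y * 𝔼 z, (v i y z) ^ q) := by
      intro y
      rw [mul_pow, hroot _ (hpos i y)]; ring
    simp only [this, ← Finset.mul_expect]
    rw [Real.mul_rpow (by positivity), one_div, Real.pow_rpow_inv_natCast hD (by omega)]
    exact Finset.expect_nonneg fun y _ => mul_nonneg (hw y) (hpos i y)

/-- Averages can be computed after averaging over translates. -/
lemma expect_shift {Y Z : Type*} [Fintype Y] [AddGroup Y] [Fintype Z] [Nonempty Z]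
    (F : Y → ℝ) (g : Z → Y) : (𝔼 y, F y) = 𝔼 y, 𝔼 z, F (y + g z) := by
  rw [Finset.expect_comm]
  have : ∀ z, (𝔼 y, F (y + g z)) = 𝔼 y, F y := fun z =>
    Fintype.expect_equiv (Equiv.addRight (g z)) _ _ (fun y => rfl)
  simp [this]

end SFP

namespace SFP
open Finset
open scoped BigOperators

section padic
open Polynomial

variable {p : ℕ} [Fact p.Prime] {k : ℕ}

/-- Triangular numbers. -/
def tri (k : ℕ) : ℕ := k * (k + 1) / 2

lemma two_tri (k : ℕ) : 2 * tri k = k * (k + 1) := by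
  unfold tri
  exact Nat.mul_div_cancel' (Nat.even_mul_succ_self k).two_dvd

lemma tri_pos {k : ℕ} (hk : 1 ≤ k) : 1 ≤ tri k := by
  have := two_tri k
  nlinarith

/-- The pairing character. -/
noncomputable def E (M : ℕ) (x : Fin k → ZMod (p ^ M)) (v : Fin k → ℤ_[p]) : ℂ :=
  ZMod.stdAddChar (∑ j, x j * PadicInt.toZModPow M (v j))

lemma E_norm (M : ℕ) (x : Fin k → ZMod (p ^ M)) (v : Fin k → ℤ_[p]) : ‖E M x v‖ = 1 := by
  unfold E; exact AddChar.norm_apply _ _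

lemma E_add_left (M : ℕ) (x y : Fin k → ZMod (p ^ M)) (v : Fin k → ℤ_[p]) :
    E M (x + y) v = E M x v * E M y v := by
  unfold E; rw [← AddChar.map_add_eq_mul, ← Finset.sum_add_distrib]
  simp [add_mul]

lemma E_add_right (M : ℕ) (x : Fin k → ZMod (p ^ M)) (v w : Fin k → ℤ_[p]) :
    E M x (v + w) = E M x v * E M x w := by
  unfold E; rw [← AddChar.map_add_eq_mul, ← Finset.sum_add_distrib]
  simp [mul_add]

lemma E_mulVec (M : ℕ) (x : Fin k → ZMod (p ^ M)) (W : Matrix (Fin k) (Fin k) ℤ_[p])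
    (v : Fin k → ℤ_[p]) :
    E M x (W.mulVec v) = E M (Matrix.vecMul x (W.map (PadicInt.toZModPow M))) v := by
  unfold E
  congr 1
  have h1 : (fun j => PadicInt.toZModPow M (W.mulVec v j)) =
      (W.map (PadicInt.toZModPow M)).mulVec (fun j => PadicInt.toZModPow M (v j)) := by
    ext j; simp [Matrix.mulVec, dotProduct]
  have h2 := Matrix.dotProduct_mulVec x (W.map (PadicInt.toZModPow M))
    (fun j => PadicInt.toZModPow M (v j))
  rw [← h1] at h2
  simpa [dotProduct] using h2

lemma char_scale (M d : ℕ) (v : ℤ_[p]) :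
    ZMod.stdAddChar (N := p ^ (M + d)) ((p : ZMod (p ^ (M + d))) ^ d * PadicInt.toZModPow (M + d) v)
      = ZMod.stdAddChar (N := p ^ M) (PadicInt.toZModPow M v) := by
  have hp : (p : ℂ) ≠ 0 := by exact_mod_cast (Fact.out : p.Prime).ne_zero
  set A : ℕ := (PadicInt.toZModPow (M + d) v).val with hA
  have h1 : PadicInt.toZModPow (M + d) v = ((A : ℤ) : ZMod (p ^ (M + d))) := by
    rw [hA]; simp
  have h2 : PadicInt.toZModPow M v = ((A : ℤ) : ZMod (p ^ M)) := by
    rw [← PadicInt.cast_toZModPow M (M + d) (by omega) v, hA]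
    simp
  rw [h1, h2]
  have h3 : (p : ZMod (p ^ (M + d))) ^ d * ((A : ℤ) : ZMod (p ^ (M + d))) =
      (((p : ℤ) ^ d * (A : ℤ) : ℤ) : ZMod (p ^ (M + d))) := by push_cast; ring
  rw [h3, ZMod.stdAddChar_coe, ZMod.stdAddChar_coe]
  congr 1
  push_cast
  rw [pow_add]
  field_simp

/-- If `x j = p^(e j) * z j` (lifted) and `e j + e' j = d`, the pairing against
`p^(e' j) * v j` is the pairing modulo `p^M`. -/
lemma E_scale (M d : ℕ) (e e' : Fin k → ℕ) (h : ∀ j, e j + e' j = d)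
    (z : Fin k → ZMod (p ^ M)) (v : Fin k → ℤ_[p]) :
    E (M + d) (fun j => (p : ZMod (p ^ (M + d))) ^ (e j) * ((z j).val : ZMod (p ^ (M + d))))
      (fun j => (p : ℤ_[p]) ^ (e' j) * v j) = E M z v := by
  unfold E
  have h1 : (∑ j, (p : ZMod (p ^ (M + d))) ^ (e j) * ((z j).val : ZMod (p ^ (M + d))) *
      PadicInt.toZModPow (M + d) ((p : ℤ_[p]) ^ (e' j) * v j)) =
      (p : ZMod (p ^ (M + d))) ^ d *
        PadicInt.toZModPow (M + d) (∑ j, ((z j).val : ℤ_[p]) * v j) := by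
    rw [map_sum, Finset.mul_sum]
    refine Finset.sum_congr rfl fun j _ => ?_
    rw [← h j]
    simp only [map_mul, map_pow, map_natCast]
    ring
  rw [h1, char_scale]
  congr 1
  rw [map_sum]
  refine Finset.sum_congr rfl fun j _ => ?_
  simp

lemma tz_eq_iff (c : ℕ) (x y : ℤ_[p]) :
    PadicInt.toZModPow c x = PadicInt.toZModPow c y ↔ (p : ℤ_[p]) ^ c ∣ x - y := by
  rw [← sub_eq_zero, ← map_sub, ← RingHom.mem_ker, PadicInt.ker_toZModPow,
    Ideal.mem_span_singleton]

/-- Exponential sums with coefficients. -/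
noncomputable def fS (M : ℕ) (S : Finset ℕ) (a : ℕ → ℂ) (v : ℕ → Fin k → ℤ_[p])
    (x : Fin k → ZMod (p ^ M)) : ℂ := ∑ i ∈ S, a i * E M x (v i)

noncomputable def sq (M : ℕ) (S : Finset ℕ) (a : ℕ → ℂ) (v : ℕ → Fin k → ℤ_[p])
    (x : Fin k → ZMod (p ^ M)) : ℝ := ‖fS M S a v x‖ ^ 2

lemma sq_nonneg' (M : ℕ) (S : Finset ℕ) (a : ℕ → ℂ) (v : ℕ → Fin k → ℤ_[p])
    (x : Fin k → ZMod (p ^ M)) : 0 ≤ sq M S a v x := by unfold sq; positivity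

/-- squared `L^P` norm, `P = k (k+1)`. -/
noncomputable def nrm (M : ℕ) (S : Finset ℕ) (a : ℕ → ℂ) (v : ℕ → Fin k → ℤ_[p]) : ℝ :=
  (𝔼 x, (sq M S a v x) ^ (tri k)) ^ (1 / (tri k : ℝ))

lemma nrm_nonneg (M : ℕ) (S : Finset ℕ) (a : ℕ → ℂ) (v : ℕ → Fin k → ℤ_[p]) :
    0 ≤ nrm M S a v :=
  Real.rpow_nonneg (Finset.expect_nonneg fun x _ => pow_nonneg (sq_nonneg' M S a v x) _) _

noncomputable def pt (φ : Fin k → ℤ_[p][X]) (t : ℤ_[p]) : Fin k → ℤ_[p] :=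
  fun j => (φ j).eval t

/-- indices in a residue class -/
noncomputable def cls (S : Finset ℕ) (n : ℕ → ℤ_[p]) (c : ℕ) (J : ZMod (p ^ c)) : Finset ℕ :=
  S.filter (fun i => PadicInt.toZModPow c (n i) = J)

def Mon (φ : Fin k → ℤ_[p][X]) : Prop :=
  ∀ j : Fin k, ∃ g : ℤ_[p][X], φ j = X ^ ((j : ℕ) + 1) + C (p : ℤ_[p]) * g

variable (p) in
def Dec (k c : ℕ) (D : ℝ) : Prop :=
  ∀ M : ℕ, k * c ≤ M → ∀ φ : Fin k → ℤ_[p][X], Mon φ → ∀ (S : Finset ℕ) (a : ℕ → ℂ) (n : ℕ → ℤ_[p]),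
    nrm M S a (fun i => pt φ (n i)) ≤ D * ∑ J : ZMod (p ^ c), nrm M (cls S n c J) a (fun i => pt φ (n i))

lemma expand (l : ℕ) (T : ℤ_[p][X]) : ∃ R : ℤ_[p][X],
    T = C (T.coeff 0) + (∑ j : Fin l, C (T.coeff ((j : ℕ) + 1)) * X ^ ((j : ℕ) + 1)) + X ^ (l + 1) * R := by
  induction l generalizing T with
  | zero => exact ⟨T.divX, by simp; rw [add_comm]; exact (Polynomial.X_mul_divX_add T).symm⟩
  | succ l ih =>
    obtain ⟨R, hR⟩ := ih T.divX
    refine ⟨R, ?_⟩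
    conv_lhs => rw [← Polynomial.X_mul_divX_add T, hR]
    rw [Fin.sum_univ_succ]
    simp only [Polynomial.coeff_divX, Fin.val_zero, Fin.val_succ]
    rw [mul_add, mul_add, Finset.mul_sum]
    have : ∀ j : Fin l, (X : ℤ_[p][X]) * (C (T.coeff ((j : ℕ) + 1 + 1)) * X ^ ((j : ℕ) + 1)) =
        C (T.coeff ((j : ℕ) + 1 + 1)) * X ^ ((j : ℕ) + 1 + 1) := fun j => by ring
    simp only [this]
    ring

/-- Taylor matrix -/
noncomputable def tay (ψ : Fin k → ℤ_[p][X]) (c : ℤ_[p]) : Matrix (Fin k) (Fin k) ℤ_[p] :=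
  fun i j => (taylor c (ψ i)).coeff ((j : ℕ) + 1)

lemma expect_vecMul (M : ℕ) (W : Matrix (Fin k) (Fin k) ℤ_[p]) (hW : IsUnit W.det)
    (F : (Fin k → ZMod (p ^ M)) → ℝ) :
    (𝔼 x, F (Matrix.vecMul x (W.map (PadicInt.toZModPow M)))) = 𝔼 x, F x := by
  set A := W.map (PadicInt.toZModPow M) with hA
  have hdet : IsUnit A.det := by
    rw [hA]
    have : (W.map (PadicInt.toZModPow M)).det = PadicInt.toZModPow M W.det := by
      rw [RingHom.map_det]; rfl
    rw [this]; exact hW.map _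
  refine Fintype.expect_equiv
    ⟨fun x => Matrix.vecMul x A, fun x => Matrix.vecMul x A⁻¹, fun x => ?_, fun x => ?_⟩ _ _
    (fun x => rfl)
  · simp [Matrix.vecMul_vecMul, Matrix.mul_nonsing_inv A hdet]
  · simp [Matrix.vecMul_vecMul, Matrix.nonsing_inv_mul A hdet]

/-- Change of variables for an affine map of points. -/
lemma sq_affine (M : ℕ) (S : Finset ℕ) (a : ℕ → ℂ) (v v' : ℕ → Fin k → ℤ_[p])
    (v0 : Fin k → ℤ_[p]) (W : Matrix (Fin k) (Fin k) ℤ_[p])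
    (h : ∀ i ∈ S, v i = v0 + W.mulVec (v' i)) (x : Fin k → ZMod (p ^ M)) :
    sq M S a v x = sq M S a v' (Matrix.vecMul x (W.map (PadicInt.toZModPow M))) := by
  unfold sq fS
  have : ∑ i ∈ S, a i * E M x (v i) =
      E M x v0 * ∑ i ∈ S, a i * E M (Matrix.vecMul x (W.map (PadicInt.toZModPow M))) (v' i) := by
    rw [Finset.mul_sum]
    refine Finset.sum_congr rfl fun i hi => ?_
    rw [h i hi, E_add_right, E_mulVec]; ring
  rw [this, norm_mul, E_norm, one_mul]

/-- Shift of variables: twisted coefficients. -/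
lemma sq_shift (M d : ℕ) (e e' : Fin k → ℕ) (he : ∀ j, e j + e' j = d)
    (S : Finset ℕ) (a : ℕ → ℂ) (w : ℕ → Fin k → ℤ_[p])
    (y : Fin k → ZMod (p ^ (M + d))) (z : Fin k → ZMod (p ^ M)) :
    sq (M + d) S a (fun i j => (p : ℤ_[p]) ^ (e' j) * w i j)
      (y + fun j => (p : ZMod (p ^ (M + d))) ^ (e j) * ((z j).val : ZMod (p ^ (M + d)))) =
    sq M S (fun i => a i * E (M + d) y (fun j => (p : ℤ_[p]) ^ (e' j) * w i j)) w z := by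
  unfold sq fS
  congr 2
  refine Finset.sum_congr rfl fun i _ => ?_
  rw [E_add_left, E_scale M d e e' he]; ring

lemma cls_sum_le (S : Finset ℕ) (n u : ℕ → ℤ_[p]) (c0 : ℤ_[p]) (a c : ℕ)
    (hn : ∀ i ∈ S, n i = c0 + (p : ℤ_[p]) ^ a * u i) (F : Finset ℕ → ℝ) (hF : ∀ S, 0 ≤ F S) :
    ∑ J : ZMod (p ^ c), F (cls S u c J) ≤ ∑ J : ZMod (p ^ (a + c)), F (cls S n (a + c) J) := by
  classical
  have hp0 : (p : ℤ_[p]) ≠ 0 := by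
    exact_mod_cast (Fact.out : p.Prime).ne_zero
  set ι : ZMod (p ^ c) → ZMod (p ^ (a + c)) := fun J =>
    PadicInt.toZModPow (a + c) (c0 + (p : ℤ_[p]) ^ a * (J.val : ℤ_[p])) with hι
  have key : ∀ x y : ℤ_[p], PadicInt.toZModPow (a + c) (c0 + (p : ℤ_[p]) ^ a * x) =
      PadicInt.toZModPow (a + c) (c0 + (p : ℤ_[p]) ^ a * y) ↔
      PadicInt.toZModPow c x = PadicInt.toZModPow c y := by
    intro x y
    rw [tz_eq_iff, tz_eq_iff, pow_add,
      show c0 + (p : ℤ_[p]) ^ a * x - (c0 + (p : ℤ_[p]) ^ a * y) = (p : ℤ_[p]) ^ a * (x - y) by ring]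
    exact mul_dvd_mul_iff_left (pow_ne_zero _ hp0)
  have hinj : Function.Injective ι := by
    intro J J' h
    have := (key _ _).1 h
    simpa using this
  have hcls : ∀ J, cls S u c J = cls S n (a + c) (ι J) := by
    intro J
    unfold cls
    refine Finset.filter_congr fun i hi => ?_
    rw [hn i hi, hι]
    simp only
    rw [key]
    simp
  simp only [hcls]
  rw [← Finset.sum_image (s := Finset.univ) (g := ι) (f := fun J => F (cls S n (a + c) J))
    (fun x _ y _ h => hinj h)]
  exact Finset.sum_le_sum_of_subset_of_nonneg (Finset.subset_univ _) (fun J _ _ => hF _)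

lemma cls_subset (S : Finset ℕ) (n : ℕ → ℤ_[p]) (c : ℕ) (J : ZMod (p ^ c)) : cls S n c J ⊆ S :=
  Finset.filter_subset _ _

end padic
end SFP

namespace SFP
open Finset
open scoped BigOperators

section padic
open Polynomial

variable {p : ℕ} [Fact p.Prime]

/-- Rescaling identity. -/
lemma rescale_exists {l : ℕ} (ψ : Fin l → ℤ_[p][X]) (c0 : ℤ_[p]) (hW : IsUnit (tay ψ c0).det)
    (a : ℕ) (ha : 1 ≤ a) : ∃ φ : Fin l → ℤ_[p][X], Mon φ ∧ ∀ u : ℤ_[p],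
      pt ψ (c0 + (p : ℤ_[p]) ^ a * u) = pt ψ c0 +
        (tay ψ c0).mulVec (fun j => (p : ℤ_[p]) ^ (a * ((j : ℕ) + 1)) * pt φ u j) := by
  classical
  choose R hR using fun i => expand l (taylor c0 (ψ i))
  set W := tay ψ c0 with hWdef
  set R' : Fin l → ℤ_[p][X] := fun j => ∑ i, C (W⁻¹ j i) * R i with hR'
  refine ⟨fun j => X ^ ((j : ℕ) + 1) + C ((p : ℤ_[p]) ^ (a * (l - j))) * X ^ (l + 1) *
    (R' j).comp (C ((p : ℤ_[p]) ^ a) * X), ?_, ?_⟩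
  · intro j
    refine ⟨C ((p : ℤ_[p]) ^ (a * (l - j) - 1)) * X ^ (l + 1) * (R' j).comp (C ((p : ℤ_[p]) ^ a) * X), ?_⟩
    have : 1 ≤ a * (l - j) := Nat.mul_pos ha (by have := j.2; omega)
    have h2 : (p : ℤ_[p]) ^ (a * (l - j)) = p * (p : ℤ_[p]) ^ (a * (l - j) - 1) := by
      rw [← pow_succ']; congr 1; omega
    simp only [h2, C_mul, mul_assoc]
  · intro u
    have hRR : ∀ (h : ℤ_[p]) i, ∑ j, W i j * (R' j).eval h = (R i).eval h := by
      intro h i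
      have h1 : (fun j => (R' j).eval h) = W⁻¹.mulVec (fun i => (R i).eval h) := by
        ext j; simp [hR', Matrix.mulVec, dotProduct, eval_finsetSum]
      have h2 : W.mulVec (fun j => (R' j).eval h) i = (R i).eval h := by
        rw [h1, Matrix.mulVec_mulVec, Matrix.mul_nonsing_inv W hW, Matrix.one_mulVec]
      simpa [Matrix.mulVec, dotProduct] using h2
    ext i
    set h := (p : ℤ_[p]) ^ a * u with hh
    have e1 : pt ψ (c0 + h) i = (taylor c0 (ψ i)).eval h := by
      simp [pt, taylor_eval, add_comm]
    rw [e1, hR i]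
    simp only [eval_add, eval_C, eval_mul, eval_pow, eval_X, eval_finsetSum, Pi.add_apply,
      taylor_coeff_zero, Matrix.mulVec, dotProduct]
    rw [add_assoc]
    congr 1
    rw [← hRR h i, Finset.mul_sum, ← Finset.sum_add_distrib]
    refine Finset.sum_congr rfl fun j _ => ?_
    have hj : a * (l + 1) = a * ((j : ℕ) + 1) + a * (l - j) := by
      rw [← mul_add]; congr 1; have := j.2; omega
    simp only [pt, eval_add, eval_C, eval_mul, eval_pow, eval_X, eval_comp]
    rw [← hh]
    have h3 : h ^ (l + 1) = (p : ℤ_[p]) ^ (a * ((j : ℕ) + 1)) * (p : ℤ_[p]) ^ (a * (l - j)) * u ^ (l + 1) := by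
      rw [← pow_add, ← hj, hh, mul_pow, pow_mul]
    have h4 : h ^ ((j : ℕ) + 1) = (p : ℤ_[p]) ^ (a * ((j : ℕ) + 1)) * u ^ ((j : ℕ) + 1) := by
      rw [hh, mul_pow, pow_mul]
    rw [h3, h4]
    simp only [hWdef, tay]
    ring

lemma lemR {l : ℕ} (hl : 1 ≤ l) (ψ : Fin l → ℤ_[p][X]) (c0 : ℤ_[p])
    (hW : IsUnit (tay ψ c0).det) (a c : ℕ) (ha : 1 ≤ a) (D : ℝ) (hD : 0 ≤ D) (hDec : Dec p l c D)
    (M : ℕ) (hM : l * (a + c) ≤ M) (S : Finset ℕ) (A : ℕ → ℂ) (n : ℕ → ℤ_[p])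
    (hn : ∀ i ∈ S, (p : ℤ_[p]) ^ a ∣ n i - c0) :
    nrm M S A (fun i => pt ψ (n i)) ≤
      D * ∑ J : ZMod (p ^ (a + c)), nrm M (cls S n (a + c) J) A (fun i => pt ψ (n i)) := by
  classical
  obtain ⟨φ, hφ, hid⟩ := rescale_exists ψ c0 hW a ha
  have hu : ∀ i, ∃ u, i ∈ S → n i = c0 + (p : ℤ_[p]) ^ a * u := by
    intro i
    by_cases hi : i ∈ S
    · obtain ⟨u, hu⟩ := hn i hi
      exact ⟨u, fun _ => by rw [← hu]; ring⟩
    · exact ⟨0, fun h => absurd h hi⟩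
  choose u hu using hu
  obtain ⟨M', rfl⟩ : ∃ M', M = M' + l * a := ⟨M - l * a, by
    have : l * a ≤ l * (a + c) := Nat.mul_le_mul_left _ (by omega)
    omega⟩
  have hM' : l * c ≤ M' := by rw [mul_add] at hM; omega
  set w : ℕ → Fin l → ℤ_[p] := fun i j => (p : ℤ_[p]) ^ (a * ((j : ℕ) + 1)) * pt φ (u i) j with hw
  set A' : (Fin l → ZMod (p ^ (M' + l * a))) → ℕ → ℂ := fun y i => A i * E (M' + l * a) y (w i) with hA'
  have key : ∀ S' ⊆ S, nrm (M' + l * a) S' A (fun i => pt ψ (n i)) =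
      (𝔼 y, (1 : ℝ) * 𝔼 z, (sq M' S' (A' y) (fun i => pt φ (u i)) z) ^ (tri l)) ^ (1 / (tri l : ℝ)) := by
    intro S' hS'
    unfold nrm
    congr 1
    have h1 : ∀ x, sq (M' + l * a) S' A (fun i => pt ψ (n i)) x =
        sq (M' + l * a) S' A w (Matrix.vecMul x ((tay ψ c0).map (PadicInt.toZModPow (M' + l * a)))) := by
      intro x
      refine sq_affine _ _ _ _ _ (pt ψ c0) _ (fun i hi => ?_) x
      simp only [hw]
      rw [← hid, ← hu i (hS' hi)]
    simp only [h1]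
    rw [expect_vecMul (M' + l * a) (tay ψ c0) hW (fun x => (sq (M' + l * a) S' A w x) ^ tri l)]
    rw [expect_shift (Z := Fin l → ZMod (p ^ M')) _ (fun z (j : Fin l) => (p : ZMod (p ^ (M' + l * a))) ^ (l * a - a * ((j : ℕ) + 1)) *
      ((z j).val : ZMod (p ^ (M' + l * a))))]
    refine Finset.expect_congr rfl fun y _ => ?_
    rw [one_mul]
    refine Finset.expect_congr rfl fun z _ => ?_
    rw [hw, sq_shift M' (l * a) (fun j => l * a - a * ((j : ℕ) + 1)) (fun j => a * ((j : ℕ) + 1))]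
    intro j
    have : a * ((j : ℕ) + 1) ≤ l * a := by
      rw [mul_comm]; exact Nat.mul_le_mul_right _ (by have := j.2; omega)
    omega
  have step : nrm (M' + l * a) S A (fun i => pt ψ (n i)) ≤
      D * ∑ J : ZMod (p ^ c), nrm (M' + l * a) (cls S u c J) A (fun i => pt ψ (n i)) := by
    rw [key S subset_rfl]
    simp only [fun J => key (cls S u c J) (cls_subset S u c J)]
    refine fiberMink Finset.univ (tri l) (tri_pos hl) (fun _ => 1) (fun _ => zero_le_one)
      (fun y z => sq M' S (A' y) (fun i => pt φ (u i)) z)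
      (fun J y z => sq M' (cls S u c J) (A' y) (fun i => pt φ (u i)) z)
      (fun y z => sq_nonneg' _ _ _ _ _) (fun J y z => sq_nonneg' _ _ _ _ _) D hD ?_
    intro y
    exact hDec M' hM' φ hφ S (A' y) u
  refine step.trans (mul_le_mul_of_nonneg_left ?_ hD)
  exact cls_sum_le S n u c0 a c (fun i hi => hu i hi)
    (fun S' => nrm (M' + l * a) S' A (fun i => pt ψ (n i))) (fun _ => nrm_nonneg _ _ _ _)

end padic
end SFP

namespace SFP
open Finset
open scoped BigOperators

section padic
open Polynomial

variable {p : ℕ} [Fact p.Prime]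

lemma nondegF (m l : ℕ) (hp : m + l < p) (e : ZMod p) (he : m = 0 ∨ e ≠ 0) :
    (Matrix.of fun i j : Fin l => ((X + C e : (ZMod p)[X]) ^ (m + 1 + (i : ℕ))).coeff ((j : ℕ) + 1)).det ≠ 0 := by
  intro hdet
  rcases Nat.eq_zero_or_pos l with rfl | hl
  · simp at hdet
  obtain ⟨v, hv, hv0⟩ := Matrix.exists_vecMul_eq_zero_iff.2 hdet
  apply hv
  set G : (ZMod p)[X] := ∑ i : Fin l, C (v i) * (X + C e) ^ (m + 1 + (i : ℕ)) with hG
  have hco : ∀ j : Fin l, G.coeff ((j : ℕ) + 1) = 0 := by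
    intro j
    have := congrFun hv0 j
    simpa [Matrix.vecMul, dotProduct, hG] using this
  have hd : derivative G = ∑ i : Fin l, C (v i * (m + 1 + (i : ℕ) : ℕ)) * (X + C e) ^ (m + (i : ℕ)) := by
    rw [hG, derivative_sum]
    refine Finset.sum_congr rfl fun i _ => ?_
    rw [derivative_C_mul, derivative_X_add_C_pow, C_mul, C_eq_natCast]
    rw [show m + 1 + (i : ℕ) - 1 = m + i by omega]; ring
  have h1 : (X : (ZMod p)[X]) ^ l ∣ derivative G := by
    rw [X_pow_dvd_iff]
    intro d hd
    rw [coeff_derivative, hco ⟨d, hd⟩, zero_mul]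
  have h2 : (X + C e : (ZMod p)[X]) ^ m ∣ derivative G := by
    rw [hd]
    refine Finset.dvd_sum fun i _ => ?_
    exact Dvd.dvd.mul_left (pow_dvd_pow _ (by omega)) _
  have hcop : IsCoprime ((X : (ZMod p)[X]) ^ l) ((X + C e) ^ m) := by
    rcases he with rfl | he
    · simp [isCoprime_one_right]
    · refine IsCoprime.pow ?_
      have := isCoprime_X_sub_C_of_isUnit_sub (R := ZMod p) (a := 0) (b := -e) (by simpa using he)
      simpa using this
  have h3 := hcop.mul_dvd h1 h2
  have hdeg : (derivative G).natDegree ≤ m + l - 1 := by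
    rw [hd]
    refine natDegree_sum_le_of_forall_le _ _ fun i _ => ?_
    refine (natDegree_C_mul_le _ _).trans ?_
    rw [natDegree_pow, natDegree_X_add_C]
    have := i.2
    omega
  have hz : derivative G = 0 := by
    by_contra hne
    have := natDegree_le_of_dvd h3 hne
    rw [natDegree_mul (pow_ne_zero _ X_ne_zero) (pow_ne_zero _ (X_add_C_ne_zero e)), natDegree_pow,
      natDegree_pow, natDegree_X, natDegree_X_add_C] at this
    omega
  -- conclude all coefficients vanish
  have hz2 : ∑ i : Fin l, C (v i * (m + 1 + (i : ℕ) : ℕ)) * (X : (ZMod p)[X]) ^ (m + (i : ℕ)) = 0 := by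
    have := congrArg (fun q => q.comp (X - C e)) (hd.symm.trans hz)
    simpa using this
  ext i
  have h5 := congrArg (fun q => q.coeff (m + (i : ℕ))) hz2
  simp only [finsetSum_coeff, coeff_C_mul, coeff_X_pow, coeff_zero] at h5
  rw [Finset.sum_eq_single i] at h5
  · simp only [if_true, mul_one] at h5
    rcases mul_eq_zero.1 h5 with h | h
    · exact h
    · exfalso
      rw [ZMod.natCast_eq_zero_iff] at h
      have := Nat.le_of_dvd (by omega) h
      have := i.2
      omega
  · intro b _ hb
    rw [if_neg, mul_zero]
    intro h; apply hb; ext; omega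
  · simp

lemma nondeg (m l : ℕ) (hp : m + l < p) (ψ : Fin l → ℤ_[p][X]) (c c' : ℤ_[p])
    (hψ : ∀ j : Fin l, ∃ g, ψ j = (X - C c') ^ (m + 1 + (j : ℕ)) + C (p : ℤ_[p]) * g)
    (he : m = 0 ∨ ¬ (p : ℤ_[p]) ∣ c - c') : IsUnit (tay ψ c).det := by
  have hun : ∀ x : ℤ_[p], PadicInt.toZMod x ≠ 0 → IsUnit x := by
    intro x hx
    by_contra hu
    apply hx
    rw [← RingHom.mem_ker, PadicInt.ker_toZMod]
    exact (IsLocalRing.mem_maximalIdeal x).2 hu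
  apply hun
  rw [RingHom.map_det]
  have hpz : PadicInt.toZMod (p : ℤ_[p]) = 0 := by simp
  convert nondegF (p := p) m l hp (PadicInt.toZMod (c - c')) ?_ using 2
  · ext i j
    obtain ⟨g, hg⟩ := hψ i
    simp only [RingHom.mapMatrix_apply, Matrix.map_apply, tay, Matrix.of_apply]
    rw [hg, ← coeff_map]
    congr 1
    simp only [map_add, map_mul, taylor_pow, taylor_C, Polynomial.map_add, Polynomial.map_mul,
      Polynomial.map_pow, map_C, hpz, C_0, zero_mul, add_zero, taylor_mul]
    congr 1
    simp
    ring
  · rcases he with h | h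
    · exact Or.inl h
    · right
      intro h0
      apply h
      have : c - c' ∈ RingHom.ker (PadicInt.toZMod (p := p)) := h0
      rw [PadicInt.ker_toZMod, PadicInt.maximalIdeal_eq_span_p, Ideal.mem_span_singleton] at this
      exact this

lemma expand_of_deg (k : ℕ) (P : ℤ_[p][X]) (hP : P.natDegree ≤ k) :
    P = C (P.coeff 0) + ∑ j : Fin k, C (P.coeff ((j : ℕ) + 1)) * X ^ ((j : ℕ) + 1) := by
  conv_lhs => rw [P.as_sum_range' (k + 1) (by omega), Finset.sum_range_succ']
  rw [add_comm]
  congr 1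
  rw [← Fin.sum_univ_eq_sum_range (fun i => (monomial (i + 1)) (P.coeff (i + 1)))]
  simp [C_mul_X_pow_eq_monomial]

lemma expand_mon {k : ℕ} (φ : Fin k → ℤ_[p][X]) (hφ : Mon φ) (c : ℤ_[p]) (i : Fin k) :
    ∃ R : ℤ_[p][X], taylor c (φ i) = C ((taylor c (φ i)).coeff 0) +
      (∑ j : Fin k, C ((taylor c (φ i)).coeff ((j : ℕ) + 1)) * X ^ ((j : ℕ) + 1)) +
      X ^ (k + 1) * (C (p : ℤ_[p]) * R) := by
  obtain ⟨g, hg⟩ := hφ i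
  obtain ⟨R, hR⟩ := expand k (taylor c g)
  refine ⟨R, ?_⟩
  set P : ℤ_[p][X] := (X + C c) ^ ((i : ℕ) + 1) with hP
  have hT : taylor c (φ i) = P + C (p : ℤ_[p]) * taylor c g := by
    rw [hg, map_add, taylor_mul, taylor_pow, taylor_X, taylor_C]
  have hdeg : P.natDegree ≤ k := by
    rw [hP, natDegree_pow, natDegree_X_add_C]; have := i.2; omega
  have h1 := expand_of_deg k P hdeg
  have hc : ∀ n, (taylor c (φ i)).coeff n = P.coeff n + p * (taylor c g).coeff n := by
    intro n; rw [hT]; simp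
  simp only [hc, C_add, C_mul, add_mul, Finset.sum_add_distrib]
  rw [hT]
  nth_rewrite 1 [h1]
  nth_rewrite 1 [hR]
  rw [mul_add, mul_add, Finset.mul_sum]
  simp only [mul_assoc]
  ring

/-- Normalisation at a point. -/
lemma normalise {k : ℕ} (hp : k < p) (φ : Fin k → ℤ_[p][X]) (hφ : Mon φ) (c : ℤ_[p]) :
    IsUnit (tay φ c).det ∧ ∃ φ' : Fin k → ℤ_[p][X],
      (∀ j : Fin k, ∃ g, φ' j = (X - C c) ^ ((j : ℕ) + 1) + C (p : ℤ_[p]) * ((X - C c) ^ (k + 1) * g)) ∧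
      ∀ t, pt φ t = pt φ c + (tay φ c).mulVec (pt φ' t) := by
  classical
  have hW : IsUnit (tay φ c).det := by
    refine nondeg 0 k (by omega) φ c 0 (fun j => ?_) (Or.inl rfl)
    obtain ⟨g, hg⟩ := hφ j
    refine ⟨g, ?_⟩
    rw [hg]; simp [add_comm]
  refine ⟨hW, ?_⟩
  choose R hR using expand_mon φ hφ c
  set W := tay φ c with hWdef
  set R' : Fin k → ℤ_[p][X] := fun j => ∑ i, C (W⁻¹ j i) * R i with hR'
  refine ⟨fun j => (X - C c) ^ ((j : ℕ) + 1) + C (p : ℤ_[p]) * ((X - C c) ^ (k + 1) * (R' j).comp (X - C c)),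
    fun j => ⟨_, rfl⟩, fun t => ?_⟩
  have hRR : ∀ (h : ℤ_[p]) i, ∑ j, W i j * (R' j).eval h = (R i).eval h := by
    intro h i
    have h1 : (fun j => (R' j).eval h) = W⁻¹.mulVec (fun i => (R i).eval h) := by
      ext j; simp [hR', Matrix.mulVec, dotProduct, eval_finsetSum]
    have h2 : W.mulVec (fun j => (R' j).eval h) i = (R i).eval h := by
      rw [h1, Matrix.mulVec_mulVec, Matrix.mul_nonsing_inv W hW, Matrix.one_mulVec]
    simpa [Matrix.mulVec, dotProduct] using h2
  ext i
  have e1 : pt φ t i = (taylor c (φ i)).eval (t - c) := by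
    simp [pt, taylor_eval]
  rw [e1, hR i]
  simp only [eval_add, eval_C, eval_mul, eval_pow, eval_X, eval_finsetSum, Pi.add_apply,
    taylor_coeff_zero, Matrix.mulVec, dotProduct]
  rw [add_assoc]
  congr 1
  rw [← hRR (t - c) i, Finset.mul_sum, Finset.mul_sum, ← Finset.sum_add_distrib]
  refine Finset.sum_congr rfl fun j _ => ?_
  simp only [pt, eval_add, eval_C, eval_mul, eval_pow, eval_X, eval_comp, eval_sub, hWdef, tay]
  ring

end padic
end SFP

namespace SFP
open Finset
open scoped BigOperators

section padic
open Polynomial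

variable {p : ℕ} [Fact p.Prime]

/-- the shift by the last `l` coordinates -/
noncomputable def lastShift (m l B d : ℕ) (z : Fin l → ZMod (p ^ B)) :
    Fin (m + l) → ZMod (p ^ (B + d)) :=
  Fin.append 0 (fun j => (p : ZMod (p ^ (B + d))) ^ d * ((z j).val : ZMod (p ^ (B + d))))

lemma E_lastShift (m l B d : ℕ) (z : Fin l → ZMod (p ^ B)) (v : Fin (m + l) → ℤ_[p]) :
    E (B + d) (lastShift m l B d z) v = E B z (fun j => v (Fin.natAdd m j)) := by
  rw [← E_scale B d (fun _ => d) (fun _ => 0) (by simp)]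
  unfold E lastShift
  rw [Fin.sum_univ_add]
  simp

lemma E_eq_one {k : ℕ} (B : ℕ) (z : Fin k → ZMod (p ^ B)) (v : Fin k → ℤ_[p])
    (h : ∀ j, (p : ℤ_[p]) ^ B ∣ v j) : E B z v = 1 := by
  unfold E
  have : ∀ j, PadicInt.toZModPow B (v j) = 0 := by
    intro j
    have := (tz_eq_iff B (v j) 0).2 (by simpa using h j)
    simpa using this
  simp [this]

lemma lemL (m l : ℕ) (hl : 1 ≤ l) (hp : m + l < p) (φ : Fin (m + l) → ℤ_[p][X]) (hφ : Mon φ)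
    (a b c : ℕ) (ha : 1 ≤ a) (D : ℝ) (hD : 0 ≤ D) (hDec : Dec p l c D) (M : ℕ)
    (h1 : l * (a + c) ≤ (m + 1) * b) (h2 : (m + 1) * b ≤ M) (S S' : Finset ℕ) (A : ℕ → ℂ)
    (n : ℕ → ℤ_[p]) (c0 c0' : ℤ_[p]) (hc : ¬ (p : ℤ_[p]) ∣ c0 - c0')
    (hn : ∀ i ∈ S, (p : ℤ_[p]) ^ a ∣ n i - c0) (hn' : ∀ i ∈ S', (p : ℤ_[p]) ^ b ∣ n i - c0') (Q : ℕ) :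
    (𝔼 x, (sq M S' A (fun i => pt φ (n i)) x) ^ Q * (sq M S A (fun i => pt φ (n i)) x) ^ (tri l))
        ^ (1 / (tri l : ℝ)) ≤
      D * ∑ J : ZMod (p ^ (a + c)), (𝔼 x, (sq M S' A (fun i => pt φ (n i)) x) ^ Q *
        (sq M (cls S n (a + c) J) A (fun i => pt φ (n i)) x) ^ (tri l)) ^ (1 / (tri l : ℝ)) := by
  classical
  obtain ⟨hW, φ', hφ', hid⟩ := normalise hp φ hφ c0'
  obtain ⟨d, rfl⟩ : ∃ d, M = (m + 1) * b + d := ⟨M - (m + 1) * b, by omega⟩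
  set B := (m + 1) * b with hB
  set ψ : Fin l → ℤ_[p][X] := fun j => φ' (Fin.natAdd m j) with hψdef
  set w : ℕ → Fin (m + l) → ℤ_[p] := fun i => pt φ' (n i) with hw
  set A' : (Fin (m + l) → ZMod (p ^ (B + d))) → ℕ → ℂ := fun y i => A i * E (B + d) y (w i) with hA'
  have hψ : IsUnit (tay ψ c0).det := by
    refine nondeg m l hp ψ c0 c0' (fun j => ?_) (Or.inr hc)
    obtain ⟨g, hg⟩ := hφ' (Fin.natAdd m j)
    refine ⟨(X - C c0') ^ (m + l + 1) * g, hg.trans ?_⟩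
    simp only [Fin.val_natAdd]
    congr 2
    omega
  have hdvd : ∀ i ∈ S', ∀ j : Fin l, (p : ℤ_[p]) ^ B ∣ w i (Fin.natAdd m j) := by
    intro i hi j
    obtain ⟨g, hg⟩ := hφ' (Fin.natAdd m j)
    simp only [hw, pt, hg, eval_add, eval_mul, eval_pow, eval_sub, eval_X, eval_C, Fin.val_natAdd]
    have h3 : ∀ e, m + 1 ≤ e → (p : ℤ_[p]) ^ B ∣ (n i - c0') ^ e := by
      intro e he
      rw [hB, mul_comm, pow_mul]
      exact (pow_dvd_pow_of_dvd (hn' i hi) _).trans (pow_dvd_pow _ he)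
    refine dvd_add (h3 _ (by omega)) (Dvd.dvd.mul_left (Dvd.dvd.mul_right (h3 _ (by omega)) _) _)
  have shiftS : ∀ (T : Finset ℕ) y z, sq (B + d) T A w (y + lastShift m l B d z) =
      sq B T (A' y) (fun i => pt ψ (n i)) z := by
    intro T y z
    unfold sq fS
    congr 2
    refine Finset.sum_congr rfl fun i _ => ?_
    rw [E_add_left, E_lastShift]
    simp only [hA', hw, hψdef]
    rw [mul_assoc]; rfl
  have shiftS' : ∀ y z, sq (B + d) S' A w (y + lastShift m l B d z) = sq (B + d) S' A w y := by
    intro y z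
    unfold sq fS
    congr 2
    refine Finset.sum_congr rfl fun i hi => ?_
    rw [E_add_left, E_lastShift, E_eq_one B z _ (hdvd i hi), mul_one]
  have key : ∀ T : Finset ℕ, (𝔼 x, (sq (B + d) S' A (fun i => pt φ (n i)) x) ^ Q *
      (sq (B + d) T A (fun i => pt φ (n i)) x) ^ (tri l)) =
      𝔼 y, (sq (B + d) S' A w y) ^ Q * 𝔼 z, (sq B T (A' y) (fun i => pt ψ (n i)) z) ^ (tri l) := by
    intro T
    have haff : ∀ (T : Finset ℕ) x, sq (B + d) T A (fun i => pt φ (n i)) x =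
        sq (B + d) T A w (Matrix.vecMul x ((tay φ c0').map (PadicInt.toZModPow (B + d)))) := by
      intro T x
      refine sq_affine _ _ _ _ _ (pt φ c0') _ (fun i hi => ?_) x
      exact hid (n i)
    simp only [haff]
    rw [expect_vecMul (B + d) (tay φ c0') hW
      (fun x => (sq (B + d) S' A w x) ^ Q * (sq (B + d) T A w x) ^ tri l)]
    rw [expect_shift (Z := Fin l → ZMod (p ^ B)) _ (lastShift m l B d)]
    refine Finset.expect_congr rfl fun y _ => ?_
    rw [Finset.mul_expect]
    refine Finset.expect_congr rfl fun z _ => ?_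
    rw [shiftS', shiftS]
  simp only [key]
  refine fiberMink Finset.univ (tri l) (tri_pos hl) _ (fun y => pow_nonneg (sq_nonneg' _ _ _ _ _) _)
      (fun y z => sq B S (A' y) (fun i => pt ψ (n i)) z)
      (fun J y z => sq B (cls S n (a + c) J) (A' y) (fun i => pt ψ (n i)) z)
      (fun y z => sq_nonneg' _ _ _ _ _) (fun J y z => sq_nonneg' _ _ _ _ _) D hD ?_
  intro y
  exact lemR hl ψ c0 hψ a c ha D hD hDec B h1 S (A' y) n hn

end padic
end SFP

namespace SFP
open Finset
open scoped BigOperators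

section padic
open Polynomial

variable {p : ℕ} [Fact p.Prime] {k : ℕ}

noncomputable def Sig (B M : ℕ) (φ : Fin k → ℤ_[p][X]) (S : Finset ℕ) (A : ℕ → ℂ) (n : ℕ → ℤ_[p]) : ℝ :=
  ∑ J : ZMod (p ^ B), nrm M (cls S n B J) A (fun i => pt φ (n i))

lemma Sig_nonneg (B M : ℕ) (φ : Fin k → ℤ_[p][X]) (S : Finset ℕ) (A : ℕ → ℂ) (n : ℕ → ℤ_[p]) :
    0 ≤ Sig B M φ S A n := Finset.sum_nonneg fun _ _ => nrm_nonneg _ _ _ _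

lemma nrm_empty (hk : 1 ≤ k) (M : ℕ) (A : ℕ → ℂ) (v : ℕ → Fin k → ℤ_[p]) :
    nrm M ∅ A v = 0 := by
  have h1 := tri_pos hk
  unfold nrm sq fS
  have h2 : (tri k : ℝ) ≠ 0 := by positivity
  simp [show tri k ≠ 0 by omega, h2]

lemma fS_cls (M : ℕ) (S : Finset ℕ) (A : ℕ → ℂ) (v : ℕ → Fin k → ℤ_[p]) (n : ℕ → ℤ_[p]) (c : ℕ)
    (x : Fin k → ZMod (p ^ M)) :
    fS M S A v x = ∑ J : ZMod (p ^ c), fS M (cls S n c J) A v x := by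
  classical
  unfold fS cls
  exact (Finset.sum_fiberwise S (fun i => PadicInt.toZModPow c (n i)) _).symm

lemma sum_Sig_cls (hk : 1 ≤ k) (B M : ℕ) (φ : Fin k → ℤ_[p][X]) (S : Finset ℕ) (A : ℕ → ℂ)
    (n : ℕ → ℤ_[p]) (a : ℕ) (ha : a ≤ B) :
    ∑ J : ZMod (p ^ a), Sig B M φ (cls S n a J) A n = Sig B M φ S A n := by
  classical
  unfold Sig
  rw [Finset.sum_comm]
  refine Finset.sum_congr rfl fun J' _ => ?_
  rw [Finset.sum_eq_single (ZMod.castHom (pow_dvd_pow p ha) (ZMod (p ^ a)) J')]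
  · congr 1
    unfold cls
    ext i
    simp only [Finset.mem_filter]
    constructor
    · rintro ⟨⟨h1, _⟩, h2⟩; exact ⟨h1, h2⟩
    · rintro ⟨h1, h2⟩
      refine ⟨⟨h1, ?_⟩, h2⟩
      rw [← h2]
      simpa using (PadicInt.cast_toZModPow a B ha (n i)).symm
  · intro J _ hJ
    have : cls (cls S n a J) n B J' = ∅ := by
      unfold cls
      ext i
      simp only [Finset.mem_filter, Finset.notMem_empty, iff_false]
      rintro ⟨⟨_, h1⟩, h2⟩
      apply hJ
      rw [← h1, ← h2]
      simpa using (PadicInt.cast_toZModPow a B ha (n i)).symm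
    rw [this, nrm_empty hk]
  · simp

lemma Sig_cls_le (hk : 1 ≤ k) (B M : ℕ) (φ : Fin k → ℤ_[p][X]) (S : Finset ℕ) (A : ℕ → ℂ)
    (n : ℕ → ℤ_[p]) (a : ℕ) (ha : a ≤ B) (J : ZMod (p ^ a)) :
    Sig B M φ (cls S n a J) A n ≤ Sig B M φ S A n := by
  rw [← sum_Sig_cls hk B M φ S A n a ha]
  exact Finset.single_le_sum (f := fun J => Sig B M φ (cls S n a J) A n)
    (fun _ _ => Sig_nonneg _ _ _ _ _ _) (Finset.mem_univ J)

lemma nrm_pow (hk : 1 ≤ k) (M : ℕ) (S : Finset ℕ) (A : ℕ → ℂ) (v : ℕ → Fin k → ℤ_[p]) :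
    nrm M S A v ^ tri k = 𝔼 x, (sq M S A v x) ^ (tri k) := by
  unfold nrm
  rw [one_div]
  exact Real.rpow_inv_natCast_pow (Finset.expect_nonneg fun x _ => pow_nonneg (sq_nonneg' M S A v x) _)
    (by have := tri_pos hk; omega)

/-- decoupling within a class -/
lemma dec_in_cls (hk : 1 ≤ k) (hp : k < p) (φ : Fin k → ℤ_[p][X]) (hφ : Mon φ) (a c : ℕ)
    (ha : 1 ≤ a) (D : ℝ) (hD : 0 ≤ D) (hDec : Dec p k c D) (M : ℕ) (hM : k * (a + c) ≤ M)
    (S : Finset ℕ) (A : ℕ → ℂ) (n : ℕ → ℤ_[p]) (c0 : ℤ_[p]) (hn : ∀ i ∈ S, (p : ℤ_[p]) ^ a ∣ n i - c0) :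
    nrm M S A (fun i => pt φ (n i)) ≤ D * Sig (a + c) M φ S A n :=
  lemR hk φ c0 (normalise hp φ hφ c0).1 a c ha D hD hDec M hM S A n hn

variable (p) in
def Bil (k l a b B : ℕ) (X : ℝ) : Prop :=
  ∀ M : ℕ, k * B ≤ M → ∀ φ : Fin k → ℤ_[p][X], Mon φ → ∀ (S S' : Finset ℕ) (A : ℕ → ℂ) (n : ℕ → ℤ_[p])
    (c0 c0' : ℤ_[p]), ¬ (p : ℤ_[p]) ∣ c0 - c0' → (∀ i ∈ S, (p : ℤ_[p]) ^ a ∣ n i - c0) →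
    (∀ i ∈ S', (p : ℤ_[p]) ^ b ∣ n i - c0') →
    (𝔼 x, (sq M S' A (fun i => pt φ (n i)) x) ^ (tri k - tri l) *
      (sq M S A (fun i => pt φ (n i)) x) ^ (tri l)) ≤
      X * (Sig B M φ S' A n ^ (tri k - tri l) * Sig B M φ S A n ^ tri l)

lemma tri_mono {l k : ℕ} (h : l ≤ k) : tri l ≤ tri k := by
  unfold tri; exact Nat.div_le_div_right (Nat.mul_le_mul h (by omega))

/-- centre of a subclass -/
lemma cls_center (S : Finset ℕ) (n : ℕ → ℤ_[p]) (c0 c0' : ℤ_[p]) (a a' : ℕ) (ha : 1 ≤ a)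
    (hc : ¬ (p : ℤ_[p]) ∣ c0 - c0') (hn : ∀ i ∈ S, (p : ℤ_[p]) ^ a ∣ n i - c0) (J : ZMod (p ^ a')) :
    ∃ c1, ¬ (p : ℤ_[p]) ∣ c1 - c0' ∧ ∀ i ∈ cls S n a' J, (p : ℤ_[p]) ^ a' ∣ n i - c1 := by
  rcases (cls S n a' J).eq_empty_or_nonempty with h | ⟨i0, h⟩
  · exact ⟨c0, hc, by simp [h]⟩
  · have h' := h
    simp only [cls, Finset.mem_filter] at h'
    refine ⟨n i0, ?_, ?_⟩
    · intro hd
      apply hc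
      have h2 : (p : ℤ_[p]) ∣ n i0 - c0 := (dvd_pow_self _ (by omega)).trans (hn i0 h'.1)
      have : c0 - c0' = (n i0 - c0') - (n i0 - c0) := by ring
      rw [this]; exact dvd_sub hd h2
    · intro i hi
      simp only [cls, Finset.mem_filter] at hi
      rw [← tz_eq_iff, hi.2, h'.2]

lemma expect_nn (M : ℕ) (S S' : Finset ℕ) (A : ℕ → ℂ) (v : ℕ → Fin k → ℤ_[p]) (q r : ℕ) :
    0 ≤ 𝔼 x, (sq M S A v x) ^ q * (sq M S' A v x) ^ r :=
  Finset.expect_nonneg fun x _ =>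
    mul_nonneg (pow_nonneg (sq_nonneg' _ _ _ _ _) _) (pow_nonneg (sq_nonneg' _ _ _ _ _) _)

lemma stepL1 (l : ℕ) (hl : 1 ≤ l) (hlk : l ≤ k) (hp : k < p) (a a' b B : ℕ) (ha : 1 ≤ a)
    (haa : a ≤ a') (haB : a' ≤ B) (hbB : b ≤ B) (hcond : l * a' ≤ (k - l + 1) * b) (D : ℝ) (hD : 0 ≤ D)
    (hDec : Dec p l (a' - a) D) (X : ℝ) (hX : 0 ≤ X) (hB : Bil p k l a' b B X) :
    Bil p k l a b B (D ^ tri l * X) := by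
  intro M hM φ hφ S S' A n c0 c0' hc hn hn'
  have hk : 1 ≤ k := by omega
  obtain ⟨m, rfl⟩ : ∃ m, k = m + l := ⟨k - l, by omega⟩
  rw [Nat.add_sub_cancel] at hcond
  have e1 : a + (a' - a) = a' := by omega
  have ht := tri_pos hl
  have ht' : (tri l : ℝ) ≠ 0 := by positivity
  have h1 := lemL m l hl hp φ hφ a b (a' - a) ha D hD hDec M (by rw [e1]; exact hcond)
    (by
      have : (m + 1) * b ≤ (m + l) * B := Nat.mul_le_mul (by omega) hbB
      omega) S S' A n c0 c0' hc hn hn' (tri (m + l) - tri l)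
  rw [e1] at h1
  set Q := tri (m + l) - tri l with hQ
  have hS'0 := Sig_nonneg B M φ S' A n
  have h2 : ∀ J : ZMod (p ^ a'), (𝔼 x, (sq M S' A (fun i => pt φ (n i)) x) ^ Q *
        (sq M (cls S n a' J) A (fun i => pt φ (n i)) x) ^ (tri l)) ^ (1 / (tri l : ℝ)) ≤
        (X * Sig B M φ S' A n ^ Q) ^ (1 / (tri l : ℝ)) * Sig B M φ (cls S n a' J) A n := by
    intro J
    obtain ⟨c1, hc1, hn1⟩ := cls_center S n c0 c0' a a' ha hc hn J
    have h3 := hB M hM φ hφ (cls S n a' J) S' A n c1 c0' hc1 hn1 hn'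
    have hS0 := Sig_nonneg B M φ (cls S n a' J) A n
    refine (Real.rpow_le_rpow (expect_nn _ _ _ _ _ _ _) h3 (by positivity)).trans (le_of_eq ?_)
    rw [← mul_assoc, Real.mul_rpow (by positivity) (by positivity)]
    congr 1
    rw [one_div]
    exact Real.pow_rpow_inv_natCast hS0 (by omega)
  have h4 := h1.trans (mul_le_mul_of_nonneg_left (Finset.sum_le_sum fun J _ => h2 J) hD)
  rw [← Finset.mul_sum, sum_Sig_cls hk B M φ S A n a' haB] at h4
  have h5 := pow_le_pow_left₀ (Real.rpow_nonneg (expect_nn _ _ _ _ _ _ _) _) h4 (tri l)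
  rw [one_div, Real.rpow_inv_natCast_pow (expect_nn _ _ _ _ _ _ _) (by omega)] at h5
  refine h5.trans (le_of_eq ?_)
  rw [mul_pow, mul_pow, Real.rpow_inv_natCast_pow (by positivity) (by omega)]
  ring

lemma stepL2 (l : ℕ) (hl : 1 ≤ l) (hlk : l < k) (a b B : ℕ) (X1 X2 : ℝ) (h1 : 0 ≤ X1) (h2 : 0 ≤ X2)
    (hB1 : Bil p k (k - l) b a B X1) (hB2 : Bil p k (l - 1) a b B X2) :
    Bil p k l a b B (X1 ^ (1 / ((k - l : ℕ) + 1 : ℝ)) * X2 ^ (1 - 1 / ((k - l : ℕ) + 1 : ℝ))) := by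
  intro M hM φ hφ S S' A n c0 c0' hc hn hn'
  have e1 := hB1 M hM φ hφ S' S A n c0' c0 (by rwa [← dvd_neg, neg_sub]) hn' hn
  have e2 := hB2 M hM φ hφ S S' A n c0 c0' hc hn hn'
  obtain ⟨m, rfl⟩ : ∃ m, k = m + 1 + l := ⟨k - l - 1, by omega⟩
  obtain ⟨l, rfl⟩ : ∃ r, l = r + 1 := ⟨l - 1, by omega⟩
  rw [show m + 1 + (l + 1) - (l + 1) = m + 1 by omega] at *
  rw [show l + 1 - 1 = l by omega] at *
  generalize hK : m + 1 + (l + 1) = K at *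
  set θ : ℝ := 1 / (((m + 1 : ℕ) : ℝ) + 1) with hθ
  have hθ0 : 0 < θ := by positivity
  have hθ1 : θ < 1 := by
    rw [hθ, div_lt_one (by positivity)]; push_cast; linarith
  set u := sq M S A (fun i => pt φ (n i)) with hu
  set v := sq M S' A (fun i => pt φ (n i)) with hv
  have hu0 : ∀ x, 0 ≤ u x := fun x => sq_nonneg' _ _ _ _ _
  have hv0 : ∀ x, 0 ≤ v x := fun x => sq_nonneg' _ _ _ _ _
  have t1 : (tri K : ℝ) = (K : ℝ) * (K + 1) / 2 := by
    have := two_tri K; have h : (2 * tri K : ℝ) = K * (K + 1) := by exact_mod_cast this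
    linarith
  have t2 : (tri (l + 1) : ℝ) = (l + 1 : ℝ) * (l + 2) / 2 := by
    have := two_tri (l + 1); have h : (2 * tri (l + 1) : ℝ) = (l + 1) * (l + 1 + 1) := by exact_mod_cast this
    linarith
  have t3 : (tri l : ℝ) = (l : ℝ) * (l + 1) / 2 := by
    have := two_tri l; have h : (2 * tri l : ℝ) = l * (l + 1) := by exact_mod_cast this
    linarith
  have t4 : (tri (m + 1) : ℝ) = (m + 1 : ℝ) * (m + 2) / 2 := by
    have := two_tri (m + 1); have h : (2 * tri (m + 1) : ℝ) = (m + 1) * (m + 1 + 1) := by exact_mod_cast this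
    linarith
  have m1 : tri (l + 1) ≤ tri K := tri_mono (by omega)
  have m2 : tri l ≤ tri K := tri_mono (by omega)
  have m3 : tri (m + 1) ≤ tri K := tri_mono (by omega)
  have hθm : θ * (m + 2) = 1 := by
    rw [hθ]; push_cast; field_simp; ring
  have ex1 : (tri (l + 1) : ℝ) = ((tri K - tri (m + 1) : ℕ) : ℝ) * θ + (tri l : ℝ) * (1 - θ) := by
    rw [Nat.cast_sub m3, t1, t2, t3, t4, ← hK]; push_cast
    have : θ = 1 / (m + 2) := by field_simp; linarith
    rw [this]; field_simp; ring
  have ex2 : ((tri K - tri (l + 1) : ℕ) : ℝ) = (tri (m + 1) : ℝ) * θ + ((tri K - tri l : ℕ) : ℝ) * (1 - θ) := by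
    rw [Nat.cast_sub m1, Nat.cast_sub m2]
    rw [Nat.cast_sub m3] at ex1
    linarith
  have comb : ∀ x y : ℝ, 0 ≤ x → 0 ≤ y → y ^ (tri K - tri (l + 1)) * x ^ tri (l + 1) =
      (x ^ (tri K - tri (m + 1)) * y ^ tri (m + 1)) ^ θ * (y ^ (tri K - tri l) * x ^ tri l) ^ (1 - θ) := by
    intro x y hx hy
    have h1' : 0 < 1 - θ := by linarith
    rw [Real.mul_rpow (by positivity) (by positivity), Real.mul_rpow (by positivity) (by positivity)]
    simp only [← Real.rpow_natCast]
    simp only [← Real.rpow_mul hx, ← Real.rpow_mul hy]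
    rw [ex1, ex2, Real.rpow_add_of_nonneg hx (by positivity) (by positivity),
      Real.rpow_add_of_nonneg hy (by positivity) (by positivity)]
    ring
  simp only [fun x => comb (u x) (v x) (hu0 x) (hv0 x)]
  have hh := holder θ hθ0 hθ1 (fun x => (u x) ^ (tri K - tri (m + 1)) * (v x) ^ tri (m + 1))
    (fun x => (v x) ^ (tri K - tri l) * (u x) ^ tri l)
    (fun x => mul_nonneg (pow_nonneg (hu0 x) _) (pow_nonneg (hv0 x) _))
    (fun x => mul_nonneg (pow_nonneg (hv0 x) _) (pow_nonneg (hu0 x) _))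
  refine hh.trans ?_
  have hs := Sig_nonneg B M φ S A n
  have hs' := Sig_nonneg B M φ S' A n
  have h1' : 0 < 1 - θ := by linarith
  have r1 := Real.rpow_le_rpow (expect_nn _ _ _ _ _ _ _) e1 hθ0.le
  have r2 := Real.rpow_le_rpow (expect_nn _ _ _ _ _ _ _) e2 h1'.le
  refine (mul_le_mul r1 r2 (Real.rpow_nonneg (expect_nn _ _ _ _ _ _ _) _) (by positivity)).trans (le_of_eq ?_)
  rw [comb _ _ hs hs', Real.mul_rpow h1 (by positivity), Real.mul_rpow h2 (by positivity)]
  ring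

lemma bil_zero (hk : 1 ≤ k) (hp : k < p) (a b B : ℕ) (hb : 1 ≤ b) (hbB : b ≤ B) (D : ℝ) (hD : 0 ≤ D)
    (hDec : Dec p k (B - b) D) : Bil p k 0 a b B (D ^ tri k) := by
  intro M hM φ hφ S S' A n c0 c0' hc hn hn'
  have e1 : b + (B - b) = B := by omega
  have h1 := dec_in_cls hk hp φ hφ b (B - b) hb D hD hDec M (by rw [e1]; exact hM) S' A n c0' hn'
  rw [e1] at h1
  have h2 := pow_le_pow_left₀ (nrm_nonneg _ _ _ _) h1 (tri k)
  rw [nrm_pow hk] at h2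
  simpa [tri, mul_pow] using h2

lemma bil_triv (l : ℕ) (hl : 1 ≤ l) (hlk : l < k) (hp : k < p) (a b B : ℕ) (ha : 1 ≤ a) (haB : a ≤ B)
    (hb : 1 ≤ b) (hbB : b ≤ B) (D : ℝ) (hD : 0 ≤ D)
    (hDec : Dec p k (B - b) D) (hDec' : Dec p k (B - a) D) : Bil p k l a b B (D ^ tri k) := by
  intro M hM φ hφ S S' A n c0 c0' hc hn hn'
  have hk : 1 ≤ k := by omega
  have e1 : b + (B - b) = B := by omega
  have h1 := dec_in_cls hk hp φ hφ b (B - b) hb D hD hDec M (by rw [e1]; exact hM) S' A n c0' hn'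
  have e2 : a + (B - a) = B := by omega
  have h2 := dec_in_cls hk hp φ hφ a (B - a) ha D hD hDec' M (by rw [e2]; exact hM) S A n c0 hn
  rw [e1] at h1
  rw [e2] at h2
  have t0 := tri_pos hk
  have t1 := tri_pos hl
  have m1 : tri l < tri k := by
    have h3 := two_tri l; have h4 := two_tri k; nlinarith
  set θ : ℝ := (tri l : ℝ) / tri k with hθ
  have hk0 : (0 : ℝ) < tri k := by positivity
  have hθ0 : 0 < θ := by positivity
  have hθ1 : θ < 1 := by rw [hθ, div_lt_one hk0]; exact_mod_cast m1
  set u := sq M S A (fun i => pt φ (n i)) with hu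
  set v := sq M S' A (fun i => pt φ (n i)) with hv
  have hu0 : ∀ x, 0 ≤ u x := fun x => sq_nonneg' _ _ _ _ _
  have hv0 : ∀ x, 0 ≤ v x := fun x => sq_nonneg' _ _ _ _ _
  have comb : ∀ x y : ℝ, 0 ≤ x → 0 ≤ y → y ^ (tri k - tri l) * x ^ tri l =
      (x ^ tri k) ^ θ * (y ^ tri k) ^ (1 - θ) := by
    intro x y hx hy
    simp only [← Real.rpow_natCast]
    simp only [← Real.rpow_mul hx, ← Real.rpow_mul hy]
    have q1 : (tri k : ℝ) * θ = tri l := by rw [hθ]; field_simp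
    have q2 : (tri k : ℝ) * (1 - θ) = (tri k - tri l : ℕ) := by
      rw [Nat.cast_sub m1.le, mul_sub, q1]; ring
    rw [q1, q2]; ring
  simp only [fun x => comb (u x) (v x) (hu0 x) (hv0 x)]
  refine (holder θ hθ0 hθ1 (fun x => (u x) ^ tri k) (fun x => (v x) ^ tri k)
    (fun x => pow_nonneg (hu0 x) _) (fun x => pow_nonneg (hv0 x) _)).trans ?_
  rw [hu, hv, ← nrm_pow hk, ← nrm_pow hk, ← comb _ _ (nrm_nonneg _ _ _ _) (nrm_nonneg _ _ _ _)]
  have hs := Sig_nonneg B M φ S A n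
  have hs' := Sig_nonneg B M φ S' A n
  refine (mul_le_mul (pow_le_pow_left₀ (nrm_nonneg _ _ _ _) h1 _)
    (pow_le_pow_left₀ (nrm_nonneg _ _ _ _) h2 _) (pow_nonneg (nrm_nonneg _ _ _ _) _) (by positivity)).trans
    (le_of_eq ?_)
  rw [mul_pow, mul_pow]
  have : D ^ tri k = D ^ (tri k - tri l) * D ^ tri l := by rw [← pow_add]; congr 1; omega
  rw [this]; ring

end padic
end SFP

namespace SFP
open Finset
open scoped BigOperators

section padic
open Polynomial

variable {p : ℕ} [Fact p.Prime] {k : ℕ}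

lemma dec_triv (hk : 1 ≤ k) (c : ℕ) : Dec p k c ((p : ℝ) ^ c) := by
  classical
  intro M hM φ hφ S A n
  have ht := tri_pos hk
  set v := fun i => pt φ (n i) with hv
  have h1 : ∀ x, sq M S A v x ≤ ∑ J : ZMod (p ^ c), (p : ℝ) ^ c * sq M (cls S n c J) A v x := by
    intro x
    unfold sq
    rw [fS_cls M S A v n c x, ← Finset.mul_sum]
    refine (pow_le_pow_left₀ (norm_nonneg _) (norm_sum_le _ _) 2).trans ?_
    have := sq_sum_le_card_mul_sum_sq (s := (Finset.univ : Finset (ZMod (p ^ c))))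
      (f := fun J => ‖fS M (cls S n c J) A v x‖)
    simpa [ZMod.card] using this
  have h2 := mink (Finset.univ : Finset (ZMod (p ^ c))) (tri k) ht
    (fun _ : Fin k → ZMod (p ^ M) => (1 : ℝ)) (fun _ => zero_le_one)
    (fun J x => (p : ℝ) ^ c * sq M (cls S n c J) A v x) (fun J x => mul_nonneg (by positivity) (sq_nonneg' _ _ _ _ _))
  simp only [one_mul] at h2
  have h3 : nrm M S A v ≤ (𝔼 x, (∑ J : ZMod (p ^ c), (p : ℝ) ^ c * sq M (cls S n c J) A v x) ^ tri k) ^ (1 / (tri k : ℝ)) := by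
    unfold nrm
    refine Real.rpow_le_rpow (Finset.expect_nonneg fun x _ => pow_nonneg (sq_nonneg' M S A v x) _) ?_ (by positivity)
    exact Finset.expect_le_expect fun x _ => pow_le_pow_left₀ (sq_nonneg' _ _ _ _ _) (h1 x) _
  refine h3.trans (h2.trans (le_of_eq ?_))
  rw [Finset.mul_sum]
  refine Finset.sum_congr rfl fun J _ => ?_
  unfold nrm
  simp only [mul_pow, ← Finset.mul_expect]
  rw [Real.mul_rpow (by positivity) (Finset.expect_nonneg fun x _ => pow_nonneg (sq_nonneg' _ _ _ _ _) _)]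
  congr 1
  rw [one_div]
  exact Real.pow_rpow_inv_natCast (by positivity) (by omega)

lemma bil_to_dec (l : ℕ) (hl : 1 ≤ l) (hlk : l < k) (hp : k < p) (B : ℕ) (hB : 1 ≤ B) (X : ℝ) (hX : 0 ≤ X)
    (hbil : Bil p k l 1 1 B X) (D0 : ℝ) (hD0 : 0 ≤ D0) (hDec : Dec p k (B - 1) D0) :
    Dec p k B (D0 + (p : ℝ) ^ 2 * X ^ (1 / (tri k : ℝ))) := by
  classical
  intro M hM φ hφ S A n
  have hk : 1 ≤ k := by omega
  have ht := tri_pos hk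
  have m1 : tri l ≤ tri k := tri_mono hlk.le
  set v := fun i => pt φ (n i) with hv
  set g : ZMod (p ^ 1) → (Fin k → ZMod (p ^ M)) → ℝ := fun I x => ‖fS M (cls S n 1 I) A v x‖ with hg
  have hg0 : ∀ I x, 0 ≤ g I x := fun I x => norm_nonneg _
  set Sg := Sig B M φ S A n with hSg
  have hSg0 : 0 ≤ Sg := Sig_nonneg _ _ _ _ _ _
  have hmem : ∀ I : ZMod (p ^ 1), ∀ i ∈ cls S n 1 I, (p : ℤ_[p]) ^ 1 ∣ n i - (I.val : ℤ_[p]) := by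
    intro I i hi
    simp only [cls, Finset.mem_filter] at hi
    rw [← tz_eq_iff, hi.2]; simp
  have h1 : ∀ x, sq M S A v x ≤ ∑ P : ZMod (p ^ 1) × ZMod (p ^ 1), g P.1 x * g P.2 x := by
    intro x
    unfold sq
    rw [fS_cls M S A v n 1 x]
    refine (pow_le_pow_left₀ (norm_nonneg _) (norm_sum_le _ _) 2).trans (le_of_eq ?_)
    rw [pow_two, Finset.sum_mul_sum, Fintype.sum_prod_type]
  have h2 := mink (Finset.univ : Finset (ZMod (p ^ 1) × ZMod (p ^ 1))) (tri k) ht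
    (fun _ : Fin k → ZMod (p ^ M) => (1 : ℝ)) (fun _ => zero_le_one)
    (fun P x => g P.1 x * g P.2 x) (fun P x => mul_nonneg (hg0 _ _) (hg0 _ _))
  simp only [one_mul] at h2
  have h3 : nrm M S A v ≤ (𝔼 x, (∑ P : ZMod (p ^ 1) × ZMod (p ^ 1), g P.1 x * g P.2 x) ^ tri k) ^ (1 / (tri k : ℝ)) := by
    unfold nrm
    refine Real.rpow_le_rpow (Finset.expect_nonneg fun x _ => pow_nonneg (sq_nonneg' M S A v x) _) ?_ (by positivity)
    exact Finset.expect_le_expect fun x _ => pow_le_pow_left₀ (sq_nonneg' _ _ _ _ _) (h1 x) _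
  have hterm : ∀ P : ZMod (p ^ 1) × ZMod (p ^ 1),
      (𝔼 x, (g P.1 x * g P.2 x) ^ tri k) ^ (1 / (tri k : ℝ)) ≤
        (if P.1 = P.2 then D0 * Sig B M φ (cls S n 1 P.1) A n else 0) + X ^ (1 / (tri k : ℝ)) * Sg := by
    rintro ⟨I, I'⟩
    dsimp only
    have hXn : 0 ≤ X ^ (1 / (tri k : ℝ)) * Sg := mul_nonneg (Real.rpow_nonneg hX _) hSg0
    by_cases hII : I = I'
    · subst hII
      rw [if_pos rfl]
      have h4 : (𝔼 x, (g I x * g I x) ^ tri k) ^ (1 / (tri k : ℝ)) = nrm M (cls S n 1 I) A v := by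
        unfold nrm sq; simp only [hg, pow_two]
      rw [h4]
      have e1 : 1 + (B - 1) = B := by omega
      have h5 := dec_in_cls hk hp φ hφ 1 (B - 1) le_rfl D0 hD0 hDec M (by rw [e1]; exact hM) (cls S n 1 I) A n
        (I.val : ℤ_[p]) (hmem I)
      rw [e1] at h5
      linarith
    · rw [if_neg hII, zero_add]
      have hnd : ∀ J J' : ZMod (p ^ 1), J ≠ J' → ¬ (p : ℤ_[p]) ∣ (J.val : ℤ_[p]) - (J'.val : ℤ_[p]) := by
        intro J J' hJ hd
        have := (tz_eq_iff 1 (J.val : ℤ_[p]) (J'.val : ℤ_[p])).2 (by simpa using hd)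
        apply hJ; simpa using this
      have b1 := hbil M hM φ hφ (cls S n 1 I) (cls S n 1 I') A n _ _ (hnd I I' hII) (hmem I) (hmem I')
      have b2 := hbil M hM φ hφ (cls S n 1 I') (cls S n 1 I) A n _ _ (hnd I' I (Ne.symm hII)) (hmem I') (hmem I)
      have s1 := Sig_cls_le hk B M φ S A n 1 hB I
      have s2 := Sig_cls_le hk B M φ S A n 1 hB I'
      have n1 := Sig_nonneg B M φ (cls S n 1 I) A n
      have n2 := Sig_nonneg B M φ (cls S n 1 I') A n
      have epow : Sg ^ (tri k - tri l) * Sg ^ tri l = Sg ^ tri k := by rw [← pow_add]; congr 1; omega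
      have c1 : X * (Sig B M φ (cls S n 1 I') A n ^ (tri k - tri l) * Sig B M φ (cls S n 1 I) A n ^ tri l) ≤ X * Sg ^ tri k := by
        rw [← epow]; gcongr
      have c2 : X * (Sig B M φ (cls S n 1 I) A n ^ (tri k - tri l) * Sig B M φ (cls S n 1 I') A n ^ tri l) ≤ X * Sg ^ tri k := by
        rw [← epow]; gcongr
      have hh := holder (1 / 2) (by norm_num) (by norm_num)
        (fun x => (sq M (cls S n 1 I') A v x) ^ (tri k - tri l) * (sq M (cls S n 1 I) A v x) ^ tri l)
        (fun x => (sq M (cls S n 1 I) A v x) ^ (tri k - tri l) * (sq M (cls S n 1 I') A v x) ^ tri l)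
        (fun x => mul_nonneg (pow_nonneg (sq_nonneg' _ _ _ _ _) _) (pow_nonneg (sq_nonneg' _ _ _ _ _) _))
        (fun x => mul_nonneg (pow_nonneg (sq_nonneg' _ _ _ _ _) _) (pow_nonneg (sq_nonneg' _ _ _ _ _) _))
      have hcomb : ∀ x, (g I x * g I' x) ^ tri k =
          ((sq M (cls S n 1 I') A v x) ^ (tri k - tri l) * (sq M (cls S n 1 I) A v x) ^ tri l) ^ (1 / 2 : ℝ) *
          ((sq M (cls S n 1 I) A v x) ^ (tri k - tri l) * (sq M (cls S n 1 I') A v x) ^ tri l) ^ (1 - 1 / 2 : ℝ) := by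
        intro x
        have g1 := hg0 I x
        have g2 := hg0 I' x
        rw [show (1 - 1 / 2 : ℝ) = 1 / 2 by norm_num]
        have q1 : sq M (cls S n 1 I) A v x = g I x ^ 2 := rfl
        have q2 : sq M (cls S n 1 I') A v x = g I' x ^ 2 := rfl
        rw [q1, q2, ← Real.mul_rpow (by positivity) (by positivity), ← Real.sqrt_eq_rpow]
        symm
        rw [Real.sqrt_eq_iff_mul_self_eq (by positivity) (by positivity)]
        have e3 : tri k = (tri k - tri l) + tri l := by omega
        generalize tri k - tri l = Q at *
        rw [e3]; ring
      simp only [hcomb]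
      have e4 : X ^ (1 / (tri k : ℝ)) * Sg = (X * Sg ^ tri k) ^ (1 / (tri k : ℝ)) := by
        rw [Real.mul_rpow hX (by positivity)]
        congr 1
        rw [one_div]; exact (Real.pow_rpow_inv_natCast hSg0 (by omega)).symm
      rw [e4]
      refine Real.rpow_le_rpow (Finset.expect_nonneg fun x _ => ?_) (hh.trans ?_) (by positivity)
      · rw [← hcomb x]; exact pow_nonneg (mul_nonneg (hg0 _ _) (hg0 _ _)) _
      · have r1 := Real.rpow_le_rpow (expect_nn _ _ _ _ _ _ _) (b1.trans c1) (show (0 : ℝ) ≤ 1 / 2 by norm_num)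
        have r2 := Real.rpow_le_rpow (expect_nn _ _ _ _ _ _ _) (b2.trans c2) (show (0 : ℝ) ≤ 1 - 1 / 2 by norm_num)
        refine (mul_le_mul r1 r2 (Real.rpow_nonneg (expect_nn _ _ _ _ _ _ _) _) (by positivity)).trans (le_of_eq ?_)
        rw [← Real.rpow_add_of_nonneg (by positivity) (by norm_num) (by norm_num)]
        norm_num
  refine h3.trans (h2.trans ((Finset.sum_le_sum fun P _ => hterm P).trans (le_of_eq ?_)))
  rw [Finset.sum_add_distrib, Fintype.sum_prod_type]
  simp only [Finset.sum_ite_eq, Finset.mem_univ, if_true, ← Finset.mul_sum]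
  rw [sum_Sig_cls hk B M φ S A n 1 hB, Finset.sum_const, Finset.card_univ, Fintype.card_prod, ZMod.card]
  simp only [hSg, Sig, nsmul_eq_mul]
  push_cast
  ring

lemma sum_pow_le {ι : Type*} [Fintype ι] [Nonempty ι] (g : ι → ℝ) (hg : ∀ i, 0 ≤ g i) (m : ℕ) :
    (∑ i, g i) ^ m ≤ (Fintype.card ι : ℝ) ^ m * ∑ i, g i ^ m := by
  obtain ⟨i0, _, hi0⟩ := Finset.exists_max_image (Finset.univ : Finset ι) g Finset.univ_nonempty
  have h1 : ∑ i, g i ≤ Fintype.card ι * g i0 := by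
    have := Finset.sum_le_card_nsmul Finset.univ g (g i0) (fun i hi => hi0 i hi)
    simpa using this
  refine (pow_le_pow_left₀ (Finset.sum_nonneg fun i _ => hg i) h1 m).trans ?_
  rw [mul_pow]
  refine mul_le_mul_of_nonneg_left ?_ (by positivity)
  exact Finset.single_le_sum (f := fun i => g i ^ m) (fun i _ => pow_nonneg (hg i) _) (Finset.mem_univ i0)

lemma sq_pow_le (M : ℕ) (S : Finset ℕ) (A : ℕ → ℂ) (v : ℕ → Fin k → ℤ_[p]) (n : ℕ → ℤ_[p]) (c q : ℕ)
    (x : Fin k → ZMod (p ^ M)) : sq M S A v x ^ q ≤ ((p : ℝ) ^ c) ^ (2 * q) *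
      ∑ J : ZMod (p ^ c), sq M (cls S n c J) A v x ^ q := by
  unfold sq
  rw [fS_cls M S A v n c x]
  simp only [← pow_mul]
  refine (pow_le_pow_left₀ (norm_nonneg _) (norm_sum_le _ _) _).trans ?_
  have := sum_pow_le (fun J : ZMod (p ^ c) => ‖fS M (cls S n c J) A v x‖) (fun _ => norm_nonneg _) (2 * q)
  rw [ZMod.card] at this
  simpa [pow_mul] using this

lemma bil_loss (l : ℕ) (hk : 1 ≤ k) (a b B : ℕ) (haB : a ≤ B) (hbB : b ≤ B) (X : ℝ) (hX : 0 ≤ X)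
    (hbil : Bil p k l a b B X) :
    Bil p k l 1 1 B ((p : ℝ) ^ ((2 * tri l + 1) * a + (2 * (tri k - tri l) + 1) * b) * X) := by
  classical
  intro M hM φ hφ S S' A n c0 c0' hc hn hn'
  set v := fun i => pt φ (n i) with hv
  set Q := tri k - tri l with hQ
  have hc' : ¬ (p : ℤ_[p]) ∣ c0' - c0 := by rwa [← dvd_neg, neg_sub]
  have s0 := Sig_nonneg B M φ S A n
  have s0' := Sig_nonneg B M φ S' A n
  have hterm : ∀ (J' : ZMod (p ^ b)) (J : ZMod (p ^ a)),
      (𝔼 x, sq M (cls S' n b J') A v x ^ Q * sq M (cls S n a J) A v x ^ tri l) ≤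
      X * (Sig B M φ S' A n ^ Q * Sig B M φ S A n ^ tri l) := by
    intro J' J
    obtain ⟨c1, hc1, h1⟩ := cls_center S n c0 c0' 1 a le_rfl hc hn J
    obtain ⟨c2, hc2, h2⟩ := cls_center S' n c0' c1 1 b le_rfl (by rwa [← dvd_neg, neg_sub]) hn' J'
    have h3 := hbil M hM φ hφ (cls S n a J) (cls S' n b J') A n c1 c2 (by rwa [← dvd_neg, neg_sub]) h1 h2
    refine h3.trans ?_
    have s1 := Sig_cls_le hk B M φ S A n a haB J
    have s2 := Sig_cls_le hk B M φ S' A n b hbB J'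
    have n1 := Sig_nonneg B M φ (cls S n a J) A n
    have n2 := Sig_nonneg B M φ (cls S' n b J') A n
    gcongr
  have h4 : (𝔼 x, sq M S' A v x ^ Q * sq M S A v x ^ tri l) ≤
      𝔼 x, ∑ J' : ZMod (p ^ b), ∑ J : ZMod (p ^ a), (((p : ℝ) ^ b) ^ (2 * Q) * ((p : ℝ) ^ a) ^ (2 * tri l)) *
        (sq M (cls S' n b J') A v x ^ Q * sq M (cls S n a J) A v x ^ tri l) := by
    refine Finset.expect_le_expect fun x _ => ?_
    have h5 := sq_pow_le M S' A v n b Q x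
    have h6 := sq_pow_le M S A v n a (tri l) x
    refine (mul_le_mul h5 h6 (pow_nonneg (sq_nonneg' _ _ _ _ _) _)
      (mul_nonneg (by positivity) (Finset.sum_nonneg fun _ _ => pow_nonneg (sq_nonneg' _ _ _ _ _) _))).trans (le_of_eq ?_)
    simp only [← Finset.mul_sum]
    rw [← Finset.sum_mul]
    ring
  refine h4.trans ?_
  rw [Finset.expect_sum_comm]
  simp only [Finset.expect_sum_comm, ← Finset.mul_expect]
  refine (Finset.sum_le_sum fun J' _ => Finset.sum_le_sum fun J _ =>
    mul_le_mul_of_nonneg_left (hterm J' J) (by positivity)).trans (le_of_eq ?_)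
  simp only [Finset.sum_const, Finset.card_univ, ZMod.card, nsmul_eq_mul]
  push_cast
  ring

/-- the linear case -/
lemma dec_one (c : ℕ) : Dec p 1 c 1 := by
  classical
  intro M hM φ hφ S A n
  obtain ⟨g, hg⟩ := hφ 0
  set v := fun i => pt φ (n i) with hv
  have hn0 : ∀ S', nrm M S' A v = 𝔼 x, sq M S' A v x := by
    intro S'; unfold nrm; simp [tri]
  simp only [hn0]
  rw [one_mul, ← Finset.expect_sum_comm]
  -- Complex computation
  have hp0 : (p : ℤ_[p]) ≠ 0 := by exact_mod_cast (Fact.out : p.Prime).ne_zero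
  have horth : ∀ i j, PadicInt.toZModPow c (n i) ≠ PadicInt.toZModPow c (n j) →
      ∑ x, E M x (v i) * (starRingEnd ℂ) (E M x (v j)) = 0 := by
    intro i j hij
    have hne : PadicInt.toZModPow M (v i 0) - PadicInt.toZModPow M (v j 0) ≠ 0 := by
      intro h0
      rw [sub_eq_zero, tz_eq_iff] at h0
      apply hij
      rw [tz_eq_iff]
      have h1 : v i 0 - v j 0 = (n i - n j) + p * (g.eval (n i) - g.eval (n j)) := by
        simp only [hv, pt, hg]; simp; ring
      obtain ⟨w, hw⟩ := sub_dvd_eval_sub (n i) (n j) g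
      rw [h1, hw, show n i - n j + (p : ℤ_[p]) * ((n i - n j) * w) = (n i - n j) * (1 + p * w) by ring] at h0
      have hu : IsUnit (1 + (p : ℤ_[p]) * w) := by
        by_contra hnu
        have m1 : (1 + (p : ℤ_[p]) * w) ∈ IsLocalRing.maximalIdeal ℤ_[p] := hnu
        rw [PadicInt.maximalIdeal_eq_span_p, Ideal.mem_span_singleton] at m1
        have : (p : ℤ_[p]) ∣ 1 := by
          have := dvd_sub m1 (dvd_mul_right (p : ℤ_[p]) w)
          simpa using this
        exact PadicInt.prime_p.not_isUnit (isUnit_of_dvd_one this)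
      have h2 := (hu.dvd_mul_right).1 h0
      exact (pow_dvd_pow _ (by omega)).trans h2
    have h3 : ∀ x : Fin 1 → ZMod (p ^ M), E M x (v i) * (starRingEnd ℂ) (E M x (v j)) =
        ZMod.stdAddChar (x 0 * (PadicInt.toZModPow M (v i 0) - PadicInt.toZModPow M (v j 0))) := by
      intro x
      unfold E
      rw [← AddChar.map_neg_eq_conj, ← AddChar.map_add_eq_mul]
      congr 1
      simp; ring
    simp only [h3]
    rw [← (Equiv.funUnique (Fin 1) (ZMod (p ^ M))).symm.sum_comp]
    simp only [Equiv.funUnique_symm_apply, uniqueElim_const]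
    have h4 := AddChar.sum_mulShift (ψ := ZMod.stdAddChar (N := p ^ M))
      (PadicInt.toZModPow M (v i 0) - PadicInt.toZModPow M (v j 0)) (ZMod.isPrimitive_stdAddChar _)
    rw [if_neg hne] at h4
    simpa using h4
  have hcross : ∀ J J' : ZMod (p ^ c), J ≠ J' →
      ∑ x, fS M (cls S n c J) A v x * (starRingEnd ℂ) (fS M (cls S n c J') A v x) = 0 := by
    intro J J' hJ
    unfold fS
    simp only [map_sum, map_mul, Finset.sum_mul_sum]
    rw [Finset.sum_comm]
    refine Finset.sum_eq_zero fun i hi => ?_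
    rw [Finset.sum_comm]
    refine Finset.sum_eq_zero fun j hj => ?_
    simp only [cls, Finset.mem_filter] at hi hj
    have h5 := horth i j (by rw [hi.2, hj.2]; exact hJ)
    have : ∀ x, A i * E M x (v i) * ((starRingEnd ℂ) (A j) * (starRingEnd ℂ) (E M x (v j))) =
        (A i * (starRingEnd ℂ) (A j)) * (E M x (v i) * (starRingEnd ℂ) (E M x (v j))) := fun x => by ring
    simp only [this, ← Finset.mul_sum, h5, mul_zero]
  have hfin : (∑ x, (sq M S A v x : ℂ)) = ∑ x, ∑ J : ZMod (p ^ c), (sq M (cls S n c J) A v x : ℂ) := by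
    have hsq : ∀ (T : Finset ℕ) x, (sq M T A v x : ℂ) = fS M T A v x * (starRingEnd ℂ) (fS M T A v x) := by
      intro T x
      unfold sq
      rw [Complex.mul_conj, Complex.normSq_eq_norm_sq]
    simp only [hsq]
    have : ∀ x, fS M S A v x * (starRingEnd ℂ) (fS M S A v x) = ∑ J : ZMod (p ^ c), ∑ J' : ZMod (p ^ c),
        fS M (cls S n c J) A v x * (starRingEnd ℂ) (fS M (cls S n c J') A v x) := by
      intro x
      rw [fS_cls M S A v n c x, map_sum, Finset.sum_mul_sum]
    simp only [this]
    rw [Finset.sum_comm, Finset.sum_comm (s := (Finset.univ : Finset (Fin 1 → ZMod (p ^ M))))]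
    refine Finset.sum_congr rfl fun J _ => ?_
    rw [Finset.sum_comm, Finset.sum_eq_single J]
    · intro J' _ hJ'
      exact hcross J J' (Ne.symm hJ')
    · simp
  have hreal : (∑ x, sq M S A v x) = ∑ x, ∑ J : ZMod (p ^ c), sq M (cls S n c J) A v x := by
    exact_mod_cast hfin
  rw [Fintype.expect_eq_sum_div_card, Fintype.expect_eq_sum_div_card, hreal]

end padic
end SFP

namespace SFP
open Finset
open scoped BigOperators

section padic
open Polynomial

variable {p : ℕ} [Fact p.Prime] {k : ℕ}

lemma Dec.mono {c : ℕ} {D D' : ℝ} (h : Dec p k c D) (hD : D ≤ D') : Dec p k c D' :=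
  fun M hM φ hφ S a n => (h M hM φ hφ S a n).trans
    (mul_le_mul_of_nonneg_right hD (Finset.sum_nonneg fun _ _ => nrm_nonneg _ _ _ _))

lemma Bil.mono {l a b B : ℕ} {X X' : ℝ} (h : Bil p k l a b B X) (hX : X ≤ X') : Bil p k l a b B X' :=
  fun M hM φ hφ S S' A n c0 c0' hc hn hn' => (h M hM φ hφ S S' A n c0 c0' hc hn hn').trans
    (mul_le_mul_of_nonneg_right hX (mul_nonneg (pow_nonneg (Sig_nonneg _ _ _ _ _ _) _)
      (pow_nonneg (Sig_nonneg _ _ _ _ _ _) _)))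

noncomputable def lam (k : ℕ) (η0 : ℝ) : ℕ → ℕ → ℝ
  | 0, l => if l = 0 then η0 else 0
  | (n + 1), l => if l = 0 then η0 else
      lam k η0 n (k - l) / l + (1 - 1 / ((k - l : ℕ) + 1 : ℝ)) * lam k η0 n (l - 1)

lemma lam_zero (k : ℕ) (η0 : ℝ) (n : ℕ) : lam k η0 n 0 = η0 := by
  cases n <;> simp [lam]

lemma lam_sum (K : ℕ) (η0 : ℝ) (n : ℕ) :
    ∑ i ∈ range K, lam (K + 1) η0 n (i + 1) = n * (K / (K + 1) * η0) := by
  induction n with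
  | zero => simp [lam]
  | succ n ih =>
    have h1 : ∑ i ∈ range K, lam (K + 1) η0 (n + 1) (i + 1) =
        ∑ i ∈ range K, lam (K + 1) η0 n (K - i) / ((i : ℝ) + 1) +
        ∑ i ∈ range K, (1 - 1 / ((K - i : ℕ) + 1 : ℝ)) * lam (K + 1) η0 n i := by
      rw [← Finset.sum_add_distrib]
      refine Finset.sum_congr rfl fun i _ => ?_
      simp [lam]
    have h2 : ∑ i ∈ range K, lam (K + 1) η0 n (K - i) / ((i : ℝ) + 1) =
        ∑ i ∈ range K, lam (K + 1) η0 n (i + 1) / ((K - i : ℕ) : ℝ) := by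
      rw [← Finset.sum_range_reflect]
      refine Finset.sum_congr rfl fun i hi => ?_
      have := Finset.mem_range.1 hi
      rw [show K - (K - 1 - i) = i + 1 by omega]
      congr 1
      rw [show K - i = (K - 1 - i) + 1 by omega]
      push_cast; ring
    have h3 : ∑ i ∈ range K, (1 - 1 / ((K - i : ℕ) + 1 : ℝ)) * lam (K + 1) η0 n i =
        K / (K + 1) * η0 + ∑ i ∈ range K, (1 - 1 / ((K - i : ℕ) : ℝ)) * lam (K + 1) η0 n (i + 1) := by
      have h4 : ∑ i ∈ range (K + 1), (1 - 1 / ((K - i : ℕ) + 1 : ℝ)) * lam (K + 1) η0 n i =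
          ∑ i ∈ range K, (1 - 1 / ((K - i : ℕ) + 1 : ℝ)) * lam (K + 1) η0 n i := by
        rw [Finset.sum_range_succ]; simp
      rw [← h4, Finset.sum_range_succ', add_comm, lam_zero]
      congr 1
      · simp; left; field_simp; ring
      · refine Finset.sum_congr rfl fun i hi => ?_
        have := Finset.mem_range.1 hi
        congr 3
        rw [show K - i = (K - (i + 1)) + 1 by omega]
        push_cast; ring
    rw [h1, h2, h3]
    push_cast
    rw [add_mul, ← ih, one_mul, add_left_comm, ← Finset.sum_add_distrib, add_comm]
    congr 1
    refine Finset.sum_congr rfl fun i hi => ?_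
    ring

variable (p k) in
def HH (η : ℝ) : Prop := ∃ C : ℝ, 0 < C ∧ ∀ B : ℕ, Dec p k B (C * (p : ℝ) ^ (η * B))

variable (p k) in
def Raised (η lm : ℝ) (n l : ℕ) : Prop := ∀ ε : ℝ, 0 < ε → ∃ C : ℝ, 0 < C ∧ ∀ B b a : ℕ, 1 ≤ b →
  (k.factorial) ^ (n + 1) ∣ b → k ^ (n + 1) * b ≤ B → 1 ≤ a → l * a ≤ (k - l + 1) * b → a ≤ B →
  Bil p k l a b B ((C * (p : ℝ) ^ (η * B - lm * b + ε * B)) ^ tri k)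

lemma one_lt_pR : (1 : ℝ) < p := by exact_mod_cast (Fact.out : p.Prime).one_lt

lemma b_le_B (hk : 1 ≤ k) {n b B : ℕ} (h : k ^ (n + 1) * b ≤ B) : b ≤ B :=
  (Nat.le_mul_of_pos_left b (Nat.pow_pos hk)).trans h

lemma raised_zero_l (hk : 1 ≤ k) (hp : k < p) (η η0 : ℝ) (h0 : η0 ≤ η) (hH : HH p k η) (n : ℕ) :
    Raised p k η η0 n 0 := by
  intro ε hε
  obtain ⟨C, hC, hD⟩ := hH
  refine ⟨C, hC, fun B b a hb hdvd hkb ha hla haB => ?_⟩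
  have hbB := b_le_B hk hkb
  have h1 := bil_zero hk hp a b B hb hbB _ (by have := one_lt_pR (p := p); positivity) (hD (B - b))
  refine h1.mono ?_
  have hp1 := one_lt_pR (p := p)
  gcongr
  · exact hp1.le
  · rw [Nat.cast_sub hbB]
    have : (0 : ℝ) ≤ b := by positivity
    have hB0 : (0 : ℝ) ≤ B := by positivity
    nlinarith

lemma raised_base (hp : k < p) (η : ℝ) (hη : 0 ≤ η) (hH : HH p k η) (l : ℕ) (hl : 1 ≤ l) (hlk : l < k) :
    Raised p k η 0 0 l := by
  intro ε hε
  obtain ⟨C, hC, hD⟩ := hH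
  refine ⟨C, hC, fun B b a hb hdvd hkb ha hla haB => ?_⟩
  have hbB := b_le_B (by omega) hkb
  have hp1 := one_lt_pR (p := p)
  have hm : ∀ c ≤ B, Dec p k c (C * (p : ℝ) ^ (η * B - 0 * b + ε * B)) := by
    intro c hc
    refine (hD c).mono ?_
    have : (c : ℝ) ≤ B := by exact_mod_cast hc
    have hB0 : (0 : ℝ) ≤ B := by positivity
    gcongr
    · exact hp1.le
    · nlinarith
  exact bil_triv l hl hlk hp a b B ha haB hb hbB _ (by positivity) (hm _ (by omega)) (hm _ (by omega))

lemma raised_step (hp : k < p) (η : ℝ) (l : ℕ) (hl : 1 ≤ l) (hlk : l < k)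
    (hlow : ∀ ε : ℝ, 0 < ε → HH p l ε) (n : ℕ) (lm1 lm2 : ℝ) (h1 : Raised p k η lm1 n (k - l))
    (h2 : Raised p k η lm2 n (l - 1)) :
    Raised p k η (lm1 / l + (1 - 1 / ((k - l : ℕ) + 1 : ℝ)) * lm2) (n + 1) l := by
  intro ε hε
  obtain ⟨C1, hC1, h1⟩ := h1 (ε / 2) (by positivity)
  obtain ⟨C2, hC2, h2⟩ := h2 (ε / 2) (by positivity)
  obtain ⟨C3, hC3, h3⟩ := hlow (ε / 2) (by positivity)
  set θ : ℝ := 1 / ((k - l : ℕ) + 1 : ℝ) with hθ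
  have hθ0 : 0 < θ := by positivity
  have hθ1 : θ ≤ 1 := by rw [hθ, div_le_one (by positivity)]; linarith [Nat.cast_nonneg (α := ℝ) (k - l)]
  have hp1 := one_lt_pR (p := p)
  have hp0 : (0 : ℝ) < p := by linarith
  refine ⟨max C3 1 * (C1 ^ θ * C2 ^ (1 - θ)), by positivity, fun B b a hb hdvd hkb ha hla haB => ?_⟩
  have hk : 1 ≤ k := by omega
  have hlR : (0 : ℝ) < l := by exact_mod_cast hl
  -- b = l * e
  obtain ⟨g, hg⟩ : l ∣ k.factorial := Nat.dvd_factorial (by omega) (by omega)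
  obtain ⟨f, hf⟩ := hdvd
  set e := g * (k.factorial ^ (n + 1) * f) with he
  have hbe : b = l * e := by rw [hf, pow_succ', he]; nth_rewrite 1 [hg]; ring
  set b' := (k - l + 1) * e with hb'
  have he1 : 1 ≤ e := by
    rcases Nat.eq_zero_or_pos e with h | h
    · rw [h] at hbe; omega
    · exact h
  have hlb' : l * b' = (k - l + 1) * b := by rw [hb', hbe]; ring
  have hb'1 : 1 ≤ b' := Nat.mul_pos (by omega) he1
  have hb'kb : b' ≤ k * b := by
    rw [hb', hbe]
    exact Nat.mul_le_mul (by omega) (Nat.le_mul_of_pos_left _ hl)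
  have hkb' : k ^ (n + 1) * b' ≤ B := by
    refine le_trans ?_ hkb
    rw [pow_succ k (n + 1), mul_assoc]
    exact Nat.mul_le_mul_left _ hb'kb
  have hkb2 : k ^ (n + 1) * b ≤ B := by
    refine le_trans ?_ hkb
    exact Nat.mul_le_mul_right _ (Nat.pow_le_pow_right hk (by omega))
  have hbB := b_le_B hk hkb2
  have hb'B := b_le_B hk hkb'
  have i1 := h1 B b' b hb'1 (by rw [hb', he]; exact Dvd.intro_left ((k - l + 1) * g * f) (by ring)) hkb' hb
    (by
      rw [show k - (k - l) + 1 = l + 1 by omega]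
      have q1 : l * ((k - l) * b) ≤ l * ((l + 1) * b') := by
        calc l * ((k - l) * b) = l * (k - l) * b := by ring
          _ ≤ (l + 1) * (k - l + 1) * b := Nat.mul_le_mul_right _ (Nat.mul_le_mul (by omega) (by omega))
          _ = l * ((l + 1) * b') := by rw [mul_assoc, ← hlb']; ring
      exact Nat.le_of_mul_le_mul_left q1 hl) hbB
  have i2 := h2 B b b' hb (Dvd.intro_left (k.factorial * f) (by rw [hf]; ring)) hkb2 hb'1
    (by
      calc (l - 1) * b' ≤ l * b' := Nat.mul_le_mul_right _ (by omega)
        _ = (k - l + 1) * b := hlb'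
        _ ≤ (k - (l - 1) + 1) * b := Nat.mul_le_mul_right _ (by omega)) hb'B
  have i3 := stepL2 l hl hlk b' b B _ _ (by positivity) (by positivity) i1 i2
  have haa : a ≤ b' := Nat.le_of_mul_le_mul_left (hla.trans (le_of_eq hlb'.symm)) hl
  have i4 := stepL1 l hl hlk.le hp a b' b B ha haa hb'B hbB (le_of_eq hlb') _ (by positivity) (h3 (b' - a)) _
    (by positivity) i3
  refine i4.mono ?_
  have hB0 : (0 : ℝ) ≤ B := by positivity
  have d1 : C3 * (p : ℝ) ^ (ε / 2 * ((b' - a : ℕ) : ℝ)) ≤ max C3 1 * (p : ℝ) ^ (ε / 2 * B) := by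
    have : ((b' - a : ℕ) : ℝ) ≤ B := by exact_mod_cast (Nat.sub_le _ _).trans hb'B
    gcongr
    · exact le_max_left _ _
    · exact hp1.le
  have d2 : (1 : ℝ) ≤ max C3 1 * (p : ℝ) ^ (ε / 2 * B) := by
    refine one_le_mul_of_one_le_of_one_le (le_max_right _ _) (Real.one_le_rpow hp1.le (by positivity))
  have d3 : (C3 * (p : ℝ) ^ (ε / 2 * ((b' - a : ℕ) : ℝ))) ^ tri l ≤ (max C3 1 * (p : ℝ) ^ (ε / 2 * B)) ^ tri k :=
    (pow_le_pow_left₀ (by positivity) d1 _).trans (pow_le_pow_right₀ d2 (tri_mono hlk.le))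
  have hsw : ∀ (x t : ℝ) (_ : 0 ≤ x), (x ^ tri k) ^ t = (x ^ t) ^ tri k := by
    intro x t hx
    rw [← Real.rpow_natCast, ← Real.rpow_natCast, ← Real.rpow_mul hx, ← Real.rpow_mul hx, mul_comm]
  rw [← hθ, hsw _ _ (by positivity), hsw _ _ (by positivity)]
  refine (mul_le_mul_of_nonneg_right d3 (by positivity)).trans (le_of_eq ?_)
  rw [← mul_pow, ← mul_pow]
  congr 1
  rw [Real.mul_rpow hC1.le (by positivity), Real.mul_rpow hC2.le (by positivity), ← Real.rpow_mul hp0.le,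
    ← Real.rpow_mul hp0.le]
  have hb'R : (l : ℝ) * b' = ((k - l : ℕ) + 1) * b := by exact_mod_cast hlb'
  have hθb : θ * b' = b / l := by
    rw [hθ]; field_simp; linarith
  have : (p : ℝ) ^ (η * B - (lm1 / l + (1 - θ) * lm2) * b + ε * B) = (p : ℝ) ^ (ε / 2 * B) *
      ((p : ℝ) ^ ((η * B - lm1 * b' + ε / 2 * B) * θ) * (p : ℝ) ^ ((η * B - lm2 * b + ε / 2 * B) * (1 - θ))) := by
    rw [← Real.rpow_add hp0, ← Real.rpow_add hp0]
    congr 1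
    have : lm1 / l * b = lm1 * (θ * b') := by rw [hθb]; ring
    linear_combination -this
  rw [this]; ring

lemma raised_all (hp : k < p) (η η0 : ℝ) (hη0 : 0 ≤ η0) (h0 : η0 ≤ η) (hH : HH p k η)
    (hlow : ∀ l, 1 ≤ l → l < k → ∀ ε : ℝ, 0 < ε → HH p l ε) (n : ℕ) : ∀ l, l < k →
    Raised p k η (lam k η0 n l) n l := by
  induction n with
  | zero =>
    intro l hl
    rcases Nat.eq_zero_or_pos l with rfl | hl0
    · rw [lam_zero]; exact raised_zero_l (by omega) hp η η0 h0 hH 0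
    · have : lam k η0 0 l = 0 := by simp [lam]; omega
      rw [this]; exact raised_base hp η (by linarith) hH l hl0 hl
  | succ n ih =>
    intro l hl
    rcases Nat.eq_zero_or_pos l with rfl | hl0
    · rw [lam_zero]; exact raised_zero_l (by omega) hp η η0 h0 hH _
    · have : lam k η0 (n + 1) l = lam k η0 n (k - l) / l + (1 - 1 / ((k - l : ℕ) + 1 : ℝ)) * lam k η0 n (l - 1) := by
        simp [lam]; omega
      rw [this]
      exact raised_step hp η l hl0 hl (hlow l hl0 hl) n _ _ (ih _ (by omega)) (ih _ (by omega))

lemma exists_lam (hk : 2 ≤ k) (η0 : ℝ) (hη0 : 0 < η0) : ∃ n l, 1 ≤ l ∧ l < k ∧ 5 ≤ lam k η0 n l := by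
  obtain ⟨K, rfl⟩ : ∃ K, k = K + 1 := ⟨k - 1, by omega⟩
  have hK : (0 : ℝ) < K := by exact_mod_cast (by omega : 0 < K)
  obtain ⟨n, hn⟩ := exists_nat_ge (5 * ((K + 1) / η0))
  refine ⟨n, ?_⟩
  by_contra hcon
  push Not at hcon
  have h1 : ∑ i ∈ range K, lam (K + 1) η0 n (i + 1) < ∑ i ∈ range K, (5 : ℝ) := by
    refine Finset.sum_lt_sum_of_nonempty (Finset.nonempty_range_iff.2 (by omega)) fun i hi => ?_
    have := Finset.mem_range.1 hi
    exact hcon (i + 1) (by omega) (by omega)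
  rw [lam_sum, Finset.sum_const, Finset.card_range, nsmul_eq_mul] at h1
  have h2 : 5 * ((K + 1) / η0) * (K / (K + 1) * η0) ≤ n * (K / (K + 1) * η0) :=
    mul_le_mul_of_nonneg_right hn (by positivity)
  have h3 : 5 * ((K + 1) / η0) * (K / (K + 1) * η0) = K * 5 := by field_simp
  linarith

lemma improve (hp : k < p) (hk : 2 ≤ k) (η0 : ℝ) (hη0 : 0 < η0)
    (hlow : ∀ l, 1 ≤ l → l < k → ∀ ε : ℝ, 0 < ε → HH p l ε) :
    ∃ σ : ℝ, 0 < σ ∧ ∀ η, η0 ≤ η → HH p k η → HH p k (max (η - σ) η0) := by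
  obtain ⟨n, l, hl, hlk, hlam⟩ := exists_lam hk η0 hη0
  set T : ℕ := k ^ (n + 1) with hT
  set F : ℕ := k.factorial ^ (n + 1) with hF
  have hT1 : 1 ≤ T := Nat.pow_pos (by omega)
  have hF1 : 1 ≤ F := Nat.pow_pos (Nat.factorial_pos k)
  have hTR : (0 : ℝ) < T := by exact_mod_cast hT1
  refine ⟨1 / (2 * T), by positivity, fun η hη hH => ?_⟩
  obtain ⟨C, hC, hR⟩ := raised_all hp η η0 hη0.le hη hH hlow n l hlk (1 / (2 * T)) (by positivity)
  set η' := max (η - 1 / (2 * (T : ℝ))) η0 with hη'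
  have hη'0 : 0 < η' := lt_of_lt_of_le hη0 (le_max_right _ _)
  have hp1 := one_lt_pR (p := p)
  have hp0 : (0 : ℝ) < p := by linarith
  have hk1 : 1 ≤ k := by omega
  have ht := tri_pos hk1
  set C' : ℝ := (p : ℝ) ^ 2 * (C * (p : ℝ) ^ (F : ℝ)) with hC'
  -- the key recursion
  have hrec : ∀ B : ℕ, T * F ≤ B → ∀ D : ℝ, 0 ≤ D → Dec p k (B - 1) D →
      Dec p k B (D + C' * (p : ℝ) ^ (η' * B)) := by
    intro B hB D hD hDec
    set b := F * (B / (T * F)) with hb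
    have hq1 : 1 ≤ B / (T * F) := (Nat.one_le_div_iff (Nat.mul_pos hT1 hF1)).2 hB
    have hb1 : F ≤ b := Nat.le_mul_of_pos_right _ hq1
    have hbk : k ≤ b := by
      refine le_trans ?_ hb1
      calc k ≤ k.factorial := Nat.self_le_factorial k
        _ ≤ F := Nat.le_self_pow (by omega) _
    have hTb : T * b ≤ B := by
      rw [hb, ← mul_assoc]; exact Nat.mul_div_le B (T * F)
    have hBb : B < T * b + T * F := by
      have := Nat.lt_mul_div_succ B (Nat.mul_pos hT1 hF1)
      rw [hb]; nlinarith
    have hBbR : (B : ℝ) / T ≤ b + F := by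
      rw [div_le_iff₀ hTR]
      have : (B : ℝ) < T * b + T * F := by exact_mod_cast hBb
      linarith
    have hbB : b ≤ B := (Nat.le_mul_of_pos_left b hT1).trans hTb
    have h1 := hR B b 1 (by omega) (Dvd.intro _ rfl) hTb le_rfl (by
      rw [mul_one]
      calc l ≤ b := by omega
        _ ≤ (k - l + 1) * b := Nat.le_mul_of_pos_left b (by omega)) (by omega)
    have h2 := bil_loss l hk1 1 b B (by omega) hbB _ (by positivity) h1
    have hb1R : (1 : ℝ) ≤ b := by exact_mod_cast (by omega : 1 ≤ b)
    have m1 : tri l ≤ tri k := tri_mono hlk.le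
    have h3 : (p : ℝ) ^ ((2 * tri l + 1) * 1 + (2 * (tri k - tri l) + 1) * b) ≤ ((p : ℝ) ^ (4 * (b : ℝ))) ^ tri k := by
      have e1 : (4 * (b : ℝ)) = ((4 * b : ℕ) : ℝ) := by push_cast; ring
      rw [e1, Real.rpow_natCast, ← pow_mul]
      refine pow_le_pow_right₀ hp1.le ?_
      obtain ⟨Q, hQ⟩ : ∃ Q, tri k = Q + tri l := ⟨tri k - tri l, by omega⟩
      have hbb : 1 ≤ b := by omega
      rw [hQ] at ht ⊢
      rw [Nat.add_sub_cancel]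
      nlinarith [Nat.mul_le_mul_left (tri l) hbb, Nat.mul_le_mul_right b ht]
    have h4 := h2.mono (mul_le_mul_of_nonneg_right h3 (by positivity))
    rw [← mul_pow] at h4
    have h5 := bil_to_dec l hl hlk hp B (by omega) _ (by positivity) h4 D hD hDec
    refine h5.mono ?_
    rw [one_div (tri k : ℝ), Real.pow_rpow_inv_natCast (by positivity) (by omega)]
    rw [hC', mul_assoc]
    refine add_le_add_right (mul_le_mul_of_nonneg_left ?_ (by positivity)) D
    rw [mul_left_comm, mul_assoc, ← Real.rpow_add hp0, ← Real.rpow_add hp0]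
    refine mul_le_mul_of_nonneg_left (Real.rpow_le_rpow_of_exponent_le hp1.le ?_) hC.le
    have hB0 : (0 : ℝ) ≤ B := by positivity
    have g1 : (η - 1 / (2 * (T : ℝ))) * B ≤ η' * B := mul_le_mul_of_nonneg_right (le_max_left _ _) hB0
    have g2 : 5 * (b : ℝ) ≤ lam k η0 n l * b := mul_le_mul_of_nonneg_right hlam (by positivity)
    have g3 : 1 / (2 * (T : ℝ)) * B = (B / T) / 2 := by field_simp
    linarith
  have hlt : (p : ℝ) ^ (-η') < 1 := Real.rpow_lt_one_of_one_lt_of_neg hp1 (by linarith)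
  set Cdd : ℝ := max ((p : ℝ) ^ (T * F)) (C' / (1 - (p : ℝ) ^ (-η'))) with hCdd
  have hCdd0 : 0 < Cdd := lt_of_lt_of_le (by positivity) (le_max_left _ _)
  refine ⟨Cdd, hCdd0, fun B => ?_⟩
  induction B with
  | zero =>
    refine (dec_triv hk1 0).mono ?_
    simp only [pow_zero, Nat.cast_zero, mul_zero, Real.rpow_zero, mul_one]
    exact le_trans (one_le_pow₀ hp1.le) (le_max_left _ _)
  | succ B ih =>
    by_cases hB : T * F ≤ B + 1
    · have h6 := hrec (B + 1) hB (Cdd * (p : ℝ) ^ (η' * B)) (by positivity) (by simpa using ih)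
      refine h6.mono ?_
      have e1 : (p : ℝ) ^ (η' * B) = (p : ℝ) ^ (η' * (B + 1 : ℕ)) * (p : ℝ) ^ (-η') := by
        rw [← Real.rpow_add hp0]; congr 1; push_cast; ring
      rw [e1]
      have e2 : C' ≤ Cdd * (1 - (p : ℝ) ^ (-η')) := by
        rw [← div_le_iff₀ (by linarith)]; exact le_max_right _ _
      have e3 : (0 : ℝ) < (p : ℝ) ^ (η' * (B + 1 : ℕ)) := by positivity
      nlinarith
    · refine (dec_triv hk1 (B + 1)).mono ?_
      have e1 : (1 : ℝ) ≤ (p : ℝ) ^ (η' * (B + 1 : ℕ)) := Real.one_le_rpow hp1.le (by positivity)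
      calc (p : ℝ) ^ (B + 1) ≤ (p : ℝ) ^ (T * F) := pow_le_pow_right₀ hp1.le (by omega)
        _ ≤ Cdd := le_max_left _ _
        _ ≤ _ := le_mul_of_one_le_right hCdd0.le e1

theorem dec_main (k : ℕ) (hk : 1 ≤ k) (hp : k < p) : ∀ ε : ℝ, 0 < ε → HH p k ε := by
  induction k using Nat.strong_induction_on with
  | _ k ih =>
    intro ε hε
    rcases Nat.lt_or_ge 1 k with h1 | h1
    · obtain ⟨σ, hσ, himp⟩ := improve hp h1 ε hε (fun l hl hlk => ih l hlk hl (by omega))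
      have hp1 := one_lt_pR (p := p)
      have base : HH p k (max 1 ε) := by
        refine ⟨1, one_pos, fun B => (dec_triv hk B).mono ?_⟩
        rw [one_mul, ← Real.rpow_natCast]
        refine Real.rpow_le_rpow_of_exponent_le hp1.le ?_
        have : (0 : ℝ) ≤ B := by positivity
        nlinarith [le_max_left 1 ε]
      have hit : ∀ j : ℕ, HH p k (max (1 - j * σ) ε) := by
        intro j
        induction j with
        | zero => simpa using base
        | succ j ihj =>
          have := himp _ (le_max_right _ _) ihj
          convert this using 1
          rw [max_sub_sub_right (1 - j * σ) ε σ |>.symm, max_assoc, max_eq_right (by linarith : ε - σ ≤ ε)]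
          congr 1; push_cast; ring
      obtain ⟨j, hj⟩ := exists_nat_ge (1 / σ)
      have := hit j
      rwa [max_eq_right] at this
      rw [div_le_iff₀ hσ] at hj
      linarith
    · have : k = 1 := by omega
      subst this
      have hp1 := one_lt_pR (p := p)
      refine ⟨1, one_pos, fun B => (dec_one B).mono ?_⟩
      rw [one_mul]
      exact Real.one_le_rpow hp1.le (by positivity)

end padic
end SFP

namespace SFP
open Finset
open scoped BigOperators

lemma addChar_sum {A ι : Type} [AddCommMonoid A] (ψ : AddChar A ℂ) (s : Finset ι) (f : ι → A) :
    ψ (∑ i ∈ s, f i) = ∏ i ∈ s, ψ (f i) := by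
  classical
  induction s using Finset.induction_on with
  | empty => simp
  | insert a s ha ih => rw [Finset.sum_insert ha, Finset.prod_insert ha, AddChar.map_add_eq_mul, ih]

lemma moment_count (L : ℕ) [NeZero L] (d s : ℕ) {ι : Type} [Fintype ι] [DecidableEq ι]
    (v : ι → Fin d → ZMod L) :
    ∑ x : Fin d → ZMod L, ‖∑ i, (ZMod.stdAddChar (∑ j, x j * v i j) : ℂ)‖ ^ (2 * s) =
      (L : ℝ) ^ d * ((univ.filter fun nm : (Fin s → ι) × (Fin s → ι) =>
        ∀ j, ∑ i, v (nm.1 i) j = ∑ i, v (nm.2 i) j).card : ℝ) := by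
  have h1 : ∀ w : Fin d → ZMod L, ∑ x : Fin d → ZMod L, (ZMod.stdAddChar (∑ j, x j * w j) : ℂ) =
      if w = 0 then (L : ℂ) ^ d else 0 := by
    intro w
    have e1 : ∀ x : Fin d → ZMod L, (ZMod.stdAddChar (∑ j, x j * w j) : ℂ) = ∏ j, ZMod.stdAddChar (x j * w j) := by
      intro x; exact addChar_sum _ _ _
    simp only [e1]
    rw [← Fintype.prod_sum (fun j y => (ZMod.stdAddChar (y * w j) : ℂ))]
    have h4 : ∀ j, ∑ y, (ZMod.stdAddChar (y * w j) : ℂ) = if w j = 0 then (L : ℂ) else 0 := by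
      intro j
      have := AddChar.sum_mulShift (ψ := ZMod.stdAddChar (N := L)) (w j) (ZMod.isPrimitive_stdAddChar _)
      rw [this]; simp [ZMod.card]
    simp only [h4]
    split_ifs with h
    · subst h; simp
    · obtain ⟨j, hj⟩ := Function.ne_iff.1 h
      exact Finset.prod_eq_zero (Finset.mem_univ j) (if_neg (by simpa using hj))
  have h2 : ∀ x : Fin d → ZMod L, ((‖∑ i, (ZMod.stdAddChar (∑ j, x j * v i j) : ℂ)‖ ^ (2 * s) : ℝ) : ℂ) =
      ∑ nm : (Fin s → ι) × (Fin s → ι),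
        ZMod.stdAddChar (∑ j, x j * (∑ i, v (nm.1 i) j - ∑ i, v (nm.2 i) j)) := by
    intro x
    have e2 : (∑ i, (ZMod.stdAddChar (∑ j, x j * v i j) : ℂ)) ^ s =
        ∑ n : Fin s → ι, ZMod.stdAddChar (∑ j, x j * ∑ i, v (n i) j) := by
      rw [Fintype.sum_pow]
      refine Finset.sum_congr rfl fun n _ => ?_
      rw [← addChar_sum, Finset.sum_comm]
      simp only [Finset.mul_sum]
    have e3 : ((‖∑ i, (ZMod.stdAddChar (∑ j, x j * v i j) : ℂ)‖ ^ (2 * s) : ℝ) : ℂ) =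
      (∑ i, (ZMod.stdAddChar (∑ j, x j * v i j) : ℂ)) ^ s *
        (starRingEnd ℂ) ((∑ i, (ZMod.stdAddChar (∑ j, x j * v i j) : ℂ)) ^ s) := by
      rw [Complex.mul_conj, Complex.normSq_eq_norm_sq, norm_pow, ← pow_mul, mul_comm]
    rw [e3, e2, map_sum, Finset.sum_mul_sum, Fintype.sum_prod_type]
    refine Finset.sum_congr rfl fun n _ => Finset.sum_congr rfl fun m _ => ?_
    rw [← AddChar.map_neg_eq_conj, ← AddChar.map_add_eq_mul]
    congr 1
    rw [← sub_eq_add_neg, ← Finset.sum_sub_distrib]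
    simp only [mul_sub]
  apply Complex.ofReal_injective
  push_cast
  rw [show (∑ x : Fin d → ZMod L, (‖∑ i, (ZMod.stdAddChar (∑ j, x j * v i j) : ℂ)‖ : ℂ) ^ (2 * s)) =
    ∑ x : Fin d → ZMod L, ((‖∑ i, (ZMod.stdAddChar (∑ j, x j * v i j) : ℂ)‖ ^ (2 * s) : ℝ) : ℂ) by push_cast; rfl]
  simp only [h2]
  rw [Finset.sum_comm]
  simp only [h1]
  rw [← Finset.sum_filter, Finset.sum_const, nsmul_eq_mul, mul_comm]
  congr 3
  ext nm
  simp only [Finset.mem_filter, Finset.mem_univ, true_and, funext_iff, Pi.zero_apply, sub_eq_zero]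

/-- Vinogradov's system: number of solutions with variables in `[0, N)`. -/
def VV (s d N : ℕ) : ℕ := (univ.filter fun nm : (Fin s → Fin N) × (Fin s → Fin N) =>
        ∀ j : Fin d, ∑ i, (nm.1 i : ℕ) ^ ((j : ℕ) + 1) = ∑ i, (nm.2 i : ℕ) ^ ((j : ℕ) + 1)).card

theorem vmvt (k : ℕ) (hk : 1 ≤ k) (ε : ℝ) (hε : 0 < ε) :
    ∃ C : ℝ, 0 < C ∧ ∀ N : ℕ, 1 ≤ N → (VV (tri k) k N : ℝ) ≤ C * (N : ℝ) ^ ((tri k : ℝ) + ε) := by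
  obtain ⟨p, hpk, hpp⟩ := Nat.exists_infinite_primes (k + 1)
  have : Fact p.Prime := ⟨hpp⟩
  have ht := tri_pos hk
  have htR : (0 : ℝ) < tri k := by exact_mod_cast ht
  obtain ⟨C, hC, hD⟩ := dec_main (p := p) k hk (by omega) (ε / tri k) (by positivity)
  have hp1 := one_lt_pR (p := p)
  have hp0 : (0 : ℝ) < p := by linarith
  refine ⟨(C * (p : ℝ) ^ (ε / tri k)) ^ tri k, by positivity, fun N hN => ?_⟩
  set B := Nat.log p N + 1 with hB
  have hNB : N < p ^ B := Nat.lt_pow_succ_log_self hpp.one_lt N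
  have hBN : p ^ (B - 1) ≤ N := Nat.pow_log_le_self p (by omega)
  set M := k * B with hM
  set φ : Fin k → Polynomial ℤ_[p] := fun j => Polynomial.X ^ ((j : ℕ) + 1) with hφ
  have hmon : Mon φ := fun j => ⟨0, by simp [hφ]⟩
  have key := hD B M le_rfl φ hmon (range N) (fun _ => 1) (fun i => (i : ℤ_[p]))
  set v : ℕ → Fin k → ℤ_[p] := fun i => pt φ (i : ℤ_[p]) with hv
  -- right-hand side
  have hsing : ∀ J : ZMod (p ^ B), nrm M (cls (range N) (fun i => (i : ℤ_[p])) B J) (fun _ => 1) v ≤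
      ((cls (range N) (fun i => (i : ℤ_[p])) B J).card : ℝ) := by
    intro J
    have hc : (cls (range N) (fun i => (i : ℤ_[p])) B J).card ≤ 1 := by
      rw [Finset.card_le_one]
      intro a ha b hb
      simp only [cls, mem_filter, mem_range, map_natCast] at ha hb
      have := ha.2.trans hb.2.symm
      rw [ZMod.natCast_eq_natCast_iff] at this
      exact Nat.ModEq.eq_of_lt_of_lt this (by omega) (by omega)
    rcases Nat.le_one_iff_eq_zero_or_eq_one.1 hc with h0 | h0
    · rw [Finset.card_eq_zero] at h0
      rw [h0, nrm_empty hk]; simp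
    · rw [h0]
      obtain ⟨i, hi⟩ := Finset.card_eq_one.1 h0
      rw [hi]
      unfold nrm sq fS
      simp [E_norm]
  have hsum : ∑ J : ZMod (p ^ B), nrm M (cls (range N) (fun i => (i : ℤ_[p])) B J) (fun _ => 1) v ≤ N := by
    refine (Finset.sum_le_sum fun J _ => hsing J).trans (le_of_eq ?_)
    have := Finset.card_eq_sum_card_fiberwise (s := range N) (t := (univ : Finset (ZMod (p ^ B))))
      (f := fun i : ℕ => PadicInt.toZModPow B (i : ℤ_[p])) (fun _ _ => by simp)
    rw [card_range] at this
    rw [← Nat.cast_sum]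
    norm_cast
    exact this.symm
  have key2 : nrm M (range N) (fun _ => 1) v ≤ C * (p : ℝ) ^ (ε / tri k * B) * N :=
    key.trans (mul_le_mul_of_nonneg_left hsum (by positivity))
  -- left-hand side
  have hL : (VV (tri k) k N : ℝ) ≤ 𝔼 x, (sq M (range N) (fun _ => 1) v x) ^ tri k := by
    have hm := moment_count (p ^ M) k (tri k) (ι := Fin N) (fun i j => ((i : ℕ) : ZMod (p ^ M)) ^ ((j : ℕ) + 1))
    have e1 : ∀ x, (sq M (range N) (fun _ => 1) v x) ^ tri k =
        ‖∑ i : Fin N, (ZMod.stdAddChar (∑ j, x j * ((i : ℕ) : ZMod (p ^ M)) ^ ((j : ℕ) + 1)) : ℂ)‖ ^ (2 * tri k) := by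
      intro x
      unfold sq fS
      rw [← pow_mul, Finset.sum_range]
      simp [hv, pt, hφ, E]
    rw [Fintype.expect_eq_sum_div_card]
    simp only [e1]
    rw [hm]
    have : (Fintype.card (Fin k → ZMod (p ^ M)) : ℝ) = ((p ^ M : ℕ) : ℝ) ^ k := by simp [ZMod.card]
    rw [this, mul_div_cancel_left₀ _ (by have := hpp.pos; positivity)]
    norm_cast
    unfold VV
    refine Finset.card_le_card fun nm => ?_
    simp only [mem_filter, mem_univ, true_and]
    intro h j
    have := h j
    exact_mod_cast congrArg (fun z : ℕ => (z : ZMod (p ^ M))) this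
  have h0 : (0 : ℝ) ≤ 𝔼 x, (sq M (range N) (fun _ => 1) v x) ^ tri k := le_trans (by positivity) hL
  have key3 : (𝔼 x, (sq M (range N) (fun _ => 1) v x) ^ tri k) ≤ (C * (p : ℝ) ^ (ε / tri k * B) * N) ^ tri k := by
    have := pow_le_pow_left₀ (nrm_nonneg _ _ _ _) key2 (tri k)
    unfold nrm at this
    rwa [one_div, Real.rpow_inv_natCast_pow h0 (by omega)] at this
  refine hL.trans (key3.trans ?_)
  have hN0 : (0 : ℝ) < N := by exact_mod_cast hN
  have hBR : (p : ℝ) ^ (ε / tri k * B) ≤ (p : ℝ) ^ (ε / tri k) * (N : ℝ) ^ (ε / tri k) := by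
    have e2 : (p : ℝ) ^ (ε / tri k * B) = (p : ℝ) ^ (ε / tri k) * ((p : ℝ) ^ (B - 1)) ^ (ε / tri k) := by
      rw [← Real.rpow_natCast, ← Real.rpow_mul hp0.le, ← Real.rpow_add hp0]
      congr 1
      rw [hB]; push_cast [Nat.add_sub_cancel]; ring
    rw [e2]
    gcongr
    exact_mod_cast hBN
  calc (C * (p : ℝ) ^ (ε / tri k * B) * N) ^ tri k ≤
      (C * ((p : ℝ) ^ (ε / tri k) * (N : ℝ) ^ (ε / tri k)) * N) ^ tri k := by gcongr
    _ = (C * (p : ℝ) ^ (ε / tri k)) ^ tri k * ((N : ℝ) ^ (ε / tri k) * N) ^ tri k := by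
      rw [← mul_pow]; congr 1; ring
    _ = _ := by
      congr 1
      rw [mul_pow, ← Real.rpow_natCast, ← Real.rpow_mul hN0.le, div_mul_cancel₀ _ htR.ne', Real.rpow_add hN0,
        Real.rpow_natCast, mul_comm]

end SFP

namespace SFP
open Finset
open scoped BigOperators

lemma mult_bound (f : ℕ → ℝ) (hf0 : ∀ n, 0 ≤ f n) (hf1 : f 1 ≤ 1) (A : ℝ) (hA : 1 ≤ A)
    (hpp : ∀ p e : ℕ, p.Prime → 1 ≤ e → f (p ^ e) ≤ A * (e + 1))
    (hmul : ∀ a b : ℕ, Nat.Coprime a b → f (a * b) ≤ f a * f b) (ε : ℝ) (hε : 0 < ε) :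
    ∃ C : ℝ, 0 < C ∧ ∀ q : ℕ, 1 ≤ q → f q ≤ C * (q : ℝ) ^ ε := by
  obtain ⟨P0, hP0⟩ : ∃ P0 : ℕ, ∀ p : ℕ, P0 ≤ p → 2 * A ≤ (p : ℝ) ^ ε := by
    have := ((tendsto_rpow_atTop hε).comp tendsto_natCast_atTop_atTop).eventually_ge_atTop (2 * A)
    exact Filter.eventually_atTop.1 this
  set l : ℝ := ε * Real.log 2 with hl
  have hl0 : 0 < l := mul_pos hε (Real.log_pos (by norm_num))
  set C1 : ℝ := A * (1 + 1 / l) with hC1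
  have hC11 : 1 ≤ C1 := by
    have : 0 < 1 / l := by positivity
    nlinarith
  have hsmall : ∀ p e : ℕ, p.Prime → A * (e + 1) ≤ C1 * ((p ^ e : ℕ) : ℝ) ^ ε := by
    intro p e hp
    have h2 : (2 : ℝ) ≤ p := by exact_mod_cast hp.two_le
    have h3 : 1 + l * e ≤ ((p ^ e : ℕ) : ℝ) ^ ε := by
      calc 1 + l * e ≤ Real.exp (l * e) := by linarith [Real.add_one_le_exp (l * e)]
        _ = ((2 : ℝ) ^ e) ^ ε := by
          rw [← Real.rpow_natCast, ← Real.rpow_mul (by norm_num), Real.rpow_def_of_pos (by norm_num)]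
          congr 1; rw [hl]; ring
        _ ≤ _ := by
          push_cast
          gcongr
    have h4 : (e : ℝ) + 1 ≤ (1 + 1 / l) * (1 + l * e) := by
      have : (1 + 1 / l) * (1 + l * e) = 1 + 1 / l + l * e + e := by field_simp; ring
      rw [this]
      have : 0 < 1 / l := by positivity
      have : 0 ≤ l * e := by positivity
      linarith
    calc A * (e + 1) ≤ A * ((1 + 1 / l) * (1 + l * e)) := by gcongr
      _ = C1 * (1 + l * e) := by rw [hC1]; ring
      _ ≤ _ := by gcongr
  have hbig : ∀ p e : ℕ, P0 ≤ p → 1 ≤ e → A * (e + 1) ≤ ((p ^ e : ℕ) : ℝ) ^ ε := by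
    intro p e hp he
    have h1 : A * (e + 1) ≤ (2 * A) ^ e := by
      induction e, he using Nat.le_induction with
      | base => push_cast; linarith
      | succ e he ih =>
        rw [pow_succ]
        push_cast
        have h5 : A * (e + 1) * (2 * A) ≤ (2 * A) ^ e * (2 * A) := by gcongr
        have : (0 : ℝ) ≤ e := by positivity
        nlinarith [mul_nonneg (sub_nonneg.2 hA) this]
    refine h1.trans ?_
    push_cast
    rw [← Real.rpow_natCast (p : ℝ) e, ← Real.rpow_mul (by positivity), mul_comm (e : ℝ) ε,
      Real.rpow_mul (by positivity), Real.rpow_natCast]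
    exact pow_le_pow_left₀ (by positivity) (hP0 p hp) e
  have main : ∀ q : ℕ, 1 ≤ q → f q ≤ C1 ^ (q.primeFactors.filter (· < P0)).card * (q : ℝ) ^ ε := by
    intro q
    induction q using Nat.recOnPosPrimePosCoprime with
    | prime_pow p e hp he =>
      intro _
      rw [Nat.primeFactors_prime_pow (by omega) hp]
      refine (hpp p e hp he).trans ?_
      by_cases h : p < P0
      · rw [Finset.filter_singleton, if_pos h, card_singleton, pow_one]
        exact hsmall p e hp
      · rw [Finset.filter_singleton, if_neg h, card_empty, pow_zero, one_mul]
        exact hbig p e (by omega) he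
    | zero => intro h; omega
    | one => intro _; simpa using hf1
    | coprime a b ha hb hab iha ihb =>
      intro _
      refine (hmul a b hab).trans ?_
      rw [hab.primeFactors_mul, Finset.filter_union, Finset.card_union_of_disjoint
        (Finset.disjoint_filter_filter (hab.disjoint_primeFactors)), pow_add]
      push_cast
      rw [Real.mul_rpow (by positivity) (by positivity)]
      calc f a * f b ≤ _ := mul_le_mul (iha (by omega)) (ihb (by omega)) (hf0 b) (by positivity)
        _ = _ := by ring
  refine ⟨C1 ^ P0, by positivity, fun q hq => (main q hq).trans ?_⟩
  refine mul_le_mul_of_nonneg_right (pow_le_pow_right₀ hC11 ?_) (by positivity)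
  · calc _ ≤ (range P0).card := Finset.card_le_card fun x hx => by simp at hx ⊢; exact hx.2
      _ = P0 := card_range _

lemma divisor_bound (ε : ℝ) (hε : 0 < ε) :
    ∃ C : ℝ, 0 < C ∧ ∀ q : ℕ, 1 ≤ q → (q.divisors.card : ℝ) ≤ C * (q : ℝ) ^ ε := by
  refine mult_bound (fun q => (q.divisors.card : ℝ)) (fun _ => by positivity) (by simp) 1 le_rfl ?_ ?_ ε hε
  · intro p e hp _
    rw [Nat.divisors_prime_pow hp]; simp
  · intro a b hab
    rw [hab.card_divisors_mul]; simp

lemma phi_bound (ε : ℝ) (hε : 0 < ε) :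
    ∃ C : ℝ, 0 < C ∧ ∀ q : ℕ, 1 ≤ q → (q : ℝ) ≤ C * (q : ℝ) ^ ε * (q.totient : ℝ) := by
  suffices hs : ∃ C : ℝ, 0 < C ∧ ∀ q : ℕ, 1 ≤ q → (q : ℝ) / q.totient ≤ C * (q : ℝ) ^ ε by
    obtain ⟨C, hC, h⟩ := hs
    refine ⟨C, hC, fun q hq => ?_⟩
    have := h q hq
    rwa [div_le_iff₀ (by exact_mod_cast Nat.totient_pos.2 hq)] at this
  refine mult_bound (fun q => (q : ℝ) / q.totient) (fun _ => by positivity) (by simp) 2 (by norm_num)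
    ?_ ?_ ε hε
  · intro p e hp he
    rw [Nat.totient_prime_pow hp (by omega)]
    obtain ⟨n, rfl⟩ : ∃ n, e = n + 1 := ⟨e - 1, by omega⟩
    have h2 := hp.two_le
    have h3 : (0 : ℝ) < ((p - 1 : ℕ) : ℝ) := by exact_mod_cast (by omega : 0 < p - 1)
    have h4 : (p : ℝ) = ((p - 1 : ℕ) : ℝ) + 1 := by exact_mod_cast (by omega : p = (p - 1) + 1)
    have h5 : (1 : ℝ) ≤ ((p - 1 : ℕ) : ℝ) := by exact_mod_cast (by omega : 1 ≤ p - 1)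
    have hp0 : (0 : ℝ) < p := by linarith
    push_cast
    rw [div_le_iff₀ (by positivity), pow_succ]
    have : (p : ℝ) ≤ 2 * ((n : ℝ) + 1 + 1) * ((p - 1 : ℕ) : ℝ) := by
      have : (0 : ℝ) ≤ n * ((p - 1 : ℕ) : ℝ) := by positivity
      nlinarith
    have := mul_le_mul_of_nonneg_left this (by positivity : (0 : ℝ) ≤ (p : ℝ) ^ n)
    linarith
  · intro a b hab
    rw [Nat.totient_mul hab]
    push_cast
    exact le_of_eq (mul_div_mul_comm _ _ _ _)

/-- number of `k`-th roots of unity among the units modulo `q` -/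
noncomputable def rho (k q : ℕ) : ℕ := Nat.card {u : (ZMod q)ˣ // u ^ k = 1}

lemma rho_mul (k a b : ℕ) (hab : Nat.Coprime a b) : rho k (a * b) = rho k a * rho k b := by
  unfold rho
  let e := (Units.mapEquiv (ZMod.chineseRemainder hab).toMulEquiv).trans MulEquiv.prodUnits
  rw [← Nat.card_prod]
  refine Nat.card_congr ?_
  refine (Equiv.subtypeEquiv e.toEquiv (p := fun u => u ^ k = 1) (q := fun u => u.1 ^ k = 1 ∧ u.2 ^ k = 1) ?_).trans ?_
  · intro u
    have : (e u) ^ k = 1 ↔ u ^ k = 1 := by rw [← map_pow, map_eq_one_iff e e.injective]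
    rw [← this, Prod.ext_iff]
    rfl
  · exact Equiv.subtypeProdEquivProd (p := fun u : (ZMod a)ˣ => u ^ k = 1) (q := fun u : (ZMod b)ˣ => u ^ k = 1)

lemma torsion_two {G : Type} [CommGroup G] [Finite G] (g : G) (hg : Nat.card G ≤ 2 * orderOf g) (k : ℕ) (hk : 1 ≤ k) :
    Nat.card {u : G // u ^ k = 1} ≤ 2 * k := by
  classical
  set T : Subgroup G := (powMonoidHom k : G →* G).ker with hT
  set H : Subgroup G := Subgroup.zpowers g with hH
  have h1 : Nat.card {u : G // u ^ k = 1} = Nat.card T := by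
    refine Nat.card_congr (Equiv.subtypeEquivRight fun u => ?_)
    rw [hT, MonoidHom.mem_ker]; rfl
  have h2 : Nat.card (H ⊓ T : Subgroup G) ≤ k := by
    have : Fintype H := Fintype.ofFinite H
    have h3 := IsCyclic.card_pow_eq_one_le (α := H) (n := k) hk
    refine le_trans ?_ h3
    rw [← Fintype.card_subtype, ← Nat.card_eq_fintype_card]
    refine Nat.card_le_card_of_injective (fun x : (H ⊓ T : Subgroup G) =>
      (⟨⟨x.1, x.2.1⟩, by
        have : (x : G) ^ k = 1 := MonoidHom.mem_ker.1 x.2.2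
        ext; exact this⟩ : {h : H // h ^ k = 1})) ?_
    intro x y hxy
    ext
    simpa using hxy
  have h4 : H.index ≤ 2 := by
    have := H.card_mul_index
    rw [hH, Nat.card_zpowers] at this
    have h5 : 0 < orderOf g := orderOf_pos g
    rw [← hH] at this
    nlinarith
  have h6 := Subgroup.relIndex_mul_relIndex (⊥ : Subgroup G) (H ⊓ T) T bot_le inf_le_right
  rw [Subgroup.relIndex_bot_left, Subgroup.relIndex_bot_left, Subgroup.inf_relIndex_right] at h6
  have h7 : H.relIndex T ≤ H.index := by
    rw [← Subgroup.relIndex_top_right]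
    exact Subgroup.relIndex_le_of_le_right le_top (by rw [Subgroup.relIndex_top_right]; exact Subgroup.index_ne_zero_of_finite)
  rw [h1, ← h6]
  calc _ ≤ k * 2 := Nat.mul_le_mul h2 (h7.trans h4)
    _ = 2 * k := by ring

lemma rho_bound (k : ℕ) (hk : 1 ≤ k) (ε : ℝ) (hε : 0 < ε) :
    ∃ C : ℝ, 0 < C ∧ ∀ q : ℕ, 1 ≤ q → (rho k q : ℝ) ≤ C * (q : ℝ) ^ ε := by
  refine mult_bound (fun q => (rho k q : ℝ)) (fun _ => by positivity) ?_ (2 * k) ?_ ?_ ?_ ε hε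
  · have : rho k 1 ≤ 1 := by
      unfold rho
      have : Subsingleton {u : (ZMod 1)ˣ // u ^ k = 1} := inferInstance
      exact Finite.card_le_one_iff_subsingleton.2 this
    exact_mod_cast this
  · have : (1 : ℝ) ≤ k := by exact_mod_cast hk
    linarith
  · intro p e hp he
    have : rho k (p ^ e) ≤ 2 * k := by
      have hfin : NeZero (p ^ e) := ⟨(pow_pos hp.pos e).ne'⟩
      unfold rho
      by_cases hp2 : p = 2
      · subst hp2
        rcases Nat.lt_or_ge e 2 with h1 | h1
        · have : e = 1 := by omega
          subst this
          refine (Nat.card_le_card_of_injective (fun x : {u : (ZMod (2 ^ 1))ˣ // u ^ k = 1} => x.1)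
            Subtype.val_injective).trans ?_
          rw [Nat.card_eq_fintype_card, ZMod.card_units_eq_totient]
          simp; omega
        · obtain ⟨n, rfl⟩ : ∃ n, e = n + 2 := ⟨e - 2, by omega⟩
          have ho := ZMod.orderOf_five n
          have hu : IsUnit (5 : ZMod (2 ^ (n + 2))) :=
            IsUnit.of_pow_eq_one (n := 2 ^ n) (by rw [← ho]; exact pow_orderOf_eq_one _) (by positivity)
          obtain ⟨g, hg⟩ := hu
          refine torsion_two g ?_ k hk
          rw [← orderOf_units, hg, ho, Nat.card_eq_fintype_card, ZMod.card_units_eq_totient,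
            Nat.totient_prime_pow Nat.prime_two (by omega)]
          simp [pow_succ, mul_comm]
      · have : Fact p.Prime := ⟨hp⟩
        have hc : IsCyclic (ZMod (p ^ e))ˣ := ZMod.isCyclic_units_of_prime_pow p hp hp2 e
        rw [Nat.card_eq_fintype_card, Fintype.card_subtype]
        have := IsCyclic.card_pow_eq_one_le (α := (ZMod (p ^ e))ˣ) (n := k) hk
        omega
    have h2 : (rho k (p ^ e) : ℝ) ≤ 2 * k := by exact_mod_cast this
    refine h2.trans ?_
    have : (0 : ℝ) ≤ 2 * k * e := by positivity
    linarith
  · intro a b hab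
    rw [rho_mul k a b hab]; push_cast; exact le_rfl

end SFP

namespace SFP
open Finset
open scoped BigOperators

lemma pair_eq {X A : Type} [Fintype X] [DecidableEq A] (f : X → A) :
    (univ.filter fun xy : X × X => f xy.1 = f xy.2).card = ∑ a ∈ univ.image f, (univ.filter fun x => f x = a).card ^ 2 := by
  classical
  rw [Finset.card_eq_sum_card_fiberwise (f := fun xy : X × X => f xy.1) (t := univ.image f)
    (fun x _ => by simp)]
  refine Finset.sum_congr rfl fun a _ => ?_
  rw [pow_two, ← Finset.card_product]
  congr 1
  ext ⟨x, y⟩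
  simp only [mem_filter, mem_univ, true_and, mem_product]
  constructor
  · rintro ⟨h1, h2⟩; exact ⟨h2, by rw [← h1, h2]⟩
  · rintro ⟨h1, h2⟩; exact ⟨by rw [h1, h2], h1⟩

lemma pair_count {X A B : Type} [Fintype X] [DecidableEq A] [DecidableEq B] (W : X → A) (π : A → B) (F : ℕ)
    (hF : ∀ b, ((univ.image W).filter fun a => π a = b).card ≤ F) :
    (univ.filter fun xy : X × X => π (W xy.1) = π (W xy.2)).card ≤
      F * (univ.filter fun xy : X × X => W xy.1 = W xy.2).card := by
  classical
  rw [pair_eq W, pair_eq (fun x => π (W x))]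
  have h1 : ∀ b, (univ.filter fun x => π (W x) = b).card ^ 2 ≤
      F * ∑ a ∈ (univ.image W).filter (fun a => π a = b), (univ.filter fun x => W x = a).card ^ 2 := by
    intro b
    have h2 : (univ.filter fun x => π (W x) = b).card =
        ∑ a ∈ (univ.image W).filter (fun a => π a = b), (univ.filter fun x => W x = a).card := by
      rw [Finset.card_eq_sum_card_fiberwise (f := W) (t := (univ.image W).filter (fun a => π a = b))
        (fun x hx => by simpa using hx)]
      refine Finset.sum_congr rfl fun a ha => ?_
      congr 1
      ext x
      simp only [mem_filter, mem_univ, true_and] at ha ⊢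
      constructor
      · exact fun h => h.2
      · intro h; exact ⟨by rw [h]; exact ha.2, h⟩
    rw [h2]
    refine (sq_sum_le_card_mul_sum_sq).trans ?_
    exact Nat.mul_le_mul_right _ (hF b)
  refine (Finset.sum_le_sum fun b _ => h1 b).trans ?_
  rw [← Finset.mul_sum]
  refine Nat.mul_le_mul_left _ (le_of_eq ?_)
  rw [← Finset.sum_fiberwise_of_maps_to (s := univ.image W) (t := univ.image fun x => π (W x)) (g := π)]
  intro a ha
  obtain ⟨x, _, rfl⟩ := Finset.mem_image.1 ha
  exact Finset.mem_image_of_mem _ (mem_univ x)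

lemma count_residue (q m : ℕ) (v : ZMod q) : ((range (q * m)).filter fun a => ((a : ℕ) : ZMod q) = v).card ≤ m := by
  refine le_trans (Finset.card_le_card_of_injOn (t := range m) (fun a => a / q) ?_ ?_) (le_of_eq (card_range m))
  · intro a ha
    simp only [coe_filter, mem_range, Set.mem_ofPred_eq] at ha
    simp only [coe_range, Set.mem_Iio]
    exact Nat.div_lt_of_lt_mul ha.1
  · intro a ha b hb hab
    simp only [coe_filter, mem_range, Set.mem_ofPred_eq] at ha hb
    have h1 := ha.2.trans hb.2.symm
    rw [ZMod.natCast_eq_natCast_iff] at h1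
    have h2 : a % q = b % q := h1
    simp only at hab
    rw [← Nat.div_add_mod a q, ← Nat.div_add_mod b q, hab, h2]

lemma cong_count (k s q : ℕ) [NeZero q] (hs : 1 ≤ s) :
    (univ.filter fun nm : (Fin s → ZMod q) × (Fin s → ZMod q) =>
        ∀ j : Fin k, ∑ i, (nm.1 i) ^ ((j : ℕ) + 1) = ∑ i, (nm.2 i) ^ ((j : ℕ) + 1)).card ≤
      (∏ j : Fin k, (s * q ^ (j : ℕ))) * VV s k q := by
  classical
  have hq : 0 < q := Nat.pos_of_ne_zero (NeZero.ne q)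
  set W : (Fin s → Fin q) → Fin k → ℕ := fun n j => ∑ i, (n i : ℕ) ^ ((j : ℕ) + 1) with hW
  set π : (Fin k → ℕ) → Fin k → ZMod q := fun a j => (a j : ZMod q) with hπ
  have h1 := pair_count W π (∏ j : Fin k, (s * q ^ (j : ℕ))) (by
    intro b
    calc _ ≤ (Fintype.piFinset fun j : Fin k => (range (q * (s * q ^ (j : ℕ)))).filter
          fun a => ((a : ℕ) : ZMod q) = b j).card := by
          refine Finset.card_le_card fun a ha => ?_
          simp only [mem_filter, mem_image, mem_univ, true_and] at ha
          obtain ⟨⟨n, rfl⟩, h2⟩ := ha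
          rw [Fintype.mem_piFinset]
          intro j
          rw [mem_filter, mem_range]
          refine ⟨?_, congrFun h2 j⟩
          simp only [hW]
          calc ∑ i, (n i : ℕ) ^ ((j : ℕ) + 1) < ∑ i : Fin s, q ^ ((j : ℕ) + 1) := by
                refine Finset.sum_lt_sum_of_nonempty ⟨⟨0, hs⟩, mem_univ _⟩ fun i _ => ?_
                exact Nat.pow_lt_pow_left (n i).2 (by omega)
            _ = _ := by simp [pow_succ]; ring
      _ = ∏ j : Fin k, ((range (q * (s * q ^ (j : ℕ)))).filter fun a => ((a : ℕ) : ZMod q) = b j).card :=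
          Fintype.card_piFinset _
      _ ≤ _ := Finset.prod_le_prod' fun j _ => count_residue q _ _)
  have h3 : (univ.filter fun nm : (Fin s → Fin q) × (Fin s → Fin q) => W nm.1 = W nm.2).card = VV s k q := by
    unfold VV; congr 1; ext nm; simp [hW, funext_iff]
  rw [h3] at h1
  refine le_trans ?_ h1
  refine Finset.card_le_card_of_injOn (fun nm => ((fun i => ⟨(nm.1 i).val, ZMod.val_lt _⟩), (fun i => ⟨(nm.2 i).val, ZMod.val_lt _⟩))) ?_ ?_
  · intro nm h
    simp only [coe_filter, mem_univ, true_and, Set.mem_ofPred_eq] at h ⊢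
    ext j
    simp only [hπ, hW]
    push_cast
    simpa using h j
  · intro nm _ nm' _ h
    simp only [Prod.mk.injEq, funext_iff, Fin.mk.injEq] at h
    ext i
    · exact ZMod.val_injective q (h.1 i)
    · exact ZMod.val_injective q (h.2 i)

lemma tri_sum (k : ℕ) : k + ∑ j : Fin k, (j : ℕ) = tri k := by
  have h := two_tri k
  have h2 : ∑ j : Fin k, (j : ℕ) = ∑ j ∈ range k, j := (Finset.sum_range (fun j => j)).symm
  have h3 := Finset.sum_range_id_mul_two k
  rw [h2]
  rcases k with _ | k
  · simp [tri]
  · simp only [Nat.add_sub_cancel] at h3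
    nlinarith

lemma moment_bound (k : ℕ) (hk : 1 ≤ k) (ε : ℝ) (hε : 0 < ε) : ∃ C : ℝ, 0 < C ∧ ∀ (q : ℕ) [NeZero q],
    ∑ c : Fin k → ZMod q, ‖∑ n : ZMod q, (ZMod.stdAddChar (∑ j, c j * n ^ ((j : ℕ) + 1)) : ℂ)‖ ^ (2 * tri k) ≤
      C * (q : ℝ) ^ (2 * (tri k : ℝ) + ε) := by
  obtain ⟨C, hC, hV⟩ := vmvt k hk ε hε
  have ht := tri_pos hk
  have ht0 : (0 : ℝ) < tri k := by exact_mod_cast ht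
  refine ⟨(tri k : ℝ) ^ k * C, by positivity, fun q _ => ?_⟩
  have hq : 0 < q := Nat.pos_of_ne_zero (NeZero.ne q)
  have hqR : (0 : ℝ) < q := by exact_mod_cast hq
  rw [moment_count q k (tri k) (ι := ZMod q) (fun n j => n ^ ((j : ℕ) + 1))]
  have h1 : ((univ.filter fun nm : (Fin (tri k) → ZMod q) × (Fin (tri k) → ZMod q) =>
        ∀ j : Fin k, ∑ i, (nm.1 i) ^ ((j : ℕ) + 1) = ∑ i, (nm.2 i) ^ ((j : ℕ) + 1)).card : ℝ) ≤
      (∏ j : Fin k, (((tri k) : ℝ) * (q : ℝ) ^ (j : ℕ))) * (VV (tri k) k q : ℝ) := by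
    exact_mod_cast cong_count k (tri k) q ht
  calc _ ≤ (q : ℝ) ^ k * ((∏ j : Fin k, (((tri k) : ℝ) * (q : ℝ) ^ (j : ℕ))) * (C * (q : ℝ) ^ ((tri k : ℝ) + ε))) := by
        refine mul_le_mul_of_nonneg_left (h1.trans ?_) (by positivity)
        exact mul_le_mul_of_nonneg_left (hV q hq) (by positivity)
    _ = (tri k : ℝ) ^ k * C * ((q : ℝ) ^ (k + ∑ j : Fin k, (j : ℕ)) * (q : ℝ) ^ ((tri k : ℝ) + ε)) := by
        rw [Finset.prod_mul_distrib, Finset.prod_pow_eq_pow_sum, Finset.prod_const, pow_add]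
        simp; ring
    _ = _ := by
        rw [tri_sum, ← Real.rpow_natCast (q : ℝ) (tri k), ← Real.rpow_add hqR]
        congr 2; ring

lemma count_mul_le (q k : ℕ) [NeZero q] (hk : 1 ≤ k) (y : ZMod q) :
    (univ.filter fun t : ZMod q => (k : ZMod q) * t = y).card ≤ k := by
  have hq : 0 < q := Nat.pos_of_ne_zero (NeZero.ne q)
  refine le_trans (Finset.card_le_card_of_injOn (t := (range (q * k)).filter fun a => ((a : ℕ) : ZMod q) = y)
    (fun t => k * t.val) ?_ ?_) (count_residue q k y)
  · intro t ht
    simp only [coe_filter, mem_univ, true_and, Set.mem_ofPred_eq, mem_range] at ht ⊢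
    refine ⟨?_, by push_cast; simpa using ht⟩
    rw [mul_comm q]
    exact Nat.mul_lt_mul_of_pos_left (ZMod.val_lt t) hk
  · intro t _ t' _ h
    exact ZMod.val_injective q (Nat.eq_of_mul_eq_mul_left hk h)

lemma sum_fiber_le {X A : Type} [Fintype X] [Fintype A] [DecidableEq A] (g : X → A) (f : A → ℝ) (hf : ∀ a, 0 ≤ f a) (m : ℕ)
    (hm : ∀ x, (univ.filter fun y => g y = g x).card ≤ m) : ∑ x, f (g x) ≤ m * ∑ a, f a := by
  rw [← Finset.sum_fiberwise (s := univ) (g := g), Finset.mul_sum]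
  refine Finset.sum_le_sum fun a _ => ?_
  rw [Finset.sum_congr rfl (g := fun _ => f a) (by intro x hx; rw [(mem_filter.1 hx).2]), Finset.sum_const, nsmul_eq_mul]
  refine mul_le_mul_of_nonneg_right ?_ (hf a)
  norm_cast
  by_cases h : (univ.filter fun y => g y = a).card = 0
  · omega
  · obtain ⟨x, hx⟩ := Finset.card_pos.1 (Nat.pos_of_ne_zero h)
    rw [← (mem_filter.1 hx).2]
    exact hm x

/-- coefficients of `a (u X + t)^k + b (u X + t)` -/
def orb (k q : ℕ) (a b : ZMod q) (u : (ZMod q)ˣ) (t : ZMod q) : Fin k → ZMod q := fun j =>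
  a * ((k.choose ((j : ℕ) + 1) : ℕ) : ZMod q) * (u : ZMod q) ^ ((j : ℕ) + 1) * t ^ (k - ((j : ℕ) + 1)) +
    if (j : ℕ) = 0 then b * u else 0

lemma orb_eval (k q : ℕ) (hk : 1 ≤ k) (a b : ZMod q) (u : (ZMod q)ˣ) (t n : ZMod q) :
    a * (u * n + t) ^ k + b * (u * n + t) = (a * t ^ k + b * t) + ∑ j, orb k q a b u t j * n ^ ((j : ℕ) + 1) := by
  unfold orb
  simp only [add_mul, Finset.sum_add_distrib]
  have h1 : ∑ j : Fin k, (if (j : ℕ) = 0 then b * (u : ZMod q) else 0) * n ^ ((j : ℕ) + 1) = b * u * n := by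
    rw [Finset.sum_eq_single (⟨0, hk⟩ : Fin k)]
    · simp
    · intro j _ hj
      rw [if_neg (fun h => hj (Fin.ext h)), zero_mul]
    · simp
  rw [h1, add_pow, Finset.sum_range_succ', Finset.sum_range]
  have h2 : a * (∑ i : Fin k, ((u : ZMod q) * n) ^ ((i : ℕ) + 1) * t ^ (k - ((i : ℕ) + 1)) * ((k.choose ((i : ℕ) + 1) : ℕ) : ZMod q)) =
      ∑ j : Fin k, a * ((k.choose ((j : ℕ) + 1) : ℕ) : ZMod q) * (u : ZMod q) ^ ((j : ℕ) + 1) * t ^ (k - ((j : ℕ) + 1)) * n ^ ((j : ℕ) + 1) := by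
    rw [Finset.mul_sum]
    refine Finset.sum_congr rfl fun j _ => ?_
    rw [mul_pow]; ring
  rw [mul_add, h2]
  simp
  ring

lemma orb_norm (k q : ℕ) [NeZero q] (hk : 1 ≤ k) (a b : ZMod q) (u : (ZMod q)ˣ) (t : ZMod q) :
    ‖∑ n : ZMod q, (ZMod.stdAddChar (∑ j, orb k q a b u t j * n ^ ((j : ℕ) + 1)) : ℂ)‖ =
      ‖∑ n : ZMod q, (ZMod.stdAddChar (a * n ^ k + b * n) : ℂ)‖ := by
  let e : ZMod q ≃ ZMod q := (Units.mulLeft u).trans (Equiv.addRight t)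
  have h1 : ∑ n : ZMod q, (ZMod.stdAddChar (a * n ^ k + b * n) : ℂ) =
      ZMod.stdAddChar (a * t ^ k + b * t) * ∑ n : ZMod q, (ZMod.stdAddChar (∑ j, orb k q a b u t j * n ^ ((j : ℕ) + 1)) : ℂ) := by
    rw [← e.sum_comp, Finset.mul_sum]
    refine Finset.sum_congr rfl fun n _ => ?_
    rw [← AddChar.map_add_eq_mul, ← orb_eval k q hk]
    rfl
  rw [h1, norm_mul, AddChar.norm_apply, one_mul]

lemma orb_fiber (k q : ℕ) [NeZero q] (hk : 3 ≤ k) (a b : ZMod q) (ha : IsUnit a) (x : (ZMod q)ˣ × ZMod q) :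
    (univ.filter fun y : (ZMod q)ˣ × ZMod q => orb k q a b y.1 y.2 = orb k q a b x.1 x.2).card ≤ rho k q * k := by
  classical
  set S := univ.filter fun y : (ZMod q)ˣ × ZMod q => orb k q a b y.1 y.2 = orb k q a b x.1 x.2 with hS
  set T : Finset (ZMod q)ˣ := univ.filter fun u => u ^ k = x.1 ^ k with hT
  have hTc : T.card = rho k q := by
    unfold rho
    rw [Nat.card_eq_fintype_card, Fintype.card_subtype]
    refine Finset.card_bij (fun u _ => u * x.1⁻¹) ?_ ?_ ?_
    · intro u hu
      simp only [hT, mem_filter, mem_univ, true_and] at hu ⊢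
      rw [mul_pow, hu, inv_pow, mul_inv_cancel]
    · intro u _ u' _ h
      exact mul_right_cancel h
    · intro u hu
      simp only [mem_filter, mem_univ, true_and] at hu
      exact ⟨u * x.1, by simp [hT, mul_pow, hu], by simp⟩
  have h1 : ∀ y ∈ S, y.1 ∈ T := by
    intro y hy
    have := congrFun (mem_filter.1 hy).2 ⟨k - 1, by omega⟩
    simp only [orb] at this
    rw [show k - 1 + 1 = k by omega, if_neg (by omega), if_neg (by omega)] at this
    simp only [Nat.choose_self, Nat.cast_one, mul_one, Nat.sub_self, pow_zero, add_zero] at this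
    have h2 := ha.mul_left_cancel this
    simp only [hT, mem_filter, mem_univ, true_and]
    ext
    push_cast
    exact h2
  rw [Finset.card_eq_sum_card_fiberwise (f := Prod.fst) (t := T) h1, ← hTc, ← smul_eq_mul]
  refine Finset.sum_le_card_nsmul _ _ _ fun u hu => ?_
  by_cases he : (S.filter fun y => y.1 = u).card = 0
  · omega
  obtain ⟨y0, hy0⟩ := Finset.card_pos.1 (Nat.pos_of_ne_zero he)
  refine le_trans (Finset.card_le_card_of_injOn (t := univ.filter fun t : ZMod q => (k : ZMod q) * t = k * y0.2)
    (fun y => y.2) ?_ ?_) (count_mul_le q k (by omega) _)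
  · intro y hy
    simp only [coe_filter, mem_univ, true_and, Set.mem_ofPred_eq, hS, mem_filter] at hy hy0 ⊢
    have h3 := congrFun (hy.1.trans hy0.1.symm) ⟨k - 2, by omega⟩
    simp only [orb] at h3
    rw [show k - 2 + 1 = k - 1 by omega, if_neg (by omega), if_neg (by omega), hy.2, hy0.2,
      show k - (k - 1) = 1 by omega, show k.choose (k - 1) = k by
        rw [← Nat.choose_symm (by omega), show k - (k - 1) = 1 by omega, Nat.choose_one_right]] at h3
    simp only [pow_one, add_zero] at h3
    have hu' : IsUnit (a * (u : ZMod q) ^ (k - 1)) := ha.mul (u.isUnit.pow _)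
    refine hu'.mul_left_cancel ?_
    linear_combination h3
  · intro y hy y' hy' h
    simp only [coe_filter, mem_univ, true_and, Set.mem_ofPred_eq, hS, mem_filter] at hy hy'
    exact Prod.ext (hy.2.trans hy'.2.symm) h

theorem complete_sum (k : ℕ) (hk : 3 ≤ k) (ε : ℝ) (hε : 0 < ε) : ∃ C : ℝ, 0 < C ∧ ∀ (q : ℕ) [NeZero q] (a b : ZMod q),
    IsUnit a → ‖∑ n : ZMod q, (ZMod.stdAddChar (a * n ^ k + b * n) : ℂ)‖ ≤ C * (q : ℝ) ^ (1 - 1 / (tri k : ℝ) + ε) := by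
  obtain ⟨C1, hC1, h1⟩ := moment_bound k (by omega) ε hε
  obtain ⟨C2, hC2, h2⟩ := phi_bound (ε / 2) (by positivity)
  obtain ⟨C3, hC3, h3⟩ := rho_bound k (by omega) (ε / 2) (by positivity)
  have ht := tri_pos (by omega : 1 ≤ k)
  have htR : (1 : ℝ) ≤ tri k := by exact_mod_cast ht
  set D : ℝ := max 1 (C2 * (C3 * k * C1)) with hD
  have hD1 : 1 ≤ D := le_max_left _ _
  refine ⟨D, by positivity, fun q _ a b ha => ?_⟩
  have hq : 0 < q := Nat.pos_of_ne_zero (NeZero.ne q)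
  have hqR : (0 : ℝ) < q := by exact_mod_cast hq
  have hq1 : (1 : ℝ) ≤ q := by exact_mod_cast hq
  set G := ‖∑ n : ZMod q, (ZMod.stdAddChar (a * n ^ k + b * n) : ℂ)‖ with hG
  have hG0 : 0 ≤ G := norm_nonneg _
  have h4 := sum_fiber_le (fun y : (ZMod q)ˣ × ZMod q => orb k q a b y.1 y.2)
    (fun c => ‖∑ n : ZMod q, (ZMod.stdAddChar (∑ j, c j * n ^ ((j : ℕ) + 1)) : ℂ)‖ ^ (2 * tri k))
    (fun _ => by positivity) _ (orb_fiber k q hk a b ha)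
  simp only [orb_norm k q (by omega : 1 ≤ k)] at h4
  rw [Finset.sum_const, nsmul_eq_mul, Finset.card_univ, Fintype.card_prod, ZMod.card_units_eq_totient, ZMod.card, ← hG] at h4
  push_cast at h4
  have h5 : (q : ℝ) * q * G ^ (2 * tri k) ≤ C2 * (C3 * k * C1) * ((q : ℝ) ^ (2 * (tri k : ℝ) + 2 * ε)) := by
    calc (q : ℝ) * q * G ^ (2 * tri k) ≤ (C2 * (q : ℝ) ^ (ε / 2) * (q.totient : ℝ)) * q * G ^ (2 * tri k) := by
          gcongr; exact h2 q hq
      _ = C2 * (q : ℝ) ^ (ε / 2) * ((q.totient : ℝ) * q * G ^ (2 * tri k)) := by ring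
      _ ≤ C2 * (q : ℝ) ^ (ε / 2) * (rho k q * k * (C1 * (q : ℝ) ^ (2 * (tri k : ℝ) + ε))) := by
          refine mul_le_mul_of_nonneg_left (h4.trans ?_) (by positivity)
          exact mul_le_mul_of_nonneg_left (h1 q) (by positivity)
      _ ≤ C2 * (q : ℝ) ^ (ε / 2) * (C3 * (q : ℝ) ^ (ε / 2) * k * (C1 * (q : ℝ) ^ (2 * (tri k : ℝ) + ε))) := by
          gcongr; exact h3 q hq
      _ = C2 * (C3 * k * C1) * ((q : ℝ) ^ (ε / 2) * (q : ℝ) ^ (ε / 2) * (q : ℝ) ^ (2 * (tri k : ℝ) + ε)) := by ring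
      _ = _ := by
          rw [← Real.rpow_add hqR, ← Real.rpow_add hqR]; congr 2; ring
  have h6 : G ^ (2 * tri k) ≤ (D * (q : ℝ) ^ (1 - 1 / (tri k : ℝ) + ε)) ^ (2 * tri k) := by
    have e1 : ((q : ℝ) ^ (1 - 1 / (tri k : ℝ) + ε)) ^ (2 * tri k) = (q : ℝ) ^ (2 * (tri k : ℝ) - 2 + 2 * (tri k : ℝ) * ε) := by
      rw [← Real.rpow_natCast, ← Real.rpow_mul hqR.le]
      congr 1; push_cast; field_simp
    have e2 : (q : ℝ) ^ (2 * (tri k : ℝ) - 2 + 2 * (tri k : ℝ) * ε) * (q * q) = (q : ℝ) ^ (2 * (tri k : ℝ) + 2 * (tri k : ℝ) * ε) := by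
      rw [← pow_two, ← Real.rpow_natCast, ← Real.rpow_add hqR]; congr 1; push_cast; ring
    have e3 : (q : ℝ) ^ (2 * (tri k : ℝ) + 2 * ε) ≤ (q : ℝ) ^ (2 * (tri k : ℝ) + 2 * (tri k : ℝ) * ε) := by
      refine Real.rpow_le_rpow_of_exponent_le hq1 ?_
      nlinarith
    have e4 : C2 * (C3 * k * C1) ≤ D ^ (2 * tri k) :=
      (le_max_right _ _).trans (le_self_pow₀ hD1 (by omega))
    rw [mul_pow, e1]
    have e5 : 0 < (q : ℝ) * q := by positivity
    refine le_of_mul_le_mul_left (h5.trans ?_) e5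
    calc _ ≤ D ^ (2 * tri k) * (q : ℝ) ^ (2 * (tri k : ℝ) + 2 * (tri k : ℝ) * ε) := by gcongr
      _ = _ := by rw [← e2]; ring
  exact le_of_pow_le_pow_left₀ (by omega) (by positivity) h6

end SFP

namespace SFP
open Finset
open scoped BigOperators

noncomputable def ee (x : ℝ) : ℂ := Complex.exp (2 * Real.pi * Complex.I * x)

lemma ee_add (x y : ℝ) : ee (x + y) = ee x * ee y := by
  unfold ee; rw [← Complex.exp_add]; congr 1; push_cast; ring

lemma ee_zero : ee 0 = 1 := by simp [ee]

lemma ee_norm (x : ℝ) : ‖ee x‖ = 1 := by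
  unfold ee
  rw [show (2 * Real.pi * Complex.I * x : ℂ) = ((2 * Real.pi * x : ℝ) : ℂ) * Complex.I by push_cast; ring]
  exact Complex.norm_exp_ofReal_mul_I _

lemma ee_int (n : ℤ) : ee n = 1 := by
  unfold ee
  rw [Complex.exp_eq_one_iff]
  exact ⟨n, by push_cast; ring⟩

lemma ee_add_int (x : ℝ) (n : ℤ) : ee (x + n) = ee x := by rw [ee_add, ee_int, mul_one]

lemma ee_neg (x : ℝ) : ee (-x) = (starRingEnd ℂ) (ee x) := by
  unfold ee
  rw [← Complex.exp_conj]
  congr 1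
  simp [Complex.conj_ofReal, map_ofNat]

lemma ee_mul_nat (x : ℝ) (n : ℕ) : ee (x * n) = ee x ^ n := by
  unfold ee
  rw [← Complex.exp_nat_mul]; congr 1; push_cast; ring

lemma ee_sum {ι : Type} (s : Finset ι) (f : ι → ℝ) : ee (∑ i ∈ s, f i) = ∏ i ∈ s, ee (f i) := by
  classical
  induction s using Finset.induction_on with
  | empty => simp [ee_zero]
  | insert a s ha ih => rw [Finset.sum_insert ha, Finset.prod_insert ha, ee_add, ih]

/-- distance to the nearest integer -/
noncomputable def nd (x : ℝ) : ℝ := |x - round x|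

lemma nd_nonneg (x : ℝ) : 0 ≤ nd x := abs_nonneg _

lemma nd_le (x : ℝ) (m : ℤ) : nd x ≤ |x - m| := round_le x m

lemma nd_le_half (x : ℝ) : nd x ≤ 1 / 2 := abs_sub_round x

lemma nd_add (x y : ℝ) : nd (x + y) ≤ nd x + nd y := by
  have := nd_le (x + y) (round x + round y)
  refine this.trans ?_
  unfold nd
  push_cast
  rw [show x + y - (round x + round y : ℝ) = (x - round x) + (y - round y) by ring]
  exact abs_add_le _ _

lemma nd_neg (x : ℝ) : nd (-x) = nd x := by
  have h : ∀ x, nd (-x) ≤ nd x := by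
    intro x
    have := nd_le (-x) (-round x)
    refine this.trans (le_of_eq ?_)
    unfold nd
    push_cast
    rw [show -x - -(round x : ℝ) = -(x - round x) by ring, abs_neg]
  exact le_antisymm (h x) (by simpa using h (-x))

lemma nd_sub (x y : ℝ) : nd (x - y) ≤ nd x + nd y := by
  rw [sub_eq_add_neg, ← nd_neg y]; exact nd_add _ _

lemma nd_nat_mul (x : ℝ) (m : ℕ) : nd (m * x) ≤ m * nd x := by
  have := nd_le (m * x) (m * round x)
  refine this.trans (le_of_eq ?_)
  unfold nd
  push_cast
  rw [← mul_sub, abs_mul, abs_of_nonneg (by positivity : (0 : ℝ) ≤ m)]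

lemma nd_add_int (x : ℝ) (m : ℤ) : nd (x + m) = nd x := by
  unfold nd; rw [round_add_intCast]; push_cast; congr 1; ring

/-- lower bound for `|1 - e(θ)|` -/
lemma one_sub_ee (x : ℝ) : 4 * nd x ≤ ‖1 - ee x‖ := by
  set y := x - round x with hy
  have h1 : ee x = ee y := by
    rw [hy, sub_eq_add_neg, ← Int.cast_neg, ee_add_int]
  have hy2 : |y| ≤ 1 / 2 := abs_sub_round x
  have h2 : ‖1 - ee y‖ = 2 * |Real.sin (Real.pi * y)| := by
    have e := Complex.norm_exp_I_mul_ofReal_sub_one (2 * Real.pi * y)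
    rw [norm_sub_rev]
    unfold ee
    rw [show (2 * Real.pi * Complex.I * y : ℂ) = Complex.I * ((2 * Real.pi * y : ℝ) : ℂ) by push_cast; ring, e,
      show 2 * Real.pi * y / 2 = Real.pi * y by ring, norm_mul]
    simp
  rw [h1, h2]
  have h3 : nd x = |y| := rfl
  rw [h3]
  have h4 := Real.mul_abs_le_abs_sin (x := Real.pi * y) (by
    rw [abs_mul, abs_of_pos Real.pi_pos]; nlinarith [Real.pi_pos])
  rw [abs_mul, abs_of_pos Real.pi_pos] at h4
  have : 2 / Real.pi * (Real.pi * |y|) = 2 * |y| := by field_simp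
  linarith


lemma ee_sub_le (x y : ℝ) : ‖ee x - ee y‖ ≤ 2 * Real.pi * |x - y| := by
  have h : ee x - ee y = ee y * (ee (x - y) - 1) := by
    rw [mul_sub, ← ee_add, mul_one]; congr 2; ring
  rw [h, norm_mul, ee_norm, one_mul]
  have e := Real.norm_exp_I_mul_ofReal_sub_one_le (x := 2 * Real.pi * (x - y))
  unfold ee
  rw [show (2 * Real.pi * Complex.I * ((x - y : ℝ) : ℂ) : ℂ) = Complex.I * ((2 * Real.pi * (x - y) : ℝ) : ℂ) by push_cast; ring]
  refine e.trans (le_of_eq ?_)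
  rw [Real.norm_eq_abs, abs_mul, abs_of_pos (by positivity)]

lemma geom_triv (θ c : ℝ) (A R : ℕ) : ‖∑ m ∈ Finset.Ico A (A + R), ee (θ * m + c)‖ ≤ R := by
  refine (norm_sum_le _ _).trans ?_
  simp [ee_norm]

lemma geom_nd (θ : ℝ) (A R : ℕ) : 2 * nd θ * ‖∑ m ∈ Finset.Ico A (A + R), ee (θ * m)‖ ≤ 1 := by
  have h : (1 - ee θ) * ∑ m ∈ Finset.Ico A (A + R), ee (θ * m) = ee (θ * A) - ee (θ * (A + R : ℕ)) := by
    induction R with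
    | zero => simp
    | succ r ih =>
      rw [← add_assoc, Finset.sum_Ico_succ_top (by omega), mul_add, ih]
      have : ee (θ * (A + r + 1 : ℕ)) = ee θ * ee (θ * (A + r : ℕ)) := by
        rw [← ee_add]; congr 1; push_cast; ring
      rw [this]; ring
  have h2 : ‖1 - ee θ‖ * ‖∑ m ∈ Finset.Ico A (A + R), ee (θ * m)‖ ≤ 2 := by
    rw [← norm_mul, h]
    refine (norm_sub_le _ _).trans ?_
    rw [ee_norm, ee_norm]; norm_num
  have h3 := one_sub_ee θ
  have h4 := mul_le_mul_of_nonneg_right h3 (norm_nonneg (∑ m ∈ Finset.Ico A (A + R), ee (θ * m)))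
  linarith

/-- completion weights -/
noncomputable def cw (L h : ℕ) : ℝ := if h = 0 then 1 else (1 / (h : ℝ) + 1 / ((L : ℝ) - h)) / 2

lemma cw_nonneg {L h : ℕ} (hh : h < L) : 0 ≤ cw L h := by
  unfold cw
  split_ifs
  · norm_num
  · have : (0 : ℝ) < (L : ℝ) - h := by
      have : (h : ℝ) < L := by exact_mod_cast hh
      linarith
    positivity

lemma nd_div_ge {L h : ℕ} (hh : h < L) (h0 : h ≠ 0) : 1 ≤ 2 * nd ((h : ℝ) / L) * (L * cw L h) := by
  have hL : (0 : ℝ) < L := by exact_mod_cast (by omega : 0 < L)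
  have hh' : (h : ℝ) < L := by exact_mod_cast hh
  have h0' : (0 : ℝ) < h := by exact_mod_cast Nat.pos_of_ne_zero h0
  have hd : (0 : ℝ) < (L : ℝ) - h := by linarith
  unfold cw
  rw [if_neg h0]
  have key : (h : ℝ) / L ≤ nd ((h : ℝ) / L) ∨ ((L : ℝ) - h) / L ≤ nd ((h : ℝ) / L) := by
    unfold nd
    rcases le_or_gt (round ((h : ℝ) / L)) 0 with hm | hm
    · left
      have : ((round ((h : ℝ) / L) : ℤ) : ℝ) ≤ 0 := by exact_mod_cast hm
      refine le_trans ?_ (le_abs_self _)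
      linarith
    · right
      have : (1 : ℝ) ≤ ((round ((h : ℝ) / L) : ℤ) : ℝ) := by exact_mod_cast hm
      refine le_trans ?_ (neg_le_abs _)
      rw [sub_div, div_self hL.ne']
      linarith
  have e : 2 * nd ((h : ℝ) / L) * (L * ((1 / (h : ℝ) + 1 / ((L : ℝ) - h)) / 2)) = (nd ((h : ℝ) / L) * L) * (1 / (h : ℝ)) + (nd ((h : ℝ) / L) * L) * (1 / ((L : ℝ) - h)) := by ring
  rw [e]
  have hn := nd_nonneg ((h : ℝ) / L)
  rcases key with k | k
  · have : (h : ℝ) ≤ nd ((h : ℝ) / L) * L := by rwa [div_le_iff₀ hL] at k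
    have t1 : 1 ≤ (nd ((h : ℝ) / L) * L) * (1 / (h : ℝ)) := by
      rw [mul_one_div, le_div_iff₀ h0']; linarith
    have t2 : 0 ≤ (nd ((h : ℝ) / L) * L) * (1 / ((L : ℝ) - h)) := by positivity
    linarith
  · have : (L : ℝ) - h ≤ nd ((h : ℝ) / L) * L := by rwa [div_le_iff₀ hL] at k
    have t1 : 1 ≤ (nd ((h : ℝ) / L) * L) * (1 / ((L : ℝ) - h)) := by
      rw [mul_one_div, le_div_iff₀ hd]; linarith
    have t2 : 0 ≤ (nd ((h : ℝ) / L) * L) * (1 / (h : ℝ)) := by positivity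
    linarith

lemma cw_sum (L : ℕ) (hL : 1 ≤ L) : ∑ h ∈ Finset.range L, cw L h ≤ 2 + Real.log L := by
  obtain ⟨M, rfl⟩ : ∃ M, L = M + 1 := ⟨L - 1, by omega⟩
  rw [Finset.sum_range_succ']
  have e1 : ∑ h ∈ Finset.range M, cw (M + 1) (h + 1) = ∑ h ∈ Finset.range M, 1 / ((h : ℝ) + 1) := by
    have : ∀ h ∈ Finset.range M, cw (M + 1) (h + 1) = (1 / ((h : ℝ) + 1)) / 2 + (1 / (((M - 1 - h : ℕ) : ℝ) + 1)) / 2 := by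
      intro h hh
      have hh := Finset.mem_range.1 hh
      unfold cw
      rw [if_neg (by omega)]
      rw [Nat.sub_sub, Nat.cast_sub (by omega)]
      push_cast
      rw [show (M : ℝ) + 1 - (h + 1) = M - (1 + h) + 1 by ring]
      ring
    rw [Finset.sum_congr rfl this, Finset.sum_add_distrib,
      Finset.sum_range_reflect (fun h => (1 / ((h : ℝ) + 1)) / 2) M, ← Finset.sum_div]
    ring
  rw [e1]
  have e2 := harmonic_le_one_add_log M
  have e3 : ((harmonic M : ℚ) : ℝ) = ∑ h ∈ Finset.range M, 1 / ((h : ℝ) + 1) := by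
    unfold harmonic; push_cast; simp
  rw [e3] at e2
  have e4 : Real.log M ≤ Real.log ((M + 1 : ℕ) : ℝ) := by
    rcases Nat.eq_zero_or_pos M with rfl | hM
    · simp
    · exact Real.log_le_log (by exact_mod_cast hM) (by push_cast; linarith)
  have : cw (M + 1) 0 = 1 := by simp [cw]
  linarith

lemma ee_orth (L : ℕ) (hL : 1 ≤ L) (n m : ℕ) (hn : n < L) (hm : m < L) :
    ∑ h ∈ Finset.range L, ee ((h : ℝ) / L * n) * ee (-((h : ℝ) / L) * m) = if n = m then (L : ℂ) else 0 := by
  have hL' : (0 : ℝ) < L := by exact_mod_cast hL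
  have e : ∀ h ∈ Finset.range L, ee ((h : ℝ) / L * n) * ee (-((h : ℝ) / L) * m) = ee (((n : ℝ) - m) / L) ^ h := by
    intro h _
    rw [← ee_add, ← ee_mul_nat]; congr 1; ring
  rw [Finset.sum_congr rfl e]
  split_ifs with hnm
  · subst hnm; simp [ee_zero]
  · have h1 : ee (((n : ℝ) - m) / L) ≠ 1 := by
      intro h
      have h2 := one_sub_ee (((n : ℝ) - m) / L)
      rw [h] at h2
      simp at h2
      have h3 : nd (((n : ℝ) - m) / L) = 0 := le_antisymm (by linarith) (nd_nonneg _)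
      unfold nd at h3
      rw [abs_eq_zero, sub_eq_zero, div_eq_iff hL'.ne'] at h3
      have h4 : (n : ℤ) - m = round (((n : ℝ) - m) / L) * L := by exact_mod_cast h3
      set r := round (((n : ℝ) - m) / L)
      have h5 : r = 0 := by
        by_contra h0
        rcases lt_or_gt_of_ne h0 with h | h
        · have : r * L ≤ -1 * (L : ℤ) := mul_le_mul_of_nonneg_right (by omega) (by omega)
          omega
        · have : 1 * (L : ℤ) ≤ r * L := mul_le_mul_of_nonneg_right (by omega) (by omega)
          omega
      rw [h5] at h4
      omega
    have h2 := geom_sum_eq h1 L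
    rw [h2, ← ee_mul_nat]
    have : ((n : ℝ) - m) / L * L = ((n - m : ℤ) : ℝ) := by push_cast; field_simp
    rw [this, ee_int]; simp

/-- completion -/
lemma completion (f : ℕ → ℂ) (L A R : ℕ) (hL : 1 ≤ L) (hAR : A + R ≤ L) :
    ‖∑ n ∈ Finset.Ico A (A + R), f n‖ ≤
      ∑ h ∈ Finset.range L, cw L h * ‖∑ n ∈ Finset.range L, f n * ee ((h : ℝ) / L * n)‖ := by
  have hL' : (0 : ℝ) < L := by exact_mod_cast hL
  have e : (L : ℂ) * ∑ n ∈ Finset.Ico A (A + R), f n =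
      ∑ h ∈ Finset.range L, (∑ m ∈ Finset.Ico A (A + R), ee (-((h : ℝ) / L) * m)) * ∑ n ∈ Finset.range L, f n * ee ((h : ℝ) / L * n) := by
    have : ∀ h ∈ Finset.range L, (∑ m ∈ Finset.Ico A (A + R), ee (-((h : ℝ) / L) * m)) * ∑ n ∈ Finset.range L, f n * ee ((h : ℝ) / L * n)
      = ∑ m ∈ Finset.Ico A (A + R), ∑ n ∈ Finset.range L, f n * (ee ((h : ℝ) / L * n) * ee (-((h : ℝ) / L) * m)) := by
      intro h _
      rw [Finset.sum_mul_sum]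
      refine Finset.sum_congr rfl fun m _ => Finset.sum_congr rfl fun n _ => by ring
    rw [Finset.sum_congr rfl this, Finset.sum_comm, Finset.mul_sum]
    refine Finset.sum_congr rfl fun m hm => ?_
    have hm := Finset.mem_Ico.1 hm
    rw [Finset.sum_comm]
    have : ∀ n ∈ Finset.range L, ∑ h ∈ Finset.range L, f n * (ee ((h : ℝ) / L * n) * ee (-((h : ℝ) / L) * m)) = if n = m then f n * L else 0 := by
      intro n hn
      rw [← Finset.mul_sum, ee_orth L hL n m (Finset.mem_range.1 hn) (by omega)]
      split_ifs <;> simp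
    rw [Finset.sum_congr rfl this, Finset.sum_ite_eq' (Finset.range L) m, if_pos (Finset.mem_range.2 (by omega))]
    ring
  have e2 : (L : ℝ) * ‖∑ n ∈ Finset.Ico A (A + R), f n‖ ≤ L * ∑ h ∈ Finset.range L, cw L h * ‖∑ n ∈ Finset.range L, f n * ee ((h : ℝ) / L * n)‖ := by
    have : (L : ℝ) * ‖∑ n ∈ Finset.Ico A (A + R), f n‖ = ‖(L : ℂ) * ∑ n ∈ Finset.Ico A (A + R), f n‖ := by
      rw [norm_mul, Complex.norm_natCast]
    rw [this, e, Finset.mul_sum]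
    refine (norm_sum_le _ _).trans (Finset.sum_le_sum fun h hh => ?_)
    have hh := Finset.mem_range.1 hh
    rw [norm_mul, ← mul_assoc]
    refine mul_le_mul_of_nonneg_right ?_ (norm_nonneg _)
    by_cases h0 : h = 0
    · have := geom_triv (-((h : ℝ) / L)) 0 A R
      simp only [add_zero] at this
      have h3 : cw L h = 1 := by simp [cw, h0]
      have h4 : (R : ℝ) ≤ L := by exact_mod_cast (by omega : R ≤ L)
      rw [h3]; linarith
    · have h1 := geom_nd (-((h : ℝ) / L)) A R
      rw [nd_neg] at h1
      have h2 := nd_div_ge hh h0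
      have h3 : 0 < 2 * nd ((h : ℝ) / L) := by
        rcases (nd_nonneg ((h : ℝ) / L)).lt_or_eq with h | h
        · linarith
        · rw [← h] at h2; norm_num at h2
      exact le_of_mul_le_mul_left (h1.trans h2) h3
  exact le_of_mul_le_mul_left e2 hL'

lemma completion_sup (f : ℕ → ℂ) (L A R : ℕ) (hL : 1 ≤ L) (hAR : A + R ≤ L) (B : ℝ)
    (hB : ∀ h < L, ‖∑ n ∈ Finset.range L, f n * ee ((h : ℝ) / L * n)‖ ≤ B) :
    ‖∑ n ∈ Finset.Ico A (A + R), f n‖ ≤ (2 + Real.log L) * B := by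
  have hB0 : 0 ≤ B := (norm_nonneg _).trans (hB 0 hL)
  refine (completion f L A R hL hAR).trans ?_
  refine le_trans (Finset.sum_le_sum fun h hh => mul_le_mul_of_nonneg_left (hB h (Finset.mem_range.1 hh)) (cw_nonneg (Finset.mem_range.1 hh))) ?_
  rw [← Finset.sum_mul]
  exact mul_le_mul_of_nonneg_right (cw_sum L hL) hB0

end SFP

namespace SFP
open Finset
open scoped BigOperators

/-- the Weyl sum -/
noncomputable def SS (k N : ℕ) (α : ℝ) : ℂ := ∑ n ∈ Finset.Ico 1 (1 + N), ee (α * (n : ℝ) ^ k)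

lemma SS_le (k N : ℕ) (α : ℝ) : ‖SS k N α‖ ≤ N := by
  refine (norm_sum_le _ _).trans ?_
  simp [ee_norm]

lemma ee_std (q : ℕ) [NeZero q] (m : ℤ) : ee ((m : ℝ) / q) = (ZMod.stdAddChar ((m : ZMod q)) : ℂ) := by
  rw [ZMod.stdAddChar_coe]
  unfold ee
  congr 1; push_cast; ring

lemma sum_range_zmod (q : ℕ) [NeZero q] (g : ZMod q → ℂ) : ∑ n ∈ Finset.range q, g (n : ZMod q) = ∑ n : ZMod q, g n := by
  refine Finset.sum_bij' (fun n _ => (n : ZMod q)) (fun x _ => x.val) ?_ ?_ ?_ ?_ ?_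
  · simp
  · intro x _; exact Finset.mem_range.2 (ZMod.val_lt x)
  · intro n hn; exact ZMod.val_cast_of_lt (Finset.mem_range.1 hn)
  · intro x _; exact ZMod.natCast_zmod_val x
  · simp

lemma incomplete (k : ℕ) (q : ℕ) [NeZero q] (B : ℝ) (a : ℤ)
    (hB : ∀ b : ZMod q, ‖∑ n : ZMod q, (ZMod.stdAddChar ((a : ZMod q) * n ^ k + b * n) : ℂ)‖ ≤ B)
    (A R : ℕ) (hR : R ≤ q) :
    ‖∑ n ∈ Finset.Ico A (A + R), ee ((a : ℝ) / q * (n : ℝ) ^ k)‖ ≤ (2 + Real.log q) * B := by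
  have hq : 1 ≤ q := Nat.one_le_iff_ne_zero.2 (NeZero.ne q)
  have h0 : ∑ n ∈ Finset.Ico A (A + R), ee ((a : ℝ) / q * (n : ℝ) ^ k) =
      ∑ n ∈ Finset.Ico 0 (0 + R), ee ((a : ℝ) / q * ((A + n : ℕ) : ℝ) ^ k) := by
    rw [Finset.sum_Ico_eq_sum_range, Finset.sum_Ico_eq_sum_range]
    simp
  rw [h0]
  refine completion_sup (fun n => ee ((a : ℝ) / q * ((A + n : ℕ) : ℝ) ^ k)) q 0 R hq (by omega) B ?_
  intro h _
  have e : ∀ n ∈ Finset.range q, ee ((a : ℝ) / q * ((A + n : ℕ) : ℝ) ^ k) * ee ((h : ℝ) / q * n) =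
      (fun x : ZMod q => (ZMod.stdAddChar ((a : ZMod q) * ((A : ZMod q) + x) ^ k + (h : ZMod q) * x) : ℂ)) (n : ZMod q) := by
    intro n _
    rw [← ee_add]
    have := ee_std q (a * ((A + n : ℕ) : ℤ) ^ k + h * n)
    push_cast at this
    simp only
    rw [← this]
    congr 1; push_cast; ring
  rw [Finset.sum_congr rfl e, sum_range_zmod q (fun x : ZMod q => (ZMod.stdAddChar ((a : ZMod q) * ((A : ZMod q) + x) ^ k + (h : ZMod q) * x) : ℂ))]
  have e2 : ∑ n : ZMod q, (ZMod.stdAddChar ((a : ZMod q) * ((A : ZMod q) + n) ^ k + (h : ZMod q) * n) : ℂ)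
      = (ZMod.stdAddChar (-((h : ZMod q) * (A : ZMod q))) : ℂ) * ∑ n : ZMod q, (ZMod.stdAddChar ((a : ZMod q) * n ^ k + (h : ZMod q) * n) : ℂ) := by
    rw [Finset.mul_sum, ← Equiv.sum_comp (Equiv.addLeft (A : ZMod q)) (fun n => (ZMod.stdAddChar (-((h : ZMod q) * (A : ZMod q))) : ℂ) * (ZMod.stdAddChar ((a : ZMod q) * n ^ k + (h : ZMod q) * n) : ℂ))]
    refine Finset.sum_congr rfl fun n _ => ?_
    rw [← AddChar.map_add_eq_mul]
    congr 1
    simp only [Equiv.coe_addLeft]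
    ring
  rw [e2, norm_mul, AddChar.norm_apply, one_mul]
  exact hB _

lemma abel_bound (u v : ℕ → ℂ) (A R : ℕ) (B : ℝ) (hv : ∀ n, ‖v n‖ ≤ 1)
    (hU : ∀ r ≤ R, ‖∑ n ∈ Finset.Ico A (A + r), u n‖ ≤ B) :
    ‖∑ n ∈ Finset.Ico A (A + R), u n * v n‖ ≤ B * (1 + ∑ n ∈ Finset.Ico A (A + R), ‖v (n + 1) - v n‖) := by
  have hB : 0 ≤ B := (norm_nonneg _).trans (hU 0 (by omega))
  have h : ∀ R : ℕ, ∑ n ∈ Finset.Ico A (A + R), u n * v n = (∑ m ∈ Finset.Ico A (A + R), u m) * v (A + R)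
      - ∑ n ∈ Finset.Ico A (A + R), (∑ m ∈ Finset.Ico A (n + 1), u m) * (v (n + 1) - v n) := by
    intro R
    induction R with
    | zero => simp
    | succ r ih =>
      rw [← add_assoc, Finset.sum_Ico_succ_top (by omega), ih,
        Finset.sum_Ico_succ_top (f := fun n => (∑ m ∈ Finset.Ico A (n + 1), u m) * (v (n + 1) - v n)) (by omega),
        Finset.sum_Ico_succ_top (f := u) (by omega)]
      ring
  rw [h]
  refine (norm_sub_le _ _).trans ?_
  rw [mul_add, mul_one, Finset.mul_sum]
  refine add_le_add ?_ ((norm_sum_le _ _).trans (Finset.sum_le_sum fun n hn => ?_))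
  · rw [norm_mul]
    calc _ ≤ B * 1 := mul_le_mul (hU R le_rfl) (hv _) (norm_nonneg _) hB
      _ = B := mul_one _
  · have hn := Finset.mem_Ico.1 hn
    rw [norm_mul]
    refine mul_le_mul_of_nonneg_right ?_ (norm_nonneg _)
    have := hU (n + 1 - A) (by omega)
    rwa [show A + (n + 1 - A) = n + 1 by omega] at this

lemma blocks (f : ℕ → ℂ) (q N : ℕ) (hq : 1 ≤ q) (B : ℝ)
    (hB : ∀ A R, R ≤ q → 1 ≤ A → A + R ≤ 1 + N → ‖∑ n ∈ Finset.Ico A (A + R), f n‖ ≤ B) :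
    ∀ R A, 1 ≤ A → A + R ≤ 1 + N → ‖∑ n ∈ Finset.Ico A (A + R), f n‖ ≤ ((R : ℝ) / q + 1) * B := by
  have hq' : (0 : ℝ) < q := by exact_mod_cast hq
  have hB0 : 0 ≤ B := (norm_nonneg _).trans (hB 1 0 (by omega) le_rfl (by omega))
  intro R
  induction R using Nat.strong_induction_on with
  | _ R ih =>
    intro A hA hAR
    rcases le_or_gt R q with h | h
    · refine (hB A R h hA hAR).trans ?_
      have : 0 ≤ (R : ℝ) / q * B := by positivity
      linarith
    · rw [← Finset.sum_Ico_consecutive f (show A ≤ A + q by omega) (show A + q ≤ A + R by omega)]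
      have h1 := hB A q le_rfl hA (by omega)
      have h2 := ih (R - q) (by omega) (A + q) (by omega) (by omega)
      rw [show A + q + (R - q) = A + R by omega, Nat.cast_sub h.le, sub_div, div_self hq'.ne'] at h2
      refine (norm_add_le _ _).trans ?_
      linarith

lemma pow_diff (k n M : ℕ) (h : n + 1 ≤ M) : |((n + 1 : ℕ) : ℝ) ^ k - (n : ℝ) ^ k| ≤ k * (M : ℝ) ^ (k - 1) := by
  have hnm : ((n : ℝ) + 1) ≤ M := by exact_mod_cast h
  have h1 : |((n + 1 : ℕ) : ℝ) ^ k - (n : ℝ) ^ k| ≤ |((n + 1 : ℕ) : ℝ) - n| * k * (max |((n + 1 : ℕ) : ℝ)| |(n : ℝ)|) ^ (k - 1) :=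
    abs_pow_sub_pow_le _ _ _
  refine h1.trans ?_
  push_cast
  rw [add_sub_cancel_left, abs_one, one_mul]
  gcongr
  refine max_le ?_ ?_
  · rw [abs_of_nonneg (by positivity)]; exact hnm
  · rw [abs_of_nonneg (by positivity)]; linarith

lemma log_bound (ε : ℝ) (hε : 0 < ε) (x : ℝ) (hx : 1 ≤ x) : 2 + Real.log x ≤ (2 + 1 / ε) * x ^ ε := by
  have h1 := Real.log_le_rpow_div (by linarith : (0 : ℝ) ≤ x) hε
  have h2 := Real.one_le_rpow hx hε.le
  have : x ^ ε / ε = 1 / ε * x ^ ε := by ring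
  rw [this] at h1
  nlinarith

lemma major_arc (k : ℕ) (hk : 3 ≤ k) (ε : ℝ) (hε : 0 < ε) : ∃ C : ℝ, 0 < C ∧ ∀ (q N : ℕ) (a : ℤ) (β : ℝ),
    1 ≤ q → q ≤ N → IsCoprime a (q : ℤ) → q * (N : ℝ) ^ (k - 1) * |β| ≤ 1 →
    ‖SS k N ((a : ℝ) / q + β)‖ ≤ C * N * (q : ℝ) ^ (-(1 / (tri k : ℝ)) + ε) := by
  obtain ⟨C, hC, h⟩ := complete_sum k hk (ε / 2) (by linarith)
  refine ⟨2 * ((2 + 1 / (ε / 2)) * C * (1 + 2 * Real.pi * (k * 2 ^ (k - 1)))), by positivity, ?_⟩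
  intro q N a β hq hqN hcop hβ
  have : NeZero q := ⟨by omega⟩
  have hq' : (1 : ℝ) ≤ q := by exact_mod_cast hq
  have hq0 : (0 : ℝ) < q := by linarith
  have hu : IsUnit (a : ZMod q) := by
    obtain ⟨x, y, hxy⟩ := hcop
    refine IsUnit.of_mul_eq_one (x : ZMod q) ?_
    have := congrArg (fun z : ℤ => (z : ZMod q)) hxy
    push_cast at this
    rw [ZMod.natCast_self] at this
    rw [mul_comm]
    simpa using this
  set B := (2 + Real.log q) * (C * (q : ℝ) ^ (1 - 1 / (tri k : ℝ) + ε / 2)) with hBdef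
  have hB0 : 0 ≤ B := by
    have := Real.log_nonneg hq'
    positivity
  have hI : ∀ A R : ℕ, R ≤ q → ‖∑ n ∈ Finset.Ico A (A + R), ee ((a : ℝ) / q * (n : ℝ) ^ k)‖ ≤ B :=
    fun A R hR => incomplete k q _ a (fun b => h q a b hu) A R hR
  set P := 1 + 2 * Real.pi * (k * 2 ^ (k - 1)) with hP
  have hP0 : 0 < P := by positivity
  have hbl : ∀ A R, R ≤ q → 1 ≤ A → A + R ≤ 1 + N →
      ‖∑ n ∈ Finset.Ico A (A + R), ee (((a : ℝ) / q + β) * (n : ℝ) ^ k)‖ ≤ B * P := by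
    intro A R hR hA hAR
    have e : ∀ n ∈ Finset.Ico A (A + R), ee (((a : ℝ) / q + β) * (n : ℝ) ^ k) = ee ((a : ℝ) / q * (n : ℝ) ^ k) * ee (β * (n : ℝ) ^ k) := by
      intro n _; rw [← ee_add]; congr 1; ring
    rw [Finset.sum_congr rfl e]
    refine (abel_bound _ (fun n => ee (β * (n : ℝ) ^ k)) A R B (fun n => (ee_norm _).le) (fun r hr => hI A r (by omega))).trans ?_
    refine mul_le_mul_of_nonneg_left ?_ hB0
    rw [hP]
    gcongr
    have : ∀ n ∈ Finset.Ico A (A + R), ‖ee (β * ((n + 1 : ℕ) : ℝ) ^ k) - ee (β * (n : ℝ) ^ k)‖ ≤ 2 * Real.pi * (|β| * (k * ((2 * N : ℕ) : ℝ) ^ (k - 1))) := by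
      intro n hn
      have hn := Finset.mem_Ico.1 hn
      refine (ee_sub_le _ _).trans ?_
      rw [← mul_sub, abs_mul]
      gcongr
      exact pow_diff k n (2 * N) (by omega)
    refine (Finset.sum_le_sum this).trans ?_
    rw [Finset.sum_const, Nat.card_Ico, nsmul_eq_mul, show A + R - A = R by omega]
    have hR' : (R : ℝ) ≤ q := by exact_mod_cast hR
    calc (R : ℝ) * (2 * Real.pi * (|β| * (k * ((2 * N : ℕ) : ℝ) ^ (k - 1)))) ≤ q * (2 * Real.pi * (|β| * (k * ((2 * N : ℕ) : ℝ) ^ (k - 1)))) := by gcongr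
      _ = 2 * Real.pi * (k * 2 ^ (k - 1)) * (q * (N : ℝ) ^ (k - 1) * |β|) := by push_cast; rw [mul_pow]; ring
      _ ≤ 2 * Real.pi * (k * 2 ^ (k - 1)) * 1 := by gcongr
      _ = _ := mul_one _
  have hfin := blocks _ q N hq (B * P) hbl N 1 le_rfl le_rfl
  refine hfin.trans ?_
  have hNq : (1 : ℝ) ≤ (N : ℝ) / q := by
    rw [le_div_iff₀ hq0, one_mul]; exact_mod_cast hqN
  have hBle : B ≤ (2 + 1 / (ε / 2)) * C * (q * (q : ℝ) ^ (-(1 / (tri k : ℝ)) + ε)) := by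
    have l := log_bound (ε / 2) (by linarith) q hq'
    have e : (q : ℝ) * (q : ℝ) ^ (-(1 / (tri k : ℝ)) + ε) = (q : ℝ) ^ (ε / 2) * (q : ℝ) ^ (1 - 1 / (tri k : ℝ) + ε / 2) := by
      rw [← Real.rpow_add hq0]
      nth_rewrite 1 [← Real.rpow_one (q : ℝ)]
      rw [← Real.rpow_add hq0]; congr 1; ring
    rw [e, hBdef]
    calc _ ≤ ((2 + 1 / (ε / 2)) * (q : ℝ) ^ (ε / 2)) * (C * (q : ℝ) ^ (1 - 1 / (tri k : ℝ) + ε / 2)) := by gcongr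
      _ = _ := by ring
  calc ((N : ℝ) / q + 1) * (B * P) ≤ ((N : ℝ) / q + (N : ℝ) / q) * (((2 + 1 / (ε / 2)) * C * (q * (q : ℝ) ^ (-(1 / (tri k : ℝ)) + ε))) * P) := by gcongr
    _ = _ := by field_simp; ring

end SFP

namespace SFP
open Finset
open scoped BigOperators

lemma normsq_eq (z : ℂ) : ((‖z‖ ^ 2 : ℝ) : ℂ) = (starRingEnd ℂ) z * z := by
  rw [mul_comm, Complex.mul_conj, Complex.normSq_eq_norm_sq]

lemma cs_complex {ι : Type} (s : Finset ι) (f g : ι → ℂ) :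
    ‖∑ i ∈ s, f i * g i‖ ^ 2 ≤ (∑ i ∈ s, ‖f i‖ ^ 2) * ∑ i ∈ s, ‖g i‖ ^ 2 := by
  have h1 : ‖∑ i ∈ s, f i * g i‖ ≤ ∑ i ∈ s, ‖f i‖ * ‖g i‖ := by
    refine (norm_sum_le _ _).trans (le_of_eq (Finset.sum_congr rfl fun i _ => norm_mul _ _))
  calc ‖∑ i ∈ s, f i * g i‖ ^ 2 ≤ (∑ i ∈ s, ‖f i‖ * ‖g i‖) ^ 2 := by gcongr
    _ ≤ _ := Finset.sum_mul_sq_le_sq_mul_sq _ _ _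

lemma large_sieve {T : Type} [Fintype T] (θ : T → ℝ) (M : ℕ) (Δ : ℝ) (hΔ0 : 0 ≤ Δ)
    (hΔ : ∀ t, ∑ t', ‖∑ m ∈ range M, ee ((θ t - θ t') * m)‖ ≤ Δ) (a : ℕ → ℂ) :
    ∑ t, ‖∑ m ∈ range M, a m * ee (θ t * m)‖ ^ 2 ≤ Δ * ∑ m ∈ range M, ‖a m‖ ^ 2 := by
  set F : T → ℂ := fun t => ∑ m ∈ range M, a m * ee (θ t * m) with hF
  set X : ℝ := ∑ t, ‖F t‖ ^ 2 with hX
  have hX0 : 0 ≤ X := Finset.sum_nonneg fun t _ => by positivity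
  have hKsym : ∀ t t', ‖∑ m ∈ range M, ee ((θ t' - θ t) * m)‖ = ‖∑ m ∈ range M, ee ((θ t - θ t') * m)‖ := by
    intro t t'
    rw [← RCLike.norm_conj (∑ m ∈ range M, ee ((θ t - θ t') * m)), map_sum]
    congr 1
    refine Finset.sum_congr rfl fun m _ => ?_
    rw [← ee_neg]; congr 1; ring
  have e1 : (X : ℂ) = ∑ m ∈ range M, a m * ∑ t, (starRingEnd ℂ) (F t) * ee (θ t * m) := by
    rw [hX]; push_cast
    have : ∀ t, ((‖F t‖ : ℂ)) ^ 2 = ∑ m ∈ range M, a m * ((starRingEnd ℂ) (F t) * ee (θ t * m)) := by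
      intro t
      have := normsq_eq (F t)
      push_cast at this
      rw [this]
      nth_rewrite 2 [hF]
      simp only
      rw [Finset.mul_sum]
      refine Finset.sum_congr rfl fun m _ => by ring
    rw [Finset.sum_congr rfl (fun t _ => this t), Finset.sum_comm]
    refine Finset.sum_congr rfl fun m _ => by rw [Finset.mul_sum]
  have e2 : X ^ 2 ≤ (∑ m ∈ range M, ‖a m‖ ^ 2) * ∑ m ∈ range M, ‖∑ t, (starRingEnd ℂ) (F t) * ee (θ t * m)‖ ^ 2 := by
    have := cs_complex (range M) a (fun m => ∑ t, (starRingEnd ℂ) (F t) * ee (θ t * m))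
    rw [← e1, Complex.norm_real, Real.norm_eq_abs, sq_abs] at this
    exact this
  have e3 : ∑ m ∈ range M, ‖∑ t, (starRingEnd ℂ) (F t) * ee (θ t * m)‖ ^ 2 ≤ Δ * X := by
    have h1 : ((∑ m ∈ range M, ‖∑ t, (starRingEnd ℂ) (F t) * ee (θ t * m)‖ ^ 2 : ℝ) : ℂ) =
        ∑ t, ∑ t', (F t * (starRingEnd ℂ) (F t')) * ∑ m ∈ range M, ee ((θ t' - θ t) * m) := by
      push_cast
      have : ∀ m ∈ range M, ((‖∑ t, (starRingEnd ℂ) (F t) * ee (θ t * m)‖ : ℂ)) ^ 2 =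
          ∑ t, ∑ t', (F t * (starRingEnd ℂ) (F t')) * ee ((θ t' - θ t) * m) := by
        intro m _
        have := normsq_eq (∑ t, (starRingEnd ℂ) (F t) * ee (θ t * m))
        push_cast at this
        rw [this, map_sum, Finset.sum_mul_sum]
        refine Finset.sum_congr rfl fun t _ => Finset.sum_congr rfl fun t' _ => ?_
        rw [map_mul, Complex.conj_conj, ← ee_neg, show (θ t' - θ t) * (m : ℝ) = -(θ t * m) + θ t' * m by ring, ee_add]
        ring
      rw [Finset.sum_congr rfl this, Finset.sum_comm]
      refine Finset.sum_congr rfl fun t _ => ?_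
      rw [Finset.sum_comm]
      refine Finset.sum_congr rfl fun t' _ => ?_
      rw [Finset.mul_sum]
    have h2 : ∑ m ∈ range M, ‖∑ t, (starRingEnd ℂ) (F t) * ee (θ t * m)‖ ^ 2 ≤
        ∑ t, ∑ t', (‖F t‖ * ‖F t'‖) * ‖∑ m ∈ range M, ee ((θ t' - θ t) * m)‖ := by
      have : ∑ m ∈ range M, ‖∑ t, (starRingEnd ℂ) (F t) * ee (θ t * m)‖ ^ 2 =
          ‖((∑ m ∈ range M, ‖∑ t, (starRingEnd ℂ) (F t) * ee (θ t * m)‖ ^ 2 : ℝ) : ℂ)‖ := by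
        rw [Complex.norm_real, Real.norm_eq_abs, abs_of_nonneg (Finset.sum_nonneg fun _ _ => by positivity)]
      rw [this, h1]
      refine (norm_sum_le _ _).trans (Finset.sum_le_sum fun t _ => (norm_sum_le _ _).trans (Finset.sum_le_sum fun t' _ => ?_))
      rw [norm_mul, norm_mul, RCLike.norm_conj]
    have h3 : ∑ t, ∑ t', (‖F t‖ * ‖F t'‖) * ‖∑ m ∈ range M, ee ((θ t' - θ t) * m)‖ ≤
        ∑ t, ∑ t', (‖F t‖ ^ 2 / 2 * ‖∑ m ∈ range M, ee ((θ t' - θ t) * m)‖ + ‖F t'‖ ^ 2 / 2 * ‖∑ m ∈ range M, ee ((θ t' - θ t) * m)‖) := by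
      refine Finset.sum_le_sum fun t _ => Finset.sum_le_sum fun t' _ => ?_
      rw [← add_mul]
      refine mul_le_mul_of_nonneg_right ?_ (norm_nonneg _)
      nlinarith [pow_two_nonneg (‖F t‖ - ‖F t'‖)]
    have h4 : ∑ t, ∑ t', ‖F t‖ ^ 2 / 2 * ‖∑ m ∈ range M, ee ((θ t' - θ t) * m)‖ ≤ Δ * X / 2 := by
      have : Δ * X / 2 = ∑ t, ‖F t‖ ^ 2 / 2 * Δ := by
        rw [← Finset.sum_mul, ← Finset.sum_div]; ring
      rw [this]
      refine Finset.sum_le_sum fun t _ => ?_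
      rw [← Finset.mul_sum]
      refine mul_le_mul_of_nonneg_left ?_ (by positivity)
      refine le_trans (le_of_eq ?_) (hΔ t)
      exact Finset.sum_congr rfl fun t' _ => hKsym t t'
    have h5 : ∑ t, ∑ t', ‖F t'‖ ^ 2 / 2 * ‖∑ m ∈ range M, ee ((θ t' - θ t) * m)‖ ≤ Δ * X / 2 := by
      rw [Finset.sum_comm]
      refine le_trans (le_of_eq ?_) h4
      refine Finset.sum_congr rfl fun t _ => Finset.sum_congr rfl fun t' _ => ?_
      rw [hKsym t t']
    refine h2.trans (h3.trans ?_)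
    simp only [Finset.sum_add_distrib]
    linarith
  have ha : 0 ≤ ∑ m ∈ range M, ‖a m‖ ^ 2 := Finset.sum_nonneg fun _ _ => by positivity
  rcases hX0.lt_or_eq with h | h
  · have : X * X ≤ (Δ * ∑ m ∈ range M, ‖a m‖ ^ 2) * X := by
      calc X * X = X ^ 2 := by ring
        _ ≤ _ := e2
        _ ≤ (∑ m ∈ range M, ‖a m‖ ^ 2) * (Δ * X) := by gcongr
        _ = _ := by ring
    exact le_of_mul_le_mul_right this h
  · rw [← h]
    positivity

lemma grouped {T X Υ : Type} [Fintype T] [Fintype X] [DecidableEq Υ] (θ : T → ℝ) (M : ℕ) (Δ : ℝ) (hΔ0 : 0 ≤ Δ)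
    (hΔ : ∀ t, ∑ t', ‖∑ m ∈ range M, ee ((θ t - θ t') * m)‖ ≤ Δ)
    (u : X → Υ) (Ub : Finset Υ) (hu : ∀ x, u x ∈ Ub) (m : X → ℕ) (hm : ∀ x, m x < M)
    (B : X → ℂ) (hB : ∀ x, ‖B x‖ ≤ 1) (φ : T → Υ → ℝ) :
    ∑ t, ‖∑ x, B x * ee (φ t (u x) + θ t * m x)‖ ^ 2 ≤
      Ub.card * Δ * (univ.filter fun xy : X × X => (u xy.1, m xy.1) = (u xy.2, m xy.2)).card := by
  set a : Υ → ℕ → ℂ := fun v n => ∑ x ∈ univ.filter (fun x => (u x, m x) = (v, n)), B x with ha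
  have h1 : ∀ t, ∑ x, B x * ee (φ t (u x) + θ t * m x) = ∑ v ∈ Ub, ee (φ t v) * ∑ n ∈ range M, a v n * ee (θ t * n) := by
    intro t
    rw [← Finset.sum_fiberwise_of_maps_to (s := univ) (t := Ub ×ˢ range M) (g := fun x => (u x, m x))
      (fun x _ => Finset.mem_product.2 ⟨hu x, Finset.mem_range.2 (hm x)⟩), Finset.sum_product]
    refine Finset.sum_congr rfl fun v _ => ?_
    rw [Finset.mul_sum]
    refine Finset.sum_congr rfl fun n _ => ?_
    rw [ha]
    simp only
    rw [Finset.sum_mul, Finset.mul_sum]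
    refine Finset.sum_congr rfl fun x hx => ?_
    have hx := (Finset.mem_filter.1 hx).2
    rw [Prod.mk.injEq] at hx
    rw [hx.1, hx.2, ee_add]; ring
  have h2 : ∀ t, ‖∑ x, B x * ee (φ t (u x) + θ t * m x)‖ ^ 2 ≤ Ub.card * ∑ v ∈ Ub, ‖∑ n ∈ range M, a v n * ee (θ t * n)‖ ^ 2 := by
    intro t
    rw [h1]
    refine (cs_complex _ _ _).trans (le_of_eq ?_)
    simp [ee_norm]
  have h3 : ∑ v ∈ Ub, ∑ n ∈ range M, ‖a v n‖ ^ 2 ≤ (univ.filter fun xy : X × X => (u xy.1, m xy.1) = (u xy.2, m xy.2)).card := by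
    rw [pair_eq (fun x => (u x, m x))]
    push_cast
    rw [← Finset.sum_product']
    have hsub : univ.image (fun x => (u x, m x)) ⊆ Ub ×ˢ range M := by
      intro y hy
      obtain ⟨x, _, rfl⟩ := Finset.mem_image.1 hy
      exact Finset.mem_product.2 ⟨hu x, Finset.mem_range.2 (hm x)⟩
    rw [← Finset.sum_subset hsub (f := fun y => ‖a y.1 y.2‖ ^ 2)]
    · refine Finset.sum_le_sum fun y _ => ?_
      gcongr
      refine (norm_sum_le _ _).trans ((Finset.sum_le_sum fun x _ => hB x).trans ?_)
      simp
    · intro y _ hy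
      have : univ.filter (fun x => (u x, m x) = (y.1, y.2)) = ∅ := by
        refine Finset.filter_eq_empty_iff.2 fun x _ hx => hy ?_
        exact Finset.mem_image.2 ⟨x, Finset.mem_univ _, hx⟩
      simp only [ha]
      rw [this]; simp
  calc ∑ t, ‖∑ x, B x * ee (φ t (u x) + θ t * m x)‖ ^ 2
      ≤ ∑ t, Ub.card * ∑ v ∈ Ub, ‖∑ n ∈ range M, a v n * ee (θ t * n)‖ ^ 2 := Finset.sum_le_sum fun t _ => h2 t
    _ = Ub.card * ∑ v ∈ Ub, ∑ t, ‖∑ n ∈ range M, a v n * ee (θ t * n)‖ ^ 2 := by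
        rw [← Finset.mul_sum, Finset.sum_comm]
    _ ≤ Ub.card * ∑ v ∈ Ub, Δ * ∑ n ∈ range M, ‖a v n‖ ^ 2 := by
        gcongr with v hv
        exact large_sieve θ M Δ hΔ0 hΔ _
    _ = Ub.card * Δ * ∑ v ∈ Ub, ∑ n ∈ range M, ‖a v n‖ ^ 2 := by rw [← Finset.mul_sum]; ring
    _ ≤ _ := by gcongr

/-- the moment over shifts, in terms of the Vinogradov count -/
lemma moment_shift {T : Type} [Fintype T] (s e L : ℕ) (γ : T → Fin (e + 1) → ℝ) (b : ℕ → ℂ) (hb : ∀ n, ‖b n‖ ≤ 1)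
    (Δ : ℝ) (hΔ0 : 0 ≤ Δ)
    (hΔ : ∀ t, ∑ t', ‖∑ m ∈ range (s * L ^ (e + 1) + 1), ee ((γ t (Fin.last e) - γ t' (Fin.last e)) * m)‖ ≤ Δ) :
    ∑ t, ‖∑ n ∈ range L, b n * ee (∑ j, γ t j * (n : ℝ) ^ ((j : ℕ) + 1))‖ ^ (2 * s) ≤
      (∏ j : Fin e, ((s * L ^ ((j : ℕ) + 1) + 1 : ℕ) : ℝ)) * Δ * VV s (e + 1) L := by
  have hbox : ∀ (x : Fin s → Fin L) (j : ℕ), ∑ i, (x i : ℕ) ^ j < s * L ^ j + 1 := by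
    intro x j
    refine Nat.lt_succ_of_le ?_
    refine (Finset.sum_le_sum fun i _ => Nat.pow_le_pow_left (x i).2.le j).trans ?_
    simp
  have key := grouped (T := T) (X := Fin s → Fin L) (Υ := Fin e → ℕ) (fun t => γ t (Fin.last e)) (s * L ^ (e + 1) + 1) Δ hΔ0 hΔ
    (fun x j => ∑ i, (x i : ℕ) ^ ((j : ℕ) + 1))
    (Fintype.piFinset fun j : Fin e => range (s * L ^ ((j : ℕ) + 1) + 1))
    (fun x => Fintype.mem_piFinset.2 fun j => Finset.mem_range.2 (hbox x _))
    (fun x => ∑ i, (x i : ℕ) ^ (e + 1)) (fun x => hbox x _)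
    (fun x => ∏ i, b (x i)) (fun x => by
      rw [norm_prod]; exact Finset.prod_le_one (fun _ _ => norm_nonneg _) (fun i _ => hb _))
    (fun t v => ∑ j : Fin e, γ t j.castSucc * (v j : ℝ))
  have hV : (univ.filter fun xy : (Fin s → Fin L) × (Fin s → Fin L) =>
      ((fun j : Fin e => ∑ i, (xy.1 i : ℕ) ^ ((j : ℕ) + 1)), ∑ i, (xy.1 i : ℕ) ^ (e + 1)) =
      ((fun j : Fin e => ∑ i, (xy.2 i : ℕ) ^ ((j : ℕ) + 1)), ∑ i, (xy.2 i : ℕ) ^ (e + 1))).card = VV s (e + 1) L := by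
    unfold VV
    congr 1
    refine Finset.filter_congr fun xy _ => ?_
    rw [Prod.mk.injEq, funext_iff, Fin.forall_fin_succ']
    simp
  rw [hV, Fintype.card_piFinset] at key
  simp only [card_range] at key
  push_cast at key ⊢
  refine le_trans (le_of_eq ?_) key
  refine Finset.sum_congr rfl fun t _ => ?_
  rw [mul_comm 2 s, pow_mul, ← norm_pow]
  congr 2
  rw [← Fin.sum_univ_eq_sum_range (fun n => b n * ee (∑ j, γ t j * (n : ℝ) ^ ((j : ℕ) + 1))), Fintype.sum_pow]
  refine Finset.sum_congr rfl fun x _ => ?_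
  rw [Finset.prod_mul_distrib, ← ee_sum]
  congr 2
  rw [Finset.sum_comm, Fin.sum_univ_castSucc]
  congr 1
  · refine Finset.sum_congr rfl fun j _ => ?_
    rw [Finset.mul_sum]; simp
  · rw [Finset.mul_sum]; simp

end SFP

namespace SFP
open Finset
open scoped BigOperators

/-- modulus of a geometric sum -/
noncomputable def GG (θ : ℝ) (M r : ℕ) : ℝ := ‖∑ m ∈ range M, ee (θ * r * m)‖

lemma GG_nonneg (θ : ℝ) (M r : ℕ) : 0 ≤ GG θ M r := norm_nonneg _

lemma GG_le (θ : ℝ) (M r : ℕ) : GG θ M r ≤ M := by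
  have := geom_triv (θ * r) 0 0 M
  simpa [GG] using this

lemma GG_nd (θ : ℝ) (M r : ℕ) : 2 * nd (θ * r) * GG θ M r ≤ 1 := by
  have := geom_nd (θ * r) 0 M
  simpa [GG] using this

lemma dist_sum (N : ℕ) (g : ℕ → ℝ) (hg : ∀ r, 0 ≤ g r) (f : ℕ → ℝ) (t : ℕ) (ht : t < N)
    (h1 : ∀ t' ≤ t, f t' = g (t - t')) (h2 : ∀ t', t < t' → f t' = g (t' - t)) :
    ∑ t' ∈ range N, f t' ≤ 2 * ∑ r ∈ range N, g r := by
  rw [← Finset.sum_filter_add_sum_filter_not (range N) (fun t' => t' ≤ t), two_mul]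
  refine add_le_add ?_ ?_
  · rw [Finset.sum_congr rfl (g := fun t' => g (t - t')) (fun t' h => h1 t' (Finset.mem_filter.1 h).2)]
    rw [← Finset.sum_image (f := g) (g := fun t' => t - t')]
    · refine Finset.sum_le_sum_of_subset_of_nonneg ?_ fun _ _ _ => hg _
      intro x hx
      obtain ⟨y, hy, rfl⟩ := Finset.mem_image.1 hx
      exact Finset.mem_range.2 (by omega)
    · intro x hx y hy hxy
      simp only [coe_filter, mem_range, Set.mem_ofPred_eq] at hx hy
      simp only at hxy
      omega
  · rw [Finset.sum_congr rfl (g := fun t' => g (t' - t)) (fun t' h => h2 t' (by have := (Finset.mem_filter.1 h).2; omega))]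
    rw [← Finset.sum_image (f := g) (g := fun t' => t' - t)]
    · refine Finset.sum_le_sum_of_subset_of_nonneg ?_ fun _ _ _ => hg _
      intro x hx
      obtain ⟨y, hy, rfl⟩ := Finset.mem_image.1 hx
      have := Finset.mem_range.1 (Finset.mem_filter.1 hy).1
      exact Finset.mem_range.2 (by omega)
    · intro x hx y hy hxy
      simp only [coe_filter, mem_range, Set.mem_ofPred_eq] at hx hy
      simp only at hxy
      omega

lemma weighted_holder {ι : Type} (I : Finset ι) (w z : ι → ℝ) (hw : ∀ i ∈ I, 0 ≤ w i) (hz : ∀ i ∈ I, 0 ≤ z i)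
    (hW : 0 < ∑ i ∈ I, w i) (n : ℕ) :
    (∑ i ∈ I, w i * z i) ^ n ≤ (∑ i ∈ I, w i) ^ n / (∑ i ∈ I, w i) * ∑ i ∈ I, w i * z i ^ n := by
  set W := ∑ i ∈ I, w i with hWd
  have h := Real.pow_arith_mean_le_arith_mean_pow I (fun i => w i / W) z (fun i hi => div_nonneg (hw i hi) hW.le)
    (by rw [← Finset.sum_div, div_self hW.ne']) hz n
  have e1 : ∑ i ∈ I, w i / W * z i = (∑ i ∈ I, w i * z i) / W := by
    rw [Finset.sum_div]; exact Finset.sum_congr rfl fun i _ => by ring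
  have e2 : ∑ i ∈ I, w i / W * z i ^ n = (∑ i ∈ I, w i * z i ^ n) / W := by
    rw [Finset.sum_div]; exact Finset.sum_congr rfl fun i _ => by ring
  rw [e1, e2, div_pow, div_le_iff₀ (by positivity)] at h
  refine h.trans (le_of_eq (by ring))

/-- coefficients of the shifted polynomial -/
noncomputable def gam (e : ℕ) (α t : ℝ) (j : Fin (e + 1)) : ℝ := α * ((e + 2).choose ((j : ℕ) + 1)) * (-t) ^ (e + 2 - ((j : ℕ) + 1))

lemma gam_last (e : ℕ) (α t : ℝ) : gam e α t (Fin.last e) = -(((e + 2 : ℕ) : ℝ) * α * t) := by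
  unfold gam
  rw [Fin.val_last, show e + 2 = (e + 1) + 1 by rfl, Nat.choose_succ_self_right, show e + 1 + 1 - (e + 1) = 1 by omega]
  push_cast; ring

lemma shift_expand (e : ℕ) (α n t : ℝ) : α * (n - t) ^ (e + 2) =
    α * n ^ (e + 2) + (∑ j, gam e α t j * n ^ ((j : ℕ) + 1)) + α * (-t) ^ (e + 2) := by
  rw [sub_eq_add_neg, add_pow, Finset.sum_range_succ, Finset.sum_range_succ', ← Fin.sum_univ_eq_sum_range (fun i => n ^ (i + 1) * (-t) ^ (e + 2 - (i + 1)) * ((e + 2).choose (i + 1) : ℝ))]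
  rw [mul_add, mul_add, Finset.mul_sum]
  simp only [gam]
  have : ∀ i : Fin (e + 1), α * (n ^ ((i : ℕ) + 1) * (-t) ^ (e + 2 - ((i : ℕ) + 1)) * ((e + 2).choose ((i : ℕ) + 1) : ℝ)) =
      α * ((e + 2).choose ((i : ℕ) + 1)) * (-t) ^ (e + 2 - ((i : ℕ) + 1)) * n ^ ((i : ℕ) + 1) := by
    intro i; ring
  rw [Finset.sum_congr rfl fun i _ => this i]
  simp
  ring

lemma weyl_core (e N : ℕ) (hN : 1 ≤ N) (s : ℕ) (α : ℝ) :
    N * ‖SS (e + 2) N α‖ ^ (2 * s) ≤ (2 + Real.log ((2 * N : ℕ) : ℝ)) ^ (2 * s) *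
      ((∏ j : Fin e, ((s * (2 * N) ^ ((j : ℕ) + 1) + 1 : ℕ) : ℝ)) *
        (2 * ∑ r ∈ range N, GG (((e + 2 : ℕ) : ℝ) * α) (s * (2 * N) ^ (e + 1) + 1) r) * VV s (e + 1) (2 * N)) := by
  set L := 2 * N with hL
  set M := s * L ^ (e + 1) + 1 with hM
  set G := ∑ r ∈ range N, GG (((e + 2 : ℕ) : ℝ) * α) M r with hG
  have hG0 : 0 ≤ G := Finset.sum_nonneg fun _ _ => GG_nonneg _ _ _
  set Q := (∏ j : Fin e, ((s * L ^ ((j : ℕ) + 1) + 1 : ℕ) : ℝ)) * (2 * G) * VV s (e + 1) L with hQ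
  have hQ0 : 0 ≤ Q := by
    have : 0 ≤ (∏ j : Fin e, ((s * L ^ ((j : ℕ) + 1) + 1 : ℕ) : ℝ)) := Finset.prod_nonneg fun _ _ => by positivity
    positivity
  have hΔ : ∀ t : Fin N, ∑ t' : Fin N, ‖∑ m ∈ range M, ee ((gam e α (t : ℕ) (Fin.last e) - gam e α (t' : ℕ) (Fin.last e)) * m)‖ ≤ 2 * G := by
    intro t
    rw [Fin.sum_univ_eq_sum_range (fun t' => ‖∑ m ∈ range M, ee ((gam e α (t : ℕ) (Fin.last e) - gam e α (t' : ℕ) (Fin.last e)) * m)‖)]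
    refine dist_sum N (GG (((e + 2 : ℕ) : ℝ) * α) M) (fun r => GG_nonneg _ _ _) _ t t.2 ?_ ?_
    · intro t' ht'
      unfold GG
      rw [← RCLike.norm_conj (∑ m ∈ range M, ee ((((e + 2 : ℕ) : ℝ) * α) * ((t - t' : ℕ) : ℝ) * m)), map_sum]
      congr 1
      refine Finset.sum_congr rfl fun m _ => ?_
      rw [← ee_neg, gam_last, gam_last, Nat.cast_sub ht']
      congr 1; ring
    · intro t' ht'
      unfold GG
      congr 1
      refine Finset.sum_congr rfl fun m _ => ?_
      rw [gam_last, gam_last, Nat.cast_sub ht'.le]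
      congr 1; ring
  set Gh : ℕ → ℕ → ℝ := fun h t => ‖∑ n ∈ range L, ee (α * ((n : ℝ) - t) ^ (e + 2)) * ee ((h : ℝ) / L * n)‖ with hGh
  have hmom : ∀ h, ∑ t ∈ range N, Gh h t ^ (2 * s) ≤ Q := by
    intro h
    have := moment_shift (T := Fin N) s e L (fun t => gam e α (t : ℕ)) (fun n => ee (α * (n : ℝ) ^ (e + 2) + (h : ℝ) / L * n))
      (fun n => (ee_norm _).le) (2 * G) (by positivity) hΔ
    refine le_trans (le_of_eq ?_) this
    rw [← Fin.sum_univ_eq_sum_range (fun t => Gh h t ^ (2 * s))]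
    refine Finset.sum_congr rfl fun t _ => ?_
    congr 1
    simp only [hGh]
    have e1 : ∀ n ∈ range L, ee (α * ((n : ℝ) - (t : ℕ)) ^ (e + 2)) * ee ((h : ℝ) / L * n) =
        ee (α * (-((t : ℕ) : ℝ)) ^ (e + 2)) * (ee (α * (n : ℝ) ^ (e + 2) + (h : ℝ) / L * n) * ee (∑ j, gam e α (t : ℕ) j * (n : ℝ) ^ ((j : ℕ) + 1))) := by
      intro n _
      rw [shift_expand, ← ee_add, ← ee_add, ← ee_add]; congr 1; ring
    rw [Finset.sum_congr rfl e1, ← Finset.mul_sum, norm_mul, ee_norm, one_mul]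
  have hL1 : 1 ≤ L := by omega
  set W := ∑ h ∈ range L, cw L h with hW
  have hWpos : 0 < W := by
    refine lt_of_lt_of_le (by norm_num : (0 : ℝ) < 1) ?_
    have : cw L 0 = 1 := by simp [cw]
    rw [← this]
    exact Finset.single_le_sum (f := cw L) (fun h hh => cw_nonneg (Finset.mem_range.1 hh)) (Finset.mem_range.2 hL1)
  have hSS : ∀ t ∈ range N, ‖SS (e + 2) N α‖ ≤ ∑ h ∈ range L, cw L h * Gh h t := by
    intro t ht
    have ht := Finset.mem_range.1 ht
    have := completion (fun n => ee (α * ((n : ℝ) - t) ^ (e + 2))) L (1 + t) N hL1 (by omega)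
    refine le_trans (le_of_eq ?_) this
    unfold SS
    congr 1
    rw [Finset.sum_Ico_eq_sum_range, Finset.sum_Ico_eq_sum_range, show 1 + N - 1 = N by omega, show 1 + t + N - (1 + t) = N by omega]
    refine Finset.sum_congr rfl fun i _ => ?_
    congr 2; push_cast; ring
  have h1 : ∀ t ∈ range N, ‖SS (e + 2) N α‖ ^ (2 * s) ≤ W ^ (2 * s) / W * ∑ h ∈ range L, cw L h * Gh h t ^ (2 * s) := by
    intro t ht
    refine le_trans (pow_le_pow_left₀ (norm_nonneg _) (hSS t ht) _) ?_
    exact weighted_holder _ _ _ (fun h hh => cw_nonneg (Finset.mem_range.1 hh)) (fun h _ => norm_nonneg _) hWpos _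
  have h2 : N * ‖SS (e + 2) N α‖ ^ (2 * s) ≤ W ^ (2 * s) * Q := by
    calc N * ‖SS (e + 2) N α‖ ^ (2 * s) = ∑ t ∈ range N, ‖SS (e + 2) N α‖ ^ (2 * s) := by simp
      _ ≤ ∑ t ∈ range N, W ^ (2 * s) / W * ∑ h ∈ range L, cw L h * Gh h t ^ (2 * s) := Finset.sum_le_sum h1
      _ = W ^ (2 * s) / W * ∑ h ∈ range L, cw L h * ∑ t ∈ range N, Gh h t ^ (2 * s) := by
          rw [← Finset.mul_sum, Finset.sum_comm]
          congr 1
          exact Finset.sum_congr rfl fun h _ => by rw [Finset.mul_sum]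
      _ ≤ W ^ (2 * s) / W * ∑ h ∈ range L, cw L h * Q := by
          refine mul_le_mul_of_nonneg_left (Finset.sum_le_sum fun h hh => ?_) (by positivity)
          exact mul_le_mul_of_nonneg_left (hmom h) (cw_nonneg (Finset.mem_range.1 hh))
      _ = W ^ (2 * s) * Q := by rw [← Finset.sum_mul, ← hW]; field_simp
  refine h2.trans ?_
  have hWle := cw_sum L hL1
  gcongr

/-- Weyl's inequality from Vinogradov's mean value theorem -/
theorem weyl (e : ℕ) (ε : ℝ) (hε : 0 < ε) : ∃ C : ℝ, 0 < C ∧ ∀ (N : ℕ) (α : ℝ), 1 ≤ N →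
    ‖SS (e + 2) N α‖ ^ (2 * tri (e + 1)) ≤ C * (N : ℝ) ^ (2 * (tri (e + 1) : ℝ) - (e + 2) + ε) *
      ∑ r ∈ range N, GG (((e + 2 : ℕ) : ℝ) * α) (tri (e + 1) * (2 * N) ^ (e + 1) + 1) r := by
  set s := tri (e + 1) with hs
  have hs1 : 0 < s := tri_pos (by omega)
  have hs0 : (0 : ℝ) < s := by exact_mod_cast hs1
  obtain ⟨C, hC, hV⟩ := vmvt (e + 1) (by omega) (ε / 2) (by linarith)
  set ε2 := ε / (4 * s) with hε2
  have hε2p : 0 < ε2 := by positivity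
  set E : ℝ := 2 * (s : ℝ) - (e + 1) + ε with hE
  refine ⟨(2 + 1 / ε2) ^ (2 * s) * ((s : ℝ) + 1) ^ e * 2 * C * 2 ^ E, by positivity, ?_⟩
  intro N α hN
  have hN0 : (0 : ℝ) < N := by exact_mod_cast hN
  have core := weyl_core e N hN s α
  set G := ∑ r ∈ range N, GG (((e + 2 : ℕ) : ℝ) * α) (s * (2 * N) ^ (e + 1) + 1) r
  have hG0 : 0 ≤ G := Finset.sum_nonneg fun _ _ => GG_nonneg _ _ _
  set L := 2 * N with hL
  have hL1 : (1 : ℝ) ≤ (L : ℝ) := by exact_mod_cast (by omega : 1 ≤ L)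
  have hL0 : (0 : ℝ) < L := by linarith
  have hlog := log_bound ε2 hε2p L hL1
  have hlog0 := Real.log_nonneg hL1
  have hVL := hV L (by omega)
  rw [← hs] at hVL
  have hprod : (∏ j : Fin e, ((s * L ^ ((j : ℕ) + 1) + 1 : ℕ) : ℝ)) ≤ ((s : ℝ) + 1) ^ e * (L : ℝ) ^ (tri e) := by
    have h1 : ∀ j : Fin e, ((s * L ^ ((j : ℕ) + 1) + 1 : ℕ) : ℝ) ≤ ((s : ℝ) + 1) * (L : ℝ) ^ ((j : ℕ) + 1) := by
      intro j
      push_cast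
      have := one_le_pow₀ hL1 (n := (j : ℕ) + 1)
      linarith
    refine (Finset.prod_le_prod (fun j _ => by positivity) fun j _ => h1 j).trans (le_of_eq ?_)
    rw [Finset.prod_mul_distrib, Finset.prod_pow_eq_pow_sum, Finset.sum_add_distrib, ← tri_sum e]
    simp [add_comm]
  have hexp : ((L : ℝ) ^ ε2) ^ (2 * s) * (L : ℝ) ^ (tri e) * (L : ℝ) ^ ((s : ℝ) + ε / 2) = (L : ℝ) ^ E := by
    rw [← Real.rpow_natCast ((L : ℝ) ^ ε2) (2 * s), ← Real.rpow_mul hL0.le, ← Real.rpow_natCast (L : ℝ) (tri e), ← Real.rpow_add hL0, ← Real.rpow_add hL0]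
    congr 1
    have t1 : (2 * (tri e : ℝ)) = e * (e + 1) := by exact_mod_cast two_tri e
    have t2 : (2 * (s : ℝ)) = (e + 1) * (e + 1 + 1) := by rw [hs]; exact_mod_cast two_tri (e + 1)
    have t3 : ε2 * ((2 * s : ℕ) : ℝ) = ε / 2 := by rw [hε2]; push_cast; field_simp; ring
    rw [t3, hE]; nlinarith
  have hfinal : N * ‖SS (e + 2) N α‖ ^ (2 * s) ≤ N * ((2 + 1 / ε2) ^ (2 * s) * ((s : ℝ) + 1) ^ e * 2 * C * 2 ^ E * (N : ℝ) ^ (2 * (s : ℝ) - (e + 2) + ε) * G) := by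
    refine core.trans ?_
    calc _ ≤ ((2 + 1 / ε2) * (L : ℝ) ^ ε2) ^ (2 * s) * ((((s : ℝ) + 1) ^ e * (L : ℝ) ^ (tri e)) * (2 * G) * (C * (L : ℝ) ^ ((s : ℝ) + ε / 2))) := by
          gcongr
      _ = (2 + 1 / ε2) ^ (2 * s) * ((s : ℝ) + 1) ^ e * 2 * C * G * (((L : ℝ) ^ ε2) ^ (2 * s) * (L : ℝ) ^ (tri e) * (L : ℝ) ^ ((s : ℝ) + ε / 2)) := by
          rw [mul_pow]; ring
      _ = _ := by
          rw [hexp, hL]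
          push_cast
          rw [Real.mul_rpow (by norm_num) hN0.le]
          have : (N : ℝ) ^ E = N * (N : ℝ) ^ (2 * (s : ℝ) - (e + 2) + ε) := by
            nth_rewrite 2 [← Real.rpow_one (N : ℝ)]
            rw [← Real.rpow_add hN0, hE]; congr 1; ring
          rw [this]; ring
  exact le_of_mul_le_mul_left hfinal hN0

end SFP

namespace SFP
open Finset
open scoped BigOperators

lemma gap_aux (D : ℕ) (Z : Finset ℕ) : (∀ x ∈ Z, ∀ y ∈ Z, x < y → D + x ≤ y) → Z.Nonempty → ∃ x ∈ Z, (∀ y ∈ Z, y ≤ x) ∧ D * (Z.card - 1) ≤ x := by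
  induction Z using Finset.induction_on_max with
  | empty => intro _ h; simp at h
  | insert a s ha ih =>
    intro h _
    refine ⟨a, Finset.mem_insert_self _ _, ?_, ?_⟩
    · intro y hy
      rcases Finset.mem_insert.1 hy with rfl | hy
      · exact le_rfl
      · exact (ha y hy).le
    · have hna : a ∉ s := fun h => lt_irrefl _ (ha a h)
      rw [Finset.card_insert_of_notMem hna, Nat.add_sub_cancel]
      rcases s.eq_empty_or_nonempty with rfl | hs
      · simp
      · obtain ⟨x, hx, _, hxc⟩ := ih (fun x hx y hy => h x (Finset.mem_insert_of_mem hx) y (Finset.mem_insert_of_mem hy)) hs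
        have h1 := h x (Finset.mem_insert_of_mem hx) a (Finset.mem_insert_self _ _) (ha x hx)
        have hc : 1 ≤ s.card := Finset.card_pos.2 hs
        obtain ⟨c, hc⟩ : ∃ c, s.card = c + 1 := ⟨s.card - 1, by omega⟩
        rw [hc] at hxc ⊢
        rw [Nat.add_sub_cancel] at hxc
        rw [mul_add, mul_one]
        omega

lemma gap_lemma (Z : Finset ℕ) (N : ℕ) (hZ : ∀ x ∈ Z, x ≤ N) (hc : 2 ≤ Z.card) :
    ∃ x ∈ Z, ∃ y ∈ Z, x < y ∧ (y - x) * (Z.card - 1) ≤ N := by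
  by_contra hcon
  push Not at hcon
  have hne : Z.Nonempty := Finset.card_pos.1 (by omega)
  obtain ⟨x, hx, _, hxc⟩ := gap_aux (N / (Z.card - 1) + 1) Z (by
    intro x hx y hy hxy
    have h := hcon x hx y hy hxy
    have : N / (Z.card - 1) < y - x := by
      rw [Nat.div_lt_iff_lt_mul (by omega)]; exact h
    omega) hne
  have h1 := hZ x hx
  have h2 : N < (N / (Z.card - 1) + 1) * (Z.card - 1) := by
    have := Nat.lt_div_mul_add (a := N) (b := Z.card - 1) (by omega)
    rw [add_mul, one_mul]; exact this
  omega

lemma nd_small (y : ℝ) (hy : |y| ≤ 1 / 2) : |y| ≤ nd y := by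
  unfold nd
  by_cases h : round y = 0
  · rw [h]; simp
  · have h1 : (1 : ℝ) ≤ |((round y : ℤ) : ℝ)| := by
      exact_mod_cast Int.one_le_abs h
    have h2 := abs_sub_abs_le_abs_sub ((round y : ℤ) : ℝ) y
    rw [abs_sub_comm] at h2
    linarith

lemma nd_frac (a : ℤ) (q r : ℕ) (hq : 1 ≤ q) (hcop : IsCoprime a (q : ℤ)) (hr : ¬ q ∣ r) : 1 / (q : ℝ) ≤ nd ((a : ℝ) / q * r) := by
  have hq0 : (0 : ℝ) < q := by exact_mod_cast hq
  unfold nd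
  set m := round ((a : ℝ) / q * r)
  have h1 : a * r - m * q ≠ 0 := by
    intro h
    apply hr
    have : (q : ℤ) ∣ a * r := ⟨m, by linarith⟩
    have := hcop.symm.dvd_of_dvd_mul_left this
    exact_mod_cast this
  have h2 : (1 : ℝ) ≤ |((a * r - m * q : ℤ) : ℝ)| := by exact_mod_cast Int.one_le_abs h1
  have h3 : (a : ℝ) / q * r - m = ((a * r - m * q : ℤ) : ℝ) / q := by push_cast; field_simp
  rw [h3, abs_div, abs_of_pos hq0]
  gcongr

lemma inv_sum_le (N : ℕ) : ∑ m ∈ range N, 1 / (m : ℝ) ≤ 1 + Real.log N := by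
  rcases N with _ | M
  · simp
  · rw [Finset.sum_range_succ']
    have e2 := harmonic_le_one_add_log M
    have e3 : ((harmonic M : ℚ) : ℝ) = ∑ h ∈ Finset.range M, 1 / (((h + 1 : ℕ)) : ℝ) := by
      unfold harmonic; push_cast; simp
    rw [e3] at e2
    have e4 : Real.log M ≤ Real.log ((M + 1 : ℕ) : ℝ) := by
      rcases Nat.eq_zero_or_pos M with rfl | hM
      · simp
      · exact Real.log_le_log (by exact_mod_cast hM) (by push_cast; linarith)
    simp only [Nat.cast_zero, div_zero, add_zero]
    linarith

/-- reduce a fraction -/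
lemma reduce_frac (b : ℤ) (q0 : ℕ) (h : 1 ≤ q0) : ∃ (a : ℤ) (q : ℕ), 1 ≤ q ∧ q ≤ q0 ∧ IsCoprime a (q : ℤ) ∧ (b : ℝ) / q0 = (a : ℝ) / q := by
  refine ⟨((b : ℚ) / q0).num, ((b : ℚ) / q0).den, Rat.den_pos _, ?_, ?_, ?_⟩
  · have h1 : ((((b : ℚ) / ((q0 : ℤ) : ℚ)).den : ℤ)) ∣ (q0 : ℤ) := by
      rw [← Rat.divInt_eq_div]; exact Rat.den_dvd b q0
    have := Int.le_of_dvd (by omega) h1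
    push_cast at this
    exact_mod_cast this
  · rw [Int.isCoprime_iff_gcd_eq_one]
    exact ((b : ℚ) / q0).reduced
  · have := Rat.num_div_den ((b : ℚ) / q0)
    have h2 := congrArg (fun x : ℚ => (x : ℝ)) this
    push_cast at h2
    exact h2.symm

set_option maxHeartbeats 2000000 in
lemma arcs (N M : ℕ) (hN : 1 ≤ N) (hM : 1 ≤ M) (θ : ℝ) (g : ℕ → ℝ) (hg0 : ∀ r, 0 ≤ g r) (hgM : ∀ r, g r ≤ M)
    (hgn : ∀ r : ℕ, 2 * nd (θ * r) * g r ≤ 1) (G : ℝ) (hG : G = ∑ r ∈ range N, g r)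
    (hG1 : 4 * (M : ℝ) ≤ G) (hG2 : 4 * (N : ℝ) ^ 2 ≤ G) :
    ∃ (a : ℤ) (q : ℕ), 1 ≤ q ∧ (q : ℝ) ≤ 4 * N * M / G ∧ |θ * q - a| ≤ (1 + Real.log N) / G := by
  have hN0 : (0 : ℝ) < N := by exact_mod_cast hN
  have hN1 : (1 : ℝ) ≤ N := by exact_mod_cast hN
  have hM0 : (0 : ℝ) < M := by exact_mod_cast hM
  have hGp : 0 < G := by linarith
  set η := N / G with hη
  have hη0 : 0 < η := by positivity
  set Z := (range N).filter fun r : ℕ => nd (θ * r) ≤ η with hZ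
  have hsplit : G ≤ M * Z.card + G / 2 := by
    nth_rewrite 1 [hG]
    rw [← Finset.sum_filter_add_sum_filter_not (range N) (fun r : ℕ => nd (θ * r) ≤ η)]
    refine add_le_add ?_ ?_
    · refine (Finset.sum_le_sum fun r _ => hgM r).trans (le_of_eq ?_)
      rw [Finset.sum_const, nsmul_eq_mul, mul_comm]
    · have : ∀ r ∈ (range N).filter (fun r : ℕ => ¬ nd (θ * r) ≤ η), g r ≤ 1 / (2 * η) := by
        intro r hr
        have hr := (Finset.mem_filter.1 hr).2
        push Not at hr
        rw [le_div_iff₀ (by positivity)]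
        have := hgn r
        have := mul_le_mul_of_nonneg_right hr.le (hg0 r)
        linarith
      refine (Finset.sum_le_sum this).trans ?_
      rw [Finset.sum_const, nsmul_eq_mul]
      have hc : (((range N).filter (fun r : ℕ => ¬ nd (θ * r) ≤ η)).card : ℝ) ≤ N := by
        have := Finset.card_filter_le (range N) (fun r : ℕ => ¬ nd (θ * r) ≤ η)
        rw [card_range] at this
        exact_mod_cast this
      calc _ ≤ (N : ℝ) * (1 / (2 * η)) := by gcongr
        _ = G / 2 := by rw [hη]; field_simp
  have hcard : G / (2 * M) ≤ Z.card := by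
    rw [div_le_iff₀ (by positivity)]; linarith
  have hcard2 : 2 ≤ Z.card := by
    have : (2 : ℝ) ≤ Z.card := by
      refine le_trans ?_ hcard
      rw [le_div_iff₀ (by positivity)]; linarith
    exact_mod_cast this
  obtain ⟨x, hx, y, hy, hxy, hgap⟩ := gap_lemma Z N (fun x hx => (Finset.mem_range.1 (Finset.mem_filter.1 hx).1).le) hcard2
  obtain ⟨q0, hq0⟩ : ∃ q0, q0 = y - x := ⟨_, rfl⟩
  rw [← hq0] at hgap
  have hq01 : 1 ≤ q0 := by omega
  have hq0p : (0 : ℝ) < q0 := by exact_mod_cast hq01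
  have hq0b : (q0 : ℝ) ≤ 4 * N * M / G := by
    have h1 : (q0 : ℝ) * ((Z.card : ℝ) - 1) ≤ N := by
      have : ((q0 * (Z.card - 1) : ℕ) : ℝ) ≤ N := by exact_mod_cast hgap
      rw [Nat.cast_mul, Nat.cast_sub (by omega)] at this
      simpa using this
    have h2 : (2 : ℝ) ≤ Z.card := by exact_mod_cast hcard2
    have h3 : G / (4 * M) ≤ (Z.card : ℝ) - 1 := by
      have : G / (4 * M) = G / (2 * M) / 2 := by field_simp; ring
      linarith
    have h4 : (q0 : ℝ) * (G / (4 * M)) ≤ N := (mul_le_mul_of_nonneg_left h3 hq0p.le).trans h1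
    rw [le_div_iff₀ hGp]
    have : (q0 : ℝ) * (G / (4 * M)) * (4 * M) = q0 * G := by field_simp
    nlinarith
  have hndq0 : nd (θ * q0) ≤ 2 * η := by
    have h1 := (Finset.mem_filter.1 hx).2
    have h2 := (Finset.mem_filter.1 hy).2
    have : θ * (q0 : ℝ) = θ * y - θ * x := by rw [hq0, Nat.cast_sub hxy.le]; ring
    rw [this]
    have := nd_sub (θ * y) (θ * x)
    linarith
  obtain ⟨a, q, hq1, hqq0, hcop, hfrac⟩ := reduce_frac (round (θ * q0)) q0 hq01
  have hqp : (0 : ℝ) < q := by exact_mod_cast hq1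
  have hqq0' : (q : ℝ) ≤ q0 := by exact_mod_cast hqq0
  set δ := θ - (a : ℝ) / q with hδ
  have hθ : θ = (a : ℝ) / q + δ := by rw [hδ]; ring
  have hδq0 : |δ| * q0 ≤ 2 * η := by
    have : |δ| * q0 = nd (θ * q0) := by
      unfold nd
      rw [hδ, ← hfrac]
      rw [show |θ - (round (θ * q0) : ℝ) / q0| * q0 = |(θ - (round (θ * q0) : ℝ) / q0) * q0| by rw [abs_mul, Nat.abs_cast]]
      congr 1; field_simp
    rw [this]; exact hndq0
  have hq0N : (q0 : ℝ) ≤ N := by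
    refine hq0b.trans ?_
    rw [div_le_iff₀ hGp]
    nlinarith
  have hδr : ∀ r : ℕ, r < N → |δ| * r * q0 ≤ 1 / 2 := by
    intro r hr
    have hr' : (r : ℝ) ≤ N := by exact_mod_cast hr.le
    calc |δ| * r * q0 = (|δ| * q0) * r := by ring
      _ ≤ 2 * η * N := by gcongr
      _ ≤ 1 / 2 := by rw [hη, mul_assoc, div_mul_eq_mul_div, ← mul_div_assoc, div_le_iff₀ hGp]; nlinarith
  have hq0ge : (1 : ℝ) ≤ q0 := by exact_mod_cast hq01
  have hδr1 : ∀ r : ℕ, r < N → |δ| * r ≤ 1 / 2 := by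
    intro r hr
    have := hδr r hr
    have h0 : 0 ≤ |δ| * r := by positivity
    nlinarith
  refine ⟨a, q, hq1, hqq0'.trans hq0b, ?_⟩
  have hval : |θ * q - a| = q * |δ| := by
    rw [show (q : ℝ) * |δ| = |q * δ| by rw [abs_mul, Nat.abs_cast]]
    congr 1
    rw [hδ]; field_simp
  rw [hval]
  by_cases hδ0 : δ = 0
  · rw [hδ0]; simp
    have := Real.log_nonneg hN1
    positivity
  have hδp : 0 < |δ| := abs_pos.2 hδ0
  -- terms not divisible by q
  have hbad : ∑ r ∈ (range N).filter (fun r => ¬ q ∣ r), g r ≤ G / 4 := by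
    have : ∀ r ∈ (range N).filter (fun r => ¬ q ∣ r), g r ≤ q0 := by
      intro r hr
      have hr := Finset.mem_filter.1 hr
      have hrN := Finset.mem_range.1 hr.1
      have h1 := nd_frac a q r hq1 hcop hr.2
      have h2 : nd ((a : ℝ) / q * r) ≤ nd (θ * r) + |δ| * r := by
        have e : (a : ℝ) / q * r = θ * r - δ * r := by rw [hθ]; ring
        rw [e]
        refine (nd_sub _ _).trans ?_
        have := nd_le (δ * r) 0
        simp only [Int.cast_zero, sub_zero, abs_mul, Nat.abs_cast] at this
        linarith
      have h3 := hδr r hrN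
      have h4 : 1 / (q0 : ℝ) ≤ 1 / q := one_div_le_one_div_of_le hqp hqq0'
      have h5 : |δ| * r ≤ 1 / 2 * (1 / q0) := by
        rw [mul_one_div, le_div_iff₀ hq0p]; exact h3
      have h6 : 1 / (q0 : ℝ) ≤ 2 * nd (θ * r) := by linarith
      have h7 := hgn r
      have h8 := mul_le_mul_of_nonneg_right h6 (hg0 r)
      have h9 : 1 / (q0 : ℝ) * g r ≤ 1 := h8.trans h7
      rw [one_div_mul_eq_div, div_le_iff₀ hq0p] at h9
      linarith
    refine (Finset.sum_le_sum this).trans ?_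
    rw [Finset.sum_const, nsmul_eq_mul]
    have hc : (((range N).filter (fun r : ℕ => ¬ q ∣ r)).card : ℝ) ≤ N := by
      have := Finset.card_filter_le (range N) (fun r : ℕ => ¬ q ∣ r)
      rw [card_range] at this
      exact_mod_cast this
    calc _ ≤ (N : ℝ) * N := by gcongr
      _ ≤ G / 4 := by nlinarith
  have hgood : ∑ r ∈ (range N).filter (fun r => q ∣ r), g r ≤ M + (1 + Real.log N) / (2 * (q * |δ|)) := by
    have h1 : ∀ r ∈ (range N).filter (fun r => q ∣ r), g r ≤ (if r = 0 then (M : ℝ) else 0) + 1 / (2 * (q * |δ|)) * (1 / ((r / q : ℕ) : ℝ)) := by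
      intro r hr
      have hr := Finset.mem_filter.1 hr
      have hrN := Finset.mem_range.1 hr.1
      split_ifs with h0
      · have : 0 ≤ 1 / (2 * (q * |δ|)) * (1 / ((r / q : ℕ) : ℝ)) := by positivity
        linarith [hgM r]
      · obtain ⟨m, rfl⟩ := hr.2
        rw [Nat.mul_div_cancel_left m (by omega)]
        have hm : m ≠ 0 := by rintro rfl; simp at h0
        have hmp : (0 : ℝ) < m := by exact_mod_cast Nat.pos_of_ne_zero hm
        have h2 := nd_small (δ * (q * m : ℕ)) (by
          rw [abs_mul, Nat.abs_cast]; exact hδr1 _ hrN)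
        have h3 : nd (θ * (q * m : ℕ)) = nd (δ * (q * m : ℕ)) := by
          have : θ * (q * m : ℕ) = δ * (q * m : ℕ) + ((a * m : ℤ) : ℝ) := by
            rw [hθ]; push_cast; field_simp; ring
          rw [this, nd_add_int]
        have h4 := hgn (q * m)
        rw [h3] at h4
        rw [abs_mul, Nat.abs_cast] at h2
        have h5 := mul_le_mul_of_nonneg_right h2 (hg0 (q * m))
        rw [zero_add, one_div_mul_one_div, le_div_iff₀ (by positivity)]
        push_cast at h5 h4
        nlinarith
    refine (Finset.sum_le_sum h1).trans ?_
    rw [Finset.sum_add_distrib]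
    refine add_le_add ?_ ?_
    · rw [Finset.sum_ite_eq' ((range N).filter (fun r => q ∣ r)) 0]
      split_ifs <;> linarith
    · rw [← Finset.mul_sum]
      have h2 : ∑ r ∈ (range N).filter (fun r => q ∣ r), 1 / ((r / q : ℕ) : ℝ) ≤ ∑ m ∈ range N, 1 / (m : ℝ) := by
        rw [← Finset.sum_image (f := fun m : ℕ => 1 / (m : ℝ)) (g := fun r => r / q)]
        · refine Finset.sum_le_sum_of_subset_of_nonneg ?_ fun _ _ _ => by positivity
          intro z hz
          obtain ⟨r, hr, rfl⟩ := Finset.mem_image.1 hz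
          have hr := Finset.mem_range.1 (Finset.mem_filter.1 hr).1
          exact Finset.mem_range.2 (lt_of_le_of_lt (Nat.div_le_self _ _) hr)
        · intro r hr r' hr' h
          simp only [coe_filter, mem_range, Set.mem_ofPred_eq] at hr hr'
          simp only at h
          rw [← Nat.div_mul_cancel hr.2, ← Nat.div_mul_cancel hr'.2, h]
      calc _ ≤ 1 / (2 * (q * |δ|)) * (1 + Real.log N) := by
            gcongr
            exact h2.trans (inv_sum_le N)
        _ = _ := by ring
  have htot : G / 2 ≤ (1 + Real.log N) / (2 * (q * |δ|)) := by
    have := Finset.sum_filter_add_sum_filter_not (range N) (fun r => q ∣ r) g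
    rw [← hG] at this
    linarith
  rw [le_div_iff₀ (by positivity)] at htot
  rw [le_div_iff₀ hGp]
  nlinarith

end SFP

namespace SFP
open Finset
open scoped BigOperators

lemma ev_large (c η : ℝ) (hη : 0 < η) : ∃ N0 : ℕ, ∀ N : ℕ, N0 ≤ N → c ≤ (N : ℝ) ^ η := by
  have h := (tendsto_rpow_atTop hη).comp tendsto_natCast_atTop_atTop
  exact Filter.eventually_atTop.1 (h.eventually_ge_atTop c)

set_option maxHeartbeats 1000000 in
theorem inverse_weyl (k : ℕ) (hk : 6 ≤ k) (ε : ℝ) (hε : 0 < ε) : ∃ N0 : ℕ, ∀ N : ℕ, N0 ≤ N → ∀ α x : ℝ, 1 ≤ x →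
    x ^ (k * (k - 1)) ≤ (N : ℝ) ^ (1 - ε) → N / x ≤ ‖SS k N α‖ →
    ∃ q : ℕ, 1 ≤ q ∧ (q : ℝ) ≤ x ^ (tri k) * (N : ℝ) ^ ε ∧ nd (q * α) ≤ x ^ (k * (k - 1)) * (N : ℝ) ^ (ε - k) := by
  obtain ⟨e, rfl⟩ : ∃ e, k = e + 2 := ⟨k - 2, by omega⟩
  rw [show e + 2 - 1 = e + 1 by omega]
  set s := tri (e + 1) with hs
  have hK : (e + 2) * (e + 1) = 2 * s := by rw [hs, two_tri]; ring
  rw [hK]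
  set kap := tri (e + 2) with hkap
  have hkap1 : 1 ≤ kap := tri_pos (by omega)
  have hkap0 : (0 : ℝ) < kap := by exact_mod_cast hkap1
  have hs1 : 1 ≤ s := tri_pos (by omega)
  set ε0 := ε / 4 with hε0
  have hε0p : 0 < ε0 := by positivity
  set p : ℝ := kap + ε / 2 with hp
  have hp0 : 0 < p := by positivity
  set ε1 : ℝ := 1 / kap - 1 / p with hε1
  have hε1p : 0 < ε1 := by
    rw [hε1, sub_pos]
    exact one_div_lt_one_div_of_lt hkap0 (by rw [hp]; linarith)
  obtain ⟨C1, hC1, hweyl⟩ := weyl e ε0 hε0p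
  obtain ⟨C3, hC3, hmaj⟩ := major_arc (e + 2) (by omega) ε1 hε1p
  set C2 : ℝ := s * 2 ^ (e + 1) + 1 with hC2
  have hC2p : 0 < C2 := by positivity
  obtain ⟨Na, hNa⟩ := ev_large (4 * ((e : ℝ) + 2) * C1 * C2) (ε - ε0) (by rw [hε0]; linarith)
  obtain ⟨Nd, hNd⟩ := ev_large (C1 * (2 + 1 / ε0)) (ε - 2 * ε0) (by rw [hε0]; linarith)
  obtain ⟨Nf, hNf⟩ := ev_large (C3 ^ p) (ε / 2) (by linarith)
  refine ⟨Na + Nd + Nf + 1, ?_⟩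
  intro N hN α x hx hX hS
  have hNa := hNa N (by omega)
  have hNd := hNd N (by omega)
  have hNf := hNf N (by omega)
  have hN1 : 1 ≤ N := by omega
  have hN1' : (1 : ℝ) ≤ N := by exact_mod_cast hN1
  have hN0 : (0 : ℝ) < N := by linarith
  have hx0 : 0 < x := by linarith
  set X := x ^ (2 * s) with hXd
  have hX1 : 1 ≤ X := one_le_pow₀ hx
  have hX0 : 0 < X := by linarith
  have hw := hweyl N α hN1
  rw [← hs] at hw
  set M := s * (2 * N) ^ (e + 1) + 1 with hM
  set G := ∑ r ∈ range N, GG (((e + 2 : ℕ) : ℝ) * α) M r with hG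
  have hNe : (N : ℝ) ^ (e + 1) = (N : ℝ) ^ ((e : ℝ) + 1) := by
    rw [← Real.rpow_natCast (N : ℝ) (e + 1)]; push_cast; rfl
  have hMle : (M : ℝ) ≤ C2 * (N : ℝ) ^ ((e : ℝ) + 1) := by
    rw [hM, hC2, ← hNe]; push_cast
    rw [mul_pow]
    have := one_le_pow₀ hN1' (n := e + 1)
    nlinarith
  -- lower bound for G
  have hGlow : (N : ℝ) ^ ((e : ℝ) + 2 - ε0) ≤ C1 * X * G := by
    have h1 : ((N : ℝ) / x) ^ (2 * s) ≤ C1 * (N : ℝ) ^ (2 * (s : ℝ) - (e + 2) + ε0) * G :=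
      (pow_le_pow_left₀ (by positivity) hS _).trans hw
    rw [div_pow, div_le_iff₀ (by positivity)] at h1
    have h2 : (N : ℝ) ^ (2 * s) = (N : ℝ) ^ ((e : ℝ) + 2 - ε0) * (N : ℝ) ^ (2 * (s : ℝ) - (e + 2) + ε0) := by
      rw [← Real.rpow_add hN0, ← Real.rpow_natCast (N : ℝ) (2 * s)]; congr 1; push_cast; ring
    rw [h2] at h1
    have h3 : 0 < (N : ℝ) ^ (2 * (s : ℝ) - (e + 2) + ε0) := by positivity
    refine le_of_mul_le_mul_right (h1.trans (le_of_eq ?_)) h3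
    rw [← hXd]; ring
  have hGp : 0 < G := by
    have : 0 < C1 * X * G := lt_of_lt_of_le (by positivity) hGlow
    exact pos_of_mul_pos_right this (by positivity)
  have hXN : X * (N : ℝ) ^ (ε - ε0) ≤ (N : ℝ) ^ (1 - ε0) := by
    calc X * (N : ℝ) ^ (ε - ε0) ≤ (N : ℝ) ^ (1 - ε) * (N : ℝ) ^ (ε - ε0) := by gcongr
      _ = _ := by rw [← Real.rpow_add hN0]; congr 1; ring
  have hkey : 4 * ((e : ℝ) + 2) * M ≤ G := by
    have h1 : C1 * X * (4 * ((e : ℝ) + 2) * M) ≤ C1 * X * G := by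
      refine le_trans ?_ hGlow
      calc C1 * X * (4 * ((e : ℝ) + 2) * M) ≤ C1 * X * (4 * ((e : ℝ) + 2) * (C2 * (N : ℝ) ^ ((e : ℝ) + 1))) := by gcongr
        _ = X * (4 * ((e : ℝ) + 2) * C1 * C2) * (N : ℝ) ^ ((e : ℝ) + 1) := by ring
        _ ≤ X * (N : ℝ) ^ (ε - ε0) * (N : ℝ) ^ ((e : ℝ) + 1) := by gcongr
        _ ≤ (N : ℝ) ^ (1 - ε0) * (N : ℝ) ^ ((e : ℝ) + 1) := by gcongr
        _ = _ := by rw [← Real.rpow_add hN0]; congr 1; ring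
    exact le_of_mul_le_mul_left h1 (by positivity)
  have he0 : (0 : ℝ) ≤ e := by positivity
  have hMp : (0 : ℝ) < M := by rw [hM]; positivity
  have hcondA : 4 * (M : ℝ) ≤ G := by nlinarith
  have hcondB : 4 * (N : ℝ) ^ 2 ≤ G := by
    refine le_trans ?_ hcondA
    have : N ^ 2 ≤ M := by
      calc N ^ 2 ≤ N ^ (e + 1) := Nat.pow_le_pow_right hN1 (by omega)
        _ ≤ (2 * N) ^ (e + 1) := Nat.pow_le_pow_left (by omega) _
        _ ≤ s * (2 * N) ^ (e + 1) := Nat.le_mul_of_pos_left _ hs1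
        _ ≤ M := by omega
    have : ((N ^ 2 : ℕ) : ℝ) ≤ M := by exact_mod_cast this
    push_cast at this
    linarith
  obtain ⟨a, q, hq1, hqle, hqd⟩ := arcs N M hN1 (by omega) (((e + 2 : ℕ) : ℝ) * α) (GG (((e + 2 : ℕ) : ℝ) * α) M)
    (GG_nonneg _ _) (GG_le _ _) (GG_nd _ _) G hG hcondA hcondB
  obtain ⟨a', q', hq'1, hq'le, hcop, hfrac⟩ := reduce_frac a ((e + 2) * q) (Nat.mul_pos (by omega) hq1)
  have hq0 : (0 : ℝ) < q := by exact_mod_cast hq1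
  have hq'0 : (0 : ℝ) < q' := by exact_mod_cast hq'1
  have hqp1r : (1 : ℝ) ≤ q' := by exact_mod_cast hq'1
  have hq'le' : (q' : ℝ) ≤ ((e : ℝ) + 2) * q := by exact_mod_cast hq'le
  set β := α - (a' : ℝ) / q' with hβ
  have hβval : ((e : ℝ) + 2) * q * |β| = |((e + 2 : ℕ) : ℝ) * α * q - a| := by
    have h0 : (0 : ℝ) ≤ ((e : ℝ) + 2) * q := by positivity
    rw [hβ, ← hfrac]
    nth_rewrite 1 [← abs_of_nonneg h0]
    rw [← abs_mul]
    congr 1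
    push_cast
    field_simp
  have hlog0 := Real.log_nonneg hN1'
  have hD : q' * |β| ≤ X * (N : ℝ) ^ (ε - (e + 2)) := by
    have h1 : q' * |β| ≤ (1 + Real.log N) / G := by
      refine le_trans ?_ hqd
      rw [← hβval]
      gcongr
    refine h1.trans ?_
    rw [div_le_iff₀ hGp]
    have h2 := log_bound ε0 hε0p N hN1'
    have h3 : C1 * (1 + Real.log N) ≤ (N : ℝ) ^ (ε - ε0) := by
      calc C1 * (1 + Real.log N) ≤ C1 * ((2 + 1 / ε0) * (N : ℝ) ^ ε0) := by gcongr; linarith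
        _ = C1 * (2 + 1 / ε0) * (N : ℝ) ^ ε0 := by ring
        _ ≤ (N : ℝ) ^ (ε - 2 * ε0) * (N : ℝ) ^ ε0 := by gcongr
        _ = _ := by rw [← Real.rpow_add hN0]; congr 1; ring
    have h4 : C1 * (1 + Real.log N) ≤ C1 * (X * (N : ℝ) ^ (ε - (e + 2)) * G) := by
      refine h3.trans ?_
      calc (N : ℝ) ^ (ε - ε0) = (N : ℝ) ^ (ε - ((e : ℝ) + 2)) * (N : ℝ) ^ ((e : ℝ) + 2 - ε0) := by
            rw [← Real.rpow_add hN0]; congr 1; ring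
        _ ≤ (N : ℝ) ^ (ε - ((e : ℝ) + 2)) * (C1 * X * G) := by gcongr
        _ = _ := by ring
    exact le_of_mul_le_mul_left h4 hC1
  have hq'N : q' ≤ N := by
    have h1 : (q' : ℝ) ≤ N := by
      refine hq'le'.trans ((mul_le_mul_of_nonneg_left hqle (by positivity)).trans ?_)
      rw [← mul_div_assoc, div_le_iff₀ hGp]
      nlinarith
    exact_mod_cast h1
  have hsmall : q' * (N : ℝ) ^ (e + 2 - 1) * |β| ≤ 1 := by
    rw [show e + 2 - 1 = e + 1 by omega, hNe]
    calc q' * (N : ℝ) ^ ((e : ℝ) + 1) * |β| = (q' * |β|) * (N : ℝ) ^ ((e : ℝ) + 1) := by ring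
      _ ≤ (X * (N : ℝ) ^ (ε - (e + 2))) * (N : ℝ) ^ ((e : ℝ) + 1) := by gcongr
      _ ≤ ((N : ℝ) ^ (1 - ε) * (N : ℝ) ^ (ε - (e + 2))) * (N : ℝ) ^ ((e : ℝ) + 1) := by gcongr
      _ = 1 := by
        rw [← Real.rpow_add hN0, ← Real.rpow_add hN0]
        rw [show 1 - ε + (ε - ((e : ℝ) + 2)) + ((e : ℝ) + 1) = 0 by ring, Real.rpow_zero]
  have hm := hmaj q' N a' β hq'1 hq'N hcop hsmall
  rw [show (a' : ℝ) / q' + β = α by rw [hβ]; ring] at hm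
  refine ⟨q', hq'1, ?_, ?_⟩
  · have h1 : N / x ≤ C3 * N * (q' : ℝ) ^ (-(1 / (kap : ℝ)) + ε1) := hS.trans hm
    have h2 : -(1 / (kap : ℝ)) + ε1 = -(1 / p) := by rw [hε1]; ring
    rw [h2, div_le_iff₀ hx0, Real.rpow_neg hq'0.le] at h1
    have h3 : (q' : ℝ) ^ (1 / p) ≤ C3 * x := by
      have hq'p : 0 < (q' : ℝ) ^ (1 / p) := by positivity
      have h4 : N * (q' : ℝ) ^ (1 / p) ≤ N * (C3 * x) := by
        calc N * (q' : ℝ) ^ (1 / p) ≤ (C3 * N * ((q' : ℝ) ^ (1 / p))⁻¹ * x) * (q' : ℝ) ^ (1 / p) := by gcongr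
          _ = _ := by field_simp
      exact le_of_mul_le_mul_left h4 hN0
    have h5 : (q' : ℝ) ≤ (C3 * x) ^ p := by
      have := Real.rpow_le_rpow (by positivity) h3 hp0.le
      rwa [← Real.rpow_mul hq'0.le, one_div_mul_cancel hp0.ne', Real.rpow_one] at this
    refine h5.trans ?_
    rw [Real.mul_rpow hC3.le hx0.le, hp, Real.rpow_add hx0, Real.rpow_natCast]
    have hxN : x ≤ N := by
      calc x = x ^ 1 := (pow_one x).symm
        _ ≤ x ^ (2 * s) := pow_le_pow_right₀ hx (by omega)
        _ ≤ (N : ℝ) ^ (1 - ε) := hX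
        _ ≤ (N : ℝ) ^ (1 : ℝ) := Real.rpow_le_rpow_of_exponent_le hN1' (by linarith)
        _ = N := Real.rpow_one _
    calc C3 ^ ((kap : ℝ) + ε / 2) * (x ^ kap * x ^ (ε / 2)) ≤ (N : ℝ) ^ (ε / 2) * (x ^ kap * (N : ℝ) ^ (ε / 2)) := by gcongr
      _ = x ^ kap * (N : ℝ) ^ ε := by
        rw [show (N : ℝ) ^ ε = (N : ℝ) ^ (ε / 2) * (N : ℝ) ^ (ε / 2) by rw [← Real.rpow_add hN0]; congr 1; ring]
        ring
  · have h1 := nd_le (q' * α) a'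
    have h2 : |q' * α - a'| = q' * |β| := by
      rw [hβ]
      nth_rewrite 2 [← abs_of_pos hq'0]
      rw [← abs_mul]; congr 1; field_simp
    rw [h2] at h1
    refine h1.trans (hD.trans (le_of_eq ?_))
    push_cast; rfl

end SFP

namespace SFP
open Finset
open scoped BigOperators

/-- number of tuples with prescribed sum -/
lemma sum_fib (p H v : ℕ) : (univ.filter fun a : Fin (p + 1) → Fin H => ∑ i, (a i : ℕ) = v).card ≤ H ^ p := by
  have h : (univ : Finset (Fin p → Fin H)).card = H ^ p := by simp
  rw [← h]
  refine Finset.card_le_card_of_injOn (fun a => fun i => a i.succ) (fun _ _ => by simp) ?_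
  intro a ha b hb hab
  simp only [coe_filter, mem_univ, true_and, Set.mem_ofPred_eq] at ha hb
  have h1 : ∀ i : Fin p, a i.succ = b i.succ := fun i => congrFun hab i
  rw [Fin.sum_univ_succ] at ha hb
  have h2 : ∑ i : Fin p, (a i.succ : ℕ) = ∑ i : Fin p, (b i.succ : ℕ) := Finset.sum_congr rfl fun i _ => by rw [h1 i]
  funext i
  refine Fin.cases ?_ h1 i
  exact Fin.ext (by omega)

lemma diag_count (p H : ℕ) (hH : 1 ≤ H) : H ^ (2 * p + 1) ≤ (p + 1) * (univ.filter fun ab : (Fin (p + 1) → Fin H) × (Fin (p + 1) → Fin H) =>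
    ∑ i, (ab.1 i : ℕ) = ∑ i, (ab.2 i : ℕ)).card := by
  have h1 := pair_eq (X := Fin (p + 1) → Fin H) (A := ℕ) (fun a => ∑ i, (a i : ℕ))
  rw [h1]
  set I := univ.image (fun a : Fin (p + 1) → Fin H => ∑ i, (a i : ℕ)) with hI
  set c : ℕ → ℕ := fun v => (univ.filter fun a : Fin (p + 1) → Fin H => ∑ i, (a i : ℕ) = v).card with hc
  have h2 : ∑ v ∈ I, c v = H ^ (p + 1) := by
    have := Finset.card_eq_sum_card_image (fun a : Fin (p + 1) → Fin H => ∑ i, (a i : ℕ)) univ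
    rw [← this]; simp
  have h3 : I.card ≤ (p + 1) * H := by
    have : I ⊆ range ((p + 1) * H) := by
      intro v hv
      obtain ⟨a, _, rfl⟩ := Finset.mem_image.1 hv
      refine Finset.mem_range.2 ?_
      calc ∑ i, (a i : ℕ) < ∑ i : Fin (p + 1), H := Finset.sum_lt_sum_of_nonempty ⟨0, Finset.mem_univ _⟩ fun i _ => (a i).2
        _ = (p + 1) * H := by simp
    simpa using Finset.card_le_card this
  have h4 : (∑ v ∈ I, c v) ^ 2 ≤ I.card * ∑ v ∈ I, c v ^ 2 := sq_sum_le_card_mul_sum_sq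
  rw [h2] at h4
  have h5 : H * H ^ (2 * p + 1) ≤ H * ((p + 1) * ∑ v ∈ I, c v ^ 2) := by
    calc H * H ^ (2 * p + 1) = (H ^ (p + 1)) ^ 2 := by rw [← pow_mul]; ring
      _ ≤ I.card * ∑ v ∈ I, c v ^ 2 := h4
      _ ≤ ((p + 1) * H) * ∑ v ∈ I, c v ^ 2 := Nat.mul_le_mul_right _ h3
      _ = _ := by ring
  exact Nat.le_of_mul_le_mul_left h5 hH

lemma off_count (p H h : ℕ) : (univ.filter fun ab : (Fin (p + 1) → Fin H) × (Fin (p + 1) → Fin H) =>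
    ((∑ i, (ab.1 i : ℕ) : ℕ) - (∑ i, (ab.2 i : ℕ) : ℕ) : ℤ).natAbs = h).card ≤ 2 * H ^ (2 * p + 1) := by
  have hfib : ∀ b : Fin (p + 1) → Fin H, (univ.filter fun a : Fin (p + 1) → Fin H =>
      ((∑ i, (a i : ℕ) : ℕ) - (∑ i, (b i : ℕ) : ℕ) : ℤ).natAbs = h).card ≤ 2 * H ^ p := by
    intro b
    have hsub : (univ.filter fun a : Fin (p + 1) → Fin H => ((∑ i, (a i : ℕ) : ℕ) - (∑ i, (b i : ℕ) : ℕ) : ℤ).natAbs = h) ⊆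
        (univ.filter fun a : Fin (p + 1) → Fin H => ∑ i, (a i : ℕ) = ∑ i, (b i : ℕ) + h) ∪
        (univ.filter fun a : Fin (p + 1) → Fin H => ∑ i, (a i : ℕ) = ∑ i, (b i : ℕ) - h) := by
      intro a ha
      simp only [mem_filter, mem_univ, true_and, mem_union] at ha ⊢
      omega
    refine (Finset.card_le_card hsub).trans ((Finset.card_union_le _ _).trans ?_)
    have := sum_fib p H (∑ i, (b i : ℕ) + h)
    have := sum_fib p H (∑ i, (b i : ℕ) - h)
    omega
  rw [Finset.card_eq_sum_card_fiberwise (f := fun ab : (Fin (p + 1) → Fin H) × (Fin (p + 1) → Fin H) => ab.2) (t := univ) (fun _ _ => by simp)]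
  have : ∀ b ∈ (univ : Finset (Fin (p + 1) → Fin H)), ((univ.filter fun ab : (Fin (p + 1) → Fin H) × (Fin (p + 1) → Fin H) =>
      ((∑ i, (ab.1 i : ℕ) : ℕ) - (∑ i, (ab.2 i : ℕ) : ℕ) : ℤ).natAbs = h).filter fun ab => ab.2 = b).card ≤ 2 * H ^ p := by
    intro b _
    refine le_trans (Finset.card_le_card_of_injOn (fun ab => ab.1) ?_ ?_) (hfib b)
    · intro ab hab
      simp only [coe_filter, mem_filter, mem_univ, true_and, Set.mem_ofPred_eq] at hab ⊢
      rw [← hab.2]; exact hab.1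
    · intro ab hab ab' hab' he
      simp only [coe_filter, mem_filter, mem_univ, true_and, Set.mem_ofPred_eq] at hab hab'
      exact Prod.ext he (hab.2.trans hab'.2.symm)
  refine (Finset.sum_le_sum this).trans ?_
  simp
  apply le_of_eq; ring

lemma montg {Y : Type} [Fintype Y] (y : Y → ℝ) (δ : ℝ) (hδ : 0 < δ) (hy : ∀ i, δ ≤ nd (y i)) (p H : ℕ) (hH : 1 ≤ H)
    (hcond : 2 * ((p : ℝ) + 1) * (1 / (2 * δ)) ^ (2 * (p + 1)) ≤ (H : ℝ) ^ (2 * p + 1)) :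
    (Fintype.card Y : ℝ) ≤ 4 * ((p : ℝ) + 1) * ∑ h ∈ Ico 1 ((p + 1) * H + 1), ‖∑ i, ee (h * y i)‖ := by
  have hH0 : (0 : ℝ) < H := by exact_mod_cast hH
  let A := Fin (p + 1) → Fin H
  let σ : A → ℕ := fun a => ∑ i, (a i : ℕ)
  set T : ℤ → ℂ := fun m => ∑ i, ee (m * y i) with hT
  have hTabs : ∀ m : ℤ, ‖T m‖ = ‖∑ i, ee ((m.natAbs : ℝ) * y i)‖ := by
    intro m
    rcases Int.natAbs_eq m with h | h
    · rw [hT]; simp only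
      congr 1
      refine Finset.sum_congr rfl fun i _ => ?_
      have : (m : ℝ) = (m.natAbs : ℝ) := by
        have := congrArg (fun z : ℤ => (z : ℝ)) h
        simpa using this
      rw [this]
    · rw [hT]; simp only
      rw [← RCLike.norm_conj (∑ i, ee ((m.natAbs : ℝ) * y i)), map_sum]
      congr 1
      refine Finset.sum_congr rfl fun i _ => ?_
      have : (m : ℝ) = -(m.natAbs : ℝ) := by
        have := congrArg (fun z : ℤ => (z : ℝ)) h
        simpa using this
      rw [this, ← ee_neg]; congr 1; ring
  have hD : ∀ i, ‖∑ h ∈ range H, ee (y i * h)‖ ≤ 1 / (2 * δ) := by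
    intro i
    have h1 := geom_nd (y i) 0 H
    simp only [zero_add, ← Finset.range_eq_Ico] at h1
    rw [le_div_iff₀ (by positivity)]
    have := mul_le_mul_of_nonneg_right (hy i) (norm_nonneg (∑ h ∈ range H, ee (y i * h)))
    linarith
  have hexp : ∀ i, ((‖∑ h ∈ range H, ee (y i * h)‖ ^ (2 * (p + 1)) : ℝ) : ℂ) = ∑ ab : A × A, ee (((σ ab.1 : ℤ) - (σ ab.2 : ℤ) : ℤ) * y i) := by
    intro i
    have h1 : (∑ h ∈ range H, ee (y i * h)) ^ (p + 1) = ∑ a : A, ee (y i * σ a) := by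
      rw [← Fin.sum_univ_eq_sum_range (fun h => ee (y i * h)), Fintype.sum_pow]
      refine Finset.sum_congr rfl fun a _ => ?_
      rw [← ee_sum, ← Finset.mul_sum]; congr 2
      simp only [σ]; push_cast; rfl
    rw [mul_comm 2, pow_mul, ← norm_pow, normsq_eq, h1, map_sum, mul_comm, Finset.sum_mul_sum, Fintype.sum_prod_type]
    refine Finset.sum_congr rfl fun a _ => Finset.sum_congr rfl fun b _ => ?_
    rw [← ee_neg, ← ee_add]; congr 1; push_cast; ring
  have hsum : ((∑ i, ‖∑ h ∈ range H, ee (y i * h)‖ ^ (2 * (p + 1)) : ℝ) : ℂ) = ∑ ab : A × A, T ((σ ab.1 : ℤ) - (σ ab.2 : ℤ)) := by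
    push_cast
    have := fun i => hexp i
    push_cast at this
    rw [Finset.sum_congr rfl fun i _ => this i, Finset.sum_comm]
    refine Finset.sum_congr rfl fun ab _ => ?_
    rw [hT]; simp
  have hup : ∑ i, ‖∑ h ∈ range H, ee (y i * h)‖ ^ (2 * (p + 1)) ≤ (Fintype.card Y : ℝ) * (1 / (2 * δ)) ^ (2 * (p + 1)) := by
    refine (Finset.sum_le_sum fun i _ => pow_le_pow_left₀ (norm_nonneg _) (hD i) _).trans ?_
    simp
  -- split
  set J := (univ.filter fun ab : A × A => σ ab.1 = σ ab.2).card with hJ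
  have hsplit : ∑ ab : A × A, T ((σ ab.1 : ℤ) - (σ ab.2 : ℤ)) = (J : ℂ) * (Fintype.card Y : ℂ) +
      ∑ ab ∈ univ.filter (fun ab : A × A => ¬ σ ab.1 = σ ab.2), T ((σ ab.1 : ℤ) - (σ ab.2 : ℤ)) := by
    rw [← Finset.sum_filter_add_sum_filter_not univ (fun ab : A × A => σ ab.1 = σ ab.2)]
    congr 1
    rw [Finset.sum_congr rfl (g := fun _ => (Fintype.card Y : ℂ))]
    · rw [Finset.sum_const, nsmul_eq_mul]
    · intro ab hab
      rw [(Finset.mem_filter.1 hab).2, sub_self, hT]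
      simp [ee_zero]
  set t : ℕ → ℝ := fun h => ‖∑ i, ee (h * y i)‖ with ht
  set St := ∑ h ∈ Ico 1 ((p + 1) * H + 1), t h with hSt
  have hσ : ∀ a : A, σ a ≤ (p + 1) * H := by
    intro a
    calc ∑ i, (a i : ℕ) ≤ ∑ i : Fin (p + 1), H := Finset.sum_le_sum fun i _ => (a i).2.le
      _ = (p + 1) * H := by simp
  have hoff : ‖∑ ab ∈ univ.filter (fun ab : A × A => ¬ σ ab.1 = σ ab.2), T ((σ ab.1 : ℤ) - (σ ab.2 : ℤ))‖ ≤ 2 * (H : ℝ) ^ (2 * p + 1) * St := by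
    refine (norm_sum_le _ _).trans ?_
    rw [← Finset.sum_fiberwise_of_maps_to (t := Ico 1 ((p + 1) * H + 1)) (g := fun ab : A × A => ((σ ab.1 : ℤ) - (σ ab.2 : ℤ)).natAbs)]
    · rw [hSt, Finset.mul_sum]
      refine Finset.sum_le_sum fun h _ => ?_
      rw [Finset.sum_congr rfl (g := fun _ => t h)]
      · rw [Finset.sum_const, nsmul_eq_mul]
        refine mul_le_mul_of_nonneg_right ?_ (norm_nonneg _)
        have h1 := off_count p H h
        have h2 : (((univ.filter (fun ab : A × A => ¬ σ ab.1 = σ ab.2)).filter fun ab => ((σ ab.1 : ℤ) - (σ ab.2 : ℤ)).natAbs = h).card) ≤ 2 * H ^ (2 * p + 1) := by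
          refine le_trans (Finset.card_le_card ?_) h1
          intro ab hab
          simp only [mem_filter, mem_univ, true_and] at hab ⊢
          exact hab.2
        exact_mod_cast h2
      · intro ab hab
        rw [hTabs, (Finset.mem_filter.1 hab).2]
    · intro ab hab
      have h1 := (Finset.mem_filter.1 hab).2
      have h2 := hσ ab.1
      have h3 := hσ ab.2
      rw [Finset.mem_Ico]
      generalize (p + 1) * H = Q at *
      omega
  have hmain : (J : ℝ) * Fintype.card Y ≤ (Fintype.card Y : ℝ) * (1 / (2 * δ)) ^ (2 * (p + 1)) + 2 * (H : ℝ) ^ (2 * p + 1) * St := by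
    have h1 : (J : ℂ) * (Fintype.card Y : ℂ) = ((∑ i, ‖∑ h ∈ range H, ee (y i * h)‖ ^ (2 * (p + 1)) : ℝ) : ℂ) -
        ∑ ab ∈ univ.filter (fun ab : A × A => ¬ σ ab.1 = σ ab.2), T ((σ ab.1 : ℤ) - (σ ab.2 : ℤ)) := by
      rw [hsum, hsplit]; ring
    have h2 : (J : ℝ) * Fintype.card Y = ‖(J : ℂ) * (Fintype.card Y : ℂ)‖ := by
      rw [norm_mul, Complex.norm_natCast, Complex.norm_natCast]
    rw [h2, h1]
    refine (norm_sub_le _ _).trans (add_le_add ?_ hoff)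
    rw [Complex.norm_real, Real.norm_eq_abs, abs_of_nonneg (Finset.sum_nonneg fun _ _ => by positivity)]
    exact hup
  have hJl : (H : ℝ) ^ (2 * p + 1) ≤ ((p : ℝ) + 1) * J := by exact_mod_cast diag_count p H hH
  have hP : (0 : ℝ) < (H : ℝ) ^ (2 * p + 1) := by positivity
  set P := (H : ℝ) ^ (2 * p + 1)
  set Z := (1 / (2 * δ)) ^ (2 * (p + 1))
  set c := (Fintype.card Y : ℝ)
  have hc0 : 0 ≤ c := by positivity
  have hp1 : (0 : ℝ) < (p : ℝ) + 1 := by positivity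
  have f1 : P * c ≤ ((p : ℝ) + 1) * (J * c) := by nlinarith
  have f2 : ((p : ℝ) + 1) * (J * c) ≤ ((p : ℝ) + 1) * (c * Z + 2 * P * St) := mul_le_mul_of_nonneg_left hmain hp1.le
  have f3 : 2 * ((p : ℝ) + 1) * Z * c ≤ P * c := mul_le_mul_of_nonneg_right hcond hc0
  have f4 : P * c ≤ P * (4 * ((p : ℝ) + 1) * St) := by nlinarith
  exact le_of_mul_le_mul_left f4 hP

end SFP

namespace SFP
open Finset
open scoped BigOperators

lemma level (S : Finset ℕ) (f : ℕ → ℝ) (hf0 : ∀ h, 0 ≤ f h) (hf1 : ∀ h, f h ≤ 1) (ρ : ℝ) (hρ : 0 < ρ) (s J : ℕ) (hJ : 1 ≤ J) (c : ℝ)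
    (hc : c ≤ ∑ h ∈ S, f h ^ s) (hsm : (S.card : ℝ) * (ρ ^ J) ^ s ≤ c / 2) :
    ∃ j < J, c / (2 * J) ≤ ((S.filter fun h => ρ ^ (j + 1) ≤ f h).card : ℝ) * (ρ ^ j) ^ s := by
  by_contra hcon
  push Not at hcon
  have hpt : ∀ h, f h ^ s ≤ ∑ j ∈ range J, (if ρ ^ (j + 1) ≤ f h then (ρ ^ j) ^ s else 0) + (ρ ^ J) ^ s := by
    intro h
    have hnn : ∀ j ∈ range J, (0 : ℝ) ≤ (if ρ ^ (j + 1) ≤ f h then (ρ ^ j) ^ s else 0) := by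
      intro j _; split_ifs <;> positivity
    by_cases hlt : f h < ρ ^ J
    · have := Finset.sum_nonneg hnn
      have h2 := pow_le_pow_left₀ (hf0 h) hlt.le s
      linarith
    · push Not at hlt
      have hex : ∃ j, ρ ^ (j + 1) ≤ f h := ⟨J - 1, by rwa [Nat.sub_add_cancel hJ]⟩
      classical
      have hsp := Nat.find_spec hex
      have hj0 : Nat.find hex < J := by
        have : Nat.find hex ≤ J - 1 := Nat.find_min' hex (by rwa [Nat.sub_add_cancel hJ])
        omega
      have hup : f h ≤ ρ ^ (Nat.find hex) := by
        rcases Nat.eq_zero_or_pos (Nat.find hex) with h0 | h0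
        · rw [h0, pow_zero]; exact hf1 h
        · have := Nat.find_min hex (m := Nat.find hex - 1) (by omega)
          rw [Nat.sub_add_cancel h0] at this
          exact (not_le.1 this).le
      have h1 := Finset.single_le_sum hnn (Finset.mem_range.2 hj0)
      rw [if_pos hsp] at h1
      have h2 := pow_le_pow_left₀ (hf0 h) hup s
      have h3 : 0 < (ρ ^ J) ^ s := by positivity
      linarith
  have hJ0 : (0 : ℝ) < J := by exact_mod_cast hJ
  have h1 : c ≤ ∑ j ∈ range J, ((S.filter fun h => ρ ^ (j + 1) ≤ f h).card : ℝ) * (ρ ^ j) ^ s + (S.card : ℝ) * (ρ ^ J) ^ s := by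
    refine hc.trans ((Finset.sum_le_sum fun h _ => hpt h).trans ?_)
    rw [Finset.sum_add_distrib, Finset.sum_comm]
    refine add_le_add (Finset.sum_le_sum fun j _ => ?_) ?_
    · rw [← Finset.sum_filter, Finset.sum_const, nsmul_eq_mul]
    · rw [Finset.sum_const, nsmul_eq_mul]
  have h2 : ∑ j ∈ range J, ((S.filter fun h => ρ ^ (j + 1) ≤ f h).card : ℝ) * (ρ ^ j) ^ s < ∑ j ∈ range J, c / (2 * J) :=
    Finset.sum_lt_sum_of_nonempty ⟨0, Finset.mem_range.2 hJ⟩ fun j hj => hcon j (Finset.mem_range.1 hj)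
  rw [Finset.sum_const, card_range, nsmul_eq_mul] at h2
  have h3 : (J : ℝ) * (c / (2 * J)) = c / 2 := by field_simp
  linarith

/-- gap step: many h with good q_h gives a small n -/
lemma gap_step (β : ℝ) (S : Finset ℕ) (M Q : ℕ) (hS : ∀ h ∈ S, 1 ≤ h ∧ h ≤ M) (hne : S.Nonempty) (q : ℕ → ℕ) (hq : ∀ h ∈ S, 1 ≤ q h ∧ q h ≤ Q)
    (κ D : ℝ) (hκ : ∀ h ∈ S, nd ((q h : ℝ) * (h * β)) ≤ κ) 
    (hD : ∀ m, 1 ≤ m → m ≤ Q * M → (m.divisors.card : ℝ) ≤ D) :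
    ∃ n : ℕ, 1 ≤ n ∧ (n : ℝ) * S.card ≤ D * (Q * M) ∧ nd (n * β) ≤ 2 * κ := by
  classical
  set I := S.image (fun h => q h * h) with hI
  have hIm : ∀ m ∈ I, 1 ≤ m ∧ m ≤ Q * M ∧ nd (m * β) ≤ κ := by
    intro m hm
    obtain ⟨h, hh, rfl⟩ := Finset.mem_image.1 hm
    refine ⟨Nat.mul_pos (hq h hh).1 (hS h hh).1, Nat.mul_le_mul (hq h hh).2 (hS h hh).2, ?_⟩
    have := hκ h hh
    rw [← mul_assoc] at this
    push_cast; exact this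
  have h0 : 0 ∉ I := fun h => by have := (hIm 0 h).1; omega
  obtain ⟨h1, hh1⟩ := hne
  have hIne : 1 ≤ I.card := Finset.card_pos.2 ⟨_, Finset.mem_image_of_mem _ hh1⟩
  have hκ0 : 0 ≤ κ := (nd_nonneg _).trans (hκ h1 hh1)
  have hcard : (S.card : ℝ) ≤ D * I.card := by
    rw [Finset.card_eq_sum_card_image (fun h => q h * h) S]
    push_cast
    refine (Finset.sum_le_sum (g := fun _ => D) fun m hm => ?_).trans (by rw [Finset.sum_const, nsmul_eq_mul, mul_comm])
    refine le_trans ?_ (hD m (hIm m hm).1 (hIm m hm).2.1)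
    have : (S.filter fun h => q h * h = m) ⊆ m.divisors := by
      intro h hh
      rw [Finset.mem_filter] at hh
      rw [Nat.mem_divisors]
      refine ⟨⟨q h, by rw [← hh.2, mul_comm]⟩, ?_⟩
      have := (hIm m hm).1; omega
    exact_mod_cast Finset.card_le_card this
  obtain ⟨x, hx, y, hy, hxy, hgap⟩ := gap_lemma (insert 0 I) (Q * M) (by
    intro x hx
    rcases Finset.mem_insert.1 hx with rfl | h
    · exact Nat.zero_le _
    · exact (hIm x h).2.1) (by rw [Finset.card_insert_of_notMem h0]; omega)
  rw [Finset.card_insert_of_notMem h0, Nat.add_sub_cancel] at hgap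
  have hnd : ∀ x ∈ insert 0 I, nd (x * β) ≤ κ := by
    intro x hx
    rcases Finset.mem_insert.1 hx with rfl | h
    · have := nd_le ((0 : ℕ) * β) 0
      simp at this ⊢
      linarith
    · exact (hIm x h).2.2
  refine ⟨y - x, by omega, ?_, ?_⟩
  · have hg : ((y - x : ℕ) : ℝ) * I.card ≤ Q * M := by exact_mod_cast hgap
    have hD0 : 0 ≤ D := by
      have := hD 1 le_rfl (by have := hIm _ (Finset.mem_image_of_mem (fun h => q h * h) hh1); omega)
      exact (Nat.cast_nonneg _).trans this
    calc ((y - x : ℕ) : ℝ) * S.card ≤ ((y - x : ℕ) : ℝ) * (D * I.card) := mul_le_mul_of_nonneg_left hcard (Nat.cast_nonneg _)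
      _ = D * (((y - x : ℕ) : ℝ) * I.card) := by ring
      _ ≤ _ := mul_le_mul_of_nonneg_left hg hD0
  · rw [Nat.cast_sub hxy.le, sub_mul]
    have := nd_sub (y * β) (x * β)
    have := hnd x hx
    have := hnd y hy
    linarith

end SFP

namespace SFP
open Finset
open scoped BigOperators

lemma single_exp (k kap K ξ ν e : ℝ) (hk6 : 6 ≤ k) (hkap : 2 * kap = k * (k + 1)) (hK : K = k * (k - 1)) (hξ0 : 0 ≤ ξ)
    (hν2 : ν ≤ 1 - K * ξ + ξ * kap) (he0 : 0 ≤ e) : (ν - e) * (k - 1) + (e + (ξ * K + (e - k))) ≤ -1 := by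
  have h4 : ν * (k - 1) ≤ (1 - K * ξ + ξ * kap) * (k - 1) := by
    apply mul_le_mul_of_nonneg_right hν2; linarith
  have h5 : (k - 1) * (kap - K) + K ≤ 0 := by
    have h : (k - 1) * (kap - K) + K = (k - 1) * k * (5 - k) / 2 := by
      have : kap = k * (k + 1) / 2 := by linarith
      rw [this, hK]; ring
    rw [h]
    have : 0 ≤ (k - 1) * k := by apply mul_nonneg <;> linarith
    nlinarith
  have h6 : ξ * ((k - 1) * (kap - K) + K) ≤ 0 := mul_nonpos_of_nonneg_of_nonpos hξ0 h5
  have h7 : 0 ≤ e * (k - 1 - 2) := mul_nonneg he0 (by linarith)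
  have h8 : (1 - K * ξ + ξ * kap) * (k - 1) + ξ * K - k = ξ * ((k - 1) * (kap - K) + K) - 1 := by ring
  have h9 : (ν - e) * (k - 1) + (e + (ξ * K + (e - k))) = ν * (k - 1) + ξ * K - k - e * (k - 1 - 2) := by ring
  linarith

set_option maxHeartbeats 1600000 in
lemma single (k : ℕ) (hk : 6 ≤ k) (s : ℕ) (hs2 : s ≤ k * (k - 1)) (η : ℝ) (hη : 0 < η) (hη1 : η ≤ 1) (c : ℝ) (hc : 0 < c) :
    ∃ N0 : ℕ, ∀ N : ℕ, N0 ≤ N → ∀ β : ℝ, ∀ M : ℕ, (M : ℝ) ≤ (N : ℝ) ^ ((s : ℝ) / ((k : ℝ) * ((k : ℝ) - 1)) - η) →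
      c ≤ ∑ h ∈ Ico 1 (M + 1), (‖SS k N (h * β)‖ / N) ^ s → ∃ n : ℕ, 1 ≤ n ∧ n ≤ N ∧ nd (β * (n : ℝ) ^ k) ≤ (N : ℝ) ^ (-1 : ℝ) := by
  set e := η / 8 with he
  have he0 : 0 < e := by positivity
  obtain ⟨J, hJ⟩ := exists_nat_ge (2 / η)
  have hJ0 : (0 : ℝ) < J := lt_of_lt_of_le (by positivity) hJ
  have hJ1 : 1 ≤ J := by exact_mod_cast hJ0
  obtain ⟨Na, hNa⟩ := inverse_weyl k hk e he0
  obtain ⟨Cd, hCd0, hCd⟩ := divisor_bound (e / 6) (by positivity)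
  obtain ⟨Nb, hNb⟩ := ev_large (2 / c) (η - e) (by rw [he]; linarith)
  obtain ⟨Nc, hNc⟩ := ev_large Cd (e / 2) (by positivity)
  obtain ⟨Nd, hNd⟩ := ev_large (2 * J / c) e he0
  obtain ⟨Ne, hNe⟩ := ev_large 2 e he0
  refine ⟨max (max Na Nb) (max (max Nc Nd) (max Ne 1)), fun N hN β M hM hsum => ?_⟩
  simp only [max_le_iff] at hN
  obtain ⟨⟨hNa', hNb'⟩, ⟨hNc', hNd'⟩, hNe', hN1⟩ := hN
  specialize hNa N hNa'
  specialize hNb N hNb'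
  specialize hNc N hNc'
  specialize hNd N hNd'
  specialize hNe N hNe'
  have hL1 : (1 : ℝ) ≤ N := by exact_mod_cast hN1
  set L : ℝ := (N : ℝ) with hL
  have hL0 : 0 < L := by linarith
  have hk6 : (6 : ℝ) ≤ k := by exact_mod_cast hk
  set K : ℝ := (k : ℝ) * ((k : ℝ) - 1) with hK
  have hK0 : 0 < K := by rw [hK]; apply mul_pos <;> linarith
  have hKn : ((k * (k - 1) : ℕ) : ℝ) = K := by rw [Nat.cast_mul, Nat.cast_sub (by omega), hK]; simp
  have hsK : (s : ℝ) ≤ K := by rw [← hKn]; exact_mod_cast hs2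
  have hs0 : (0 : ℝ) ≤ s := Nat.cast_nonneg _
  have hkap : 2 * (tri k : ℝ) = k * (k + 1) := by exact_mod_cast two_tri k
  set kap : ℝ := (tri k : ℝ) with hkapd
  set δ := (1 - e) / (K * J) with hδ
  have he1 : e ≤ 1 := by rw [he]; linarith
  have hδ0 : 0 ≤ δ := div_nonneg (by linarith) (by positivity)
  have hKδ : K * δ * J = 1 - e := by rw [hδ]; field_simp
  set ρ := L ^ (-δ) with hρ
  have hρ0 : 0 < ρ := Real.rpow_pos_of_pos hL0 _
  have hpw : ∀ j : ℕ, ρ ^ j = L ^ (-(δ * j)) := by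
    intro j; rw [hρ, ← Real.rpow_natCast (L ^ (-δ)) j, ← Real.rpow_mul hL0.le]; congr 1; ring
  have hpws : ∀ j : ℕ, (ρ ^ j) ^ s = L ^ (-(δ * j * s)) := by
    intro j; rw [hpw, ← Real.rpow_natCast (L ^ _) s, ← Real.rpow_mul hL0.le]; congr 1; ring
  obtain ⟨j, hjJ, hj⟩ := level (Ico 1 (M + 1)) (fun h => ‖SS k N (h * β)‖ / L) (fun h => by positivity)
    (fun h => by rw [div_le_one hL0]; exact SS_le _ _ _) ρ hρ0 s J hJ1 c hsum (by
      rw [Nat.card_Ico, Nat.add_sub_cancel, hpws]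
      calc (M : ℝ) * L ^ (-(δ * J * s)) ≤ L ^ ((s : ℝ) / K - η) * L ^ (-(δ * J * s)) := by gcongr
        _ = L ^ ((s : ℝ) / K - η + -(δ * J * s)) := (Real.rpow_add hL0 _ _).symm
        _ ≤ L ^ (-(η - e)) := by
          apply Real.rpow_le_rpow_of_exponent_le hL1
          have h1 : δ * J = (1 - e) / K := by rw [eq_div_iff hK0.ne']; linarith
          rw [h1]
          have h2 : (s : ℝ) / K ≤ 1 := (div_le_one hK0).2 hsK
          have h3 : (1 - e) / K * s = s / K - e * (s / K) := by ring
          rw [h3]; nlinarith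
        _ ≤ c / 2 := by
          rw [Real.rpow_neg hL0.le, inv_le_comm₀ (by positivity) (by positivity), inv_div]; exact hNb)
  set ξ := δ * ((j : ℝ) + 1) with hξ
  have hjJ' : (j : ℝ) + 1 ≤ J := by exact_mod_cast hjJ
  have hξ0 : 0 ≤ ξ := by positivity
  have hKξ : K * ξ ≤ 1 - e := by
    rw [← hKδ, hξ]
    have : 0 ≤ K * δ := by positivity
    nlinarith
  set S := (Ico 1 (M + 1)).filter (fun h : ℕ => ρ ^ (j + 1) ≤ ‖SS k N (h * β)‖ / L) with hSd
  set x := L ^ ξ with hx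
  have hx1 : 1 ≤ x := Real.one_le_rpow hL1 hξ0
  have hx0 : 0 < x := by linarith
  have hxn : ∀ m : ℕ, x ^ m = L ^ (ξ * m) := by
    intro m; rw [hx, ← Real.rpow_natCast (L ^ ξ) m, ← Real.rpow_mul hL0.le]
  have hρx : ρ ^ (j + 1) = x⁻¹ := by
    rw [hpw, hx, ← Real.rpow_neg hL0.le]; congr 1; rw [hξ]; push_cast; ring
  have hqe : ∀ h : ℕ, ∃ q : ℕ, h ∈ S → 1 ≤ q ∧ (q : ℝ) ≤ x ^ (tri k) * L ^ e ∧ nd (q * (h * β)) ≤ x ^ (k * (k - 1)) * L ^ (e - k) := by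
    intro h
    by_cases hh : h ∈ S
    · have h1 := (Finset.mem_filter.1 hh).2
      rw [hρx, le_div_iff₀ hL0] at h1
      obtain ⟨q, hq1, hq2, hq3⟩ := hNa (h * β) x hx1 (by
        rw [hxn, hKn]; apply Real.rpow_le_rpow_of_exponent_le hL1; linarith) (by rw [div_eq_inv_mul]; exact h1)
      exact ⟨q, fun _ => ⟨hq1, hq2, hq3⟩⟩
    · exact ⟨0, fun h => absurd h hh⟩
  choose q hq using hqe
  have hcJ : 0 < c / (2 * J) := by positivity
  have hSne : S.Nonempty := by
    rw [Finset.nonempty_iff_ne_empty]; intro h0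
    rw [h0] at hj; simp at hj; linarith
  set Q := ⌊x ^ (tri k) * L ^ e⌋₊ with hQ
  have hQle : (Q : ℝ) ≤ L ^ (kap * ξ + e) := by
    have hpos : 0 ≤ x ^ (tri k) * L ^ e := by positivity
    have h1 : (Q : ℝ) ≤ x ^ (tri k) * L ^ e := Nat.floor_le hpos
    have h2 : x ^ (tri k) * L ^ e = L ^ (kap * ξ + e) := by
      rw [hxn, ← Real.rpow_add hL0, mul_comm ξ]
    rw [← h2]; exact h1
  have hkapK : kap ≤ K := by rw [hK]; nlinarith
  have hkapξ : kap * ξ ≤ 1 := by nlinarith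
  have hQM : (Q : ℝ) * M ≤ L ^ (kap * ξ + e + (s / K - η)) := by
    rw [Real.rpow_add hL0 (kap * ξ + e)]; gcongr
  have hsK1 : (s : ℝ) / K ≤ 1 := (div_le_one hK0).2 hsK
  obtain ⟨n, hn1, hn2, hn3⟩ := gap_step β S M Q (fun h hh => by
      have := Finset.mem_Ico.1 (Finset.mem_filter.1 hh).1; omega) hSne q
    (fun h hh => ⟨(hq h hh).1, Nat.le_floor (hq h hh).2.1⟩) (x ^ (k * (k - 1)) * L ^ (e - k)) (L ^ e) (fun h hh => (hq h hh).2.2) (by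
      intro m hm1 hm2
      refine (hCd m hm1).trans ?_
      have hm3 : (m : ℝ) ≤ L ^ (3 : ℝ) := by
        have : (m : ℝ) ≤ Q * M := by exact_mod_cast hm2
        refine this.trans (hQM.trans (Real.rpow_le_rpow_of_exponent_le hL1 ?_))
        linarith
      calc Cd * (m : ℝ) ^ (e / 6) ≤ L ^ (e / 2) * (L ^ (3 : ℝ)) ^ (e / 6) := by gcongr
        _ = L ^ e := by rw [← Real.rpow_mul hL0.le, ← Real.rpow_add hL0]; congr 1; ring)
  -- size of S
  have hSc : L ^ (-e + δ * j * s) ≤ (S.card : ℝ) := by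
    have h1 : L ^ (-e) ≤ c / (2 * J) := by
      rw [Real.rpow_neg hL0.le, inv_le_comm₀ (by positivity) (by positivity), inv_div]; exact hNd
    have h2 := h1.trans hj
    rw [hpws] at h2
    rw [Real.rpow_add hL0]
    calc L ^ (-e) * L ^ (δ * j * s) ≤ ((S.card : ℝ) * L ^ (-(δ * j * s))) * L ^ (δ * j * s) := by gcongr
      _ = S.card := by rw [mul_assoc, ← Real.rpow_add hL0]; simp
  set ν := s / K + ξ * (kap - s) with hν
  have hδs : δ * s ≤ η / 2 := by
    have h1 : δ * s ≤ δ * K := by gcongr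
    have h2 : δ * K * J ≤ 1 := by linarith
    have h3 : 2 ≤ J * η := by rwa [div_le_iff₀ hη] at hJ
    have h4 : δ * K ≤ 1 / J := by rw [le_div_iff₀ hJ0]; exact h2
    have h5 : 1 / (J : ℝ) ≤ η / 2 := by rw [div_le_iff₀ hJ0]; linarith
    linarith
  have hnν : (n : ℝ) ≤ L ^ (ν - e) := by
    have h1 : (n : ℝ) * L ^ (-e + δ * j * s) ≤ L ^ (e + (kap * ξ + e + (s / K - η))) := by
      calc (n : ℝ) * L ^ (-e + δ * j * s) ≤ n * S.card := by gcongr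
        _ ≤ L ^ e * (Q * M) := hn2
        _ ≤ _ := by rw [Real.rpow_add hL0]; gcongr
    have h2 : (n : ℝ) = n * L ^ (-e + δ * j * s) * L ^ (-(-e + δ * j * s)) := by
      rw [mul_assoc, ← Real.rpow_add hL0]; simp
    rw [h2]
    refine (mul_le_mul_of_nonneg_right h1 (by positivity)).trans ?_
    rw [← Real.rpow_add hL0]
    apply Real.rpow_le_rpow_of_exponent_le hL1
    have h3 : δ * j * s = ξ * s - δ * s := by rw [hξ]; ring
    rw [h3, hν]
    have : ξ * (kap - s) = kap * ξ - ξ * s := by ring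
    rw [this]
    linarith
  have hν2 : ν ≤ 1 - K * ξ + ξ * kap := by
    have h1 : ν = s * (1 / K - ξ) + ξ * kap := by rw [hν]; ring
    have h2 : 0 ≤ 1 / K - ξ := by
      rw [sub_nonneg, le_div_iff₀ hK0]; linarith
    have h3 : (s : ℝ) * (1 / K - ξ) ≤ K * (1 / K - ξ) := by gcongr
    have h4 : K * (1 / K - ξ) = 1 - K * ξ := by field_simp
    linarith
  have hν1 : ν ≤ 1 := by nlinarith
  refine ⟨n, hn1, ?_, ?_⟩
  · have : (n : ℝ) ≤ L := by
      refine hnν.trans ?_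
      calc L ^ (ν - e) ≤ L ^ (1 : ℝ) := Real.rpow_le_rpow_of_exponent_le hL1 (by linarith)
        _ = L := Real.rpow_one _
    exact Nat.cast_le.1 (hL ▸ this)
  · have h1 : β * (n : ℝ) ^ k = ((n ^ (k - 1) : ℕ) : ℝ) * (n * β) := by
      have : k = (k - 1) + 1 := by omega
      conv_lhs => rw [this, pow_succ]
      push_cast; ring
    rw [h1]
    refine (nd_nat_mul _ _).trans ?_
    have h2 : ((n ^ (k - 1) : ℕ) : ℝ) ≤ L ^ ((ν - e) * ((k : ℝ) - 1)) := by
      push_cast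
      calc (n : ℝ) ^ (k - 1) ≤ (L ^ (ν - e)) ^ (k - 1) := by gcongr
        _ = _ := by rw [← Real.rpow_natCast (L ^ (ν - e)) (k - 1), ← Real.rpow_mul hL0.le, Nat.cast_sub (by omega)]; simp
    have h3 : nd (n * β) ≤ L ^ (e + (ξ * K + (e - k))) := by
      refine hn3.trans ?_
      rw [hxn, hKn, ← Real.rpow_add hL0, Real.rpow_add hL0 e]
      gcongr
    have hB := nd_nonneg (n * β)
    have hX : 0 ≤ L ^ ((ν - e) * ((k : ℝ) - 1)) := Real.rpow_nonneg hL0.le _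
    generalize nd (n * β) = B at h3 hB ⊢
    generalize ((n ^ (k - 1) : ℕ) : ℝ) = A at h2 ⊢
    calc A * B ≤ L ^ ((ν - e) * ((k : ℝ) - 1)) * L ^ (e + (ξ * K + (e - k))) :=
          mul_le_mul h2 h3 hB hX
      _ = L ^ ((ν - e) * ((k : ℝ) - 1) + (e + (ξ * K + (e - k)))) := (Real.rpow_add hL0 _ _).symm
      _ ≤ L ^ (-1 : ℝ) := by
        apply Real.rpow_le_rpow_of_exponent_le hL1
        exact single_exp k kap K ξ ν e hk6 hkap hK hξ0 hν2 he0.le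

end SFP

namespace SFP
open Finset
open scoped BigOperators

lemma prod_sums (k N s : ℕ) (β : Fin s → ℝ) (h : ℕ) :
    ∑ a : Fin s → Fin N, ee (h * ∑ i, β i * (((a i : ℕ) + 1 : ℕ) : ℝ) ^ k) = ∏ i, SS k N (h * β i) := by
  have h1 : ∀ i, SS k N (h * β i) = ∑ a : Fin N, ee (h * (β i * (((a : ℕ) + 1 : ℕ) : ℝ) ^ k)) := by
    intro i
    unfold SS
    rw [Finset.sum_Ico_eq_sum_range, Nat.add_sub_cancel_left, ← Fin.sum_univ_eq_sum_range (fun n => ee (h * β i * ((1 + n : ℕ) : ℝ) ^ k))]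
    refine Finset.sum_congr rfl fun a _ => ?_
    rw [add_comm 1, mul_assoc]
  rw [Finset.prod_congr rfl fun i _ => h1 i, Finset.prod_univ_sum, Fintype.piFinset_univ]
  refine Finset.sum_congr rfl fun a _ => ?_
  rw [Finset.mul_sum, ee_sum]

lemma prod_le_sum_pow (s : ℕ) (hs : 1 ≤ s) (f : Fin s → ℝ) (hf : ∀ i, 0 ≤ f i) : ∏ i, f i ≤ ∑ i, f i ^ s := by
  obtain ⟨i0, _, hi0⟩ := Finset.exists_max_image (univ : Finset (Fin s)) f ⟨⟨0, hs⟩, Finset.mem_univ _⟩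
  calc ∏ i, f i ≤ ∏ _i : Fin s, f i0 := Finset.prod_le_prod (fun i _ => hf i) fun i hi => hi0 i hi
    _ = f i0 ^ s := by simp
    _ ≤ _ := Finset.single_le_sum (f := fun i => f i ^ s) (fun i _ => pow_nonneg (hf i) _) (Finset.mem_univ i0)

lemma moment_lower (k N s : ℕ) (hN : 1 ≤ N) (hs : 1 ≤ s) (β : Fin s → ℝ) (δ : ℝ) (hδ : 0 < δ)
    (hy : ∀ a : Fin s → Fin N, δ ≤ nd (∑ i, β i * (((a i : ℕ) + 1 : ℕ) : ℝ) ^ k)) (p H : ℕ) (hH : 1 ≤ H)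
    (hcond : 2 * ((p : ℝ) + 1) * (1 / (2 * δ)) ^ (2 * (p + 1)) ≤ (H : ℝ) ^ (2 * p + 1)) :
    ∃ i, 1 / (4 * ((p : ℝ) + 1) * s) ≤ ∑ h ∈ Ico 1 ((p + 1) * H + 1), (‖SS k N (h * β i)‖ / N) ^ s := by
  have h1 := montg (fun a : Fin s → Fin N => ∑ i, β i * (((a i : ℕ) + 1 : ℕ) : ℝ) ^ k) δ hδ hy p H hH hcond
  have hN0 : (0 : ℝ) < N := by exact_mod_cast hN
  have hs0 : (0 : ℝ) < s := by exact_mod_cast hs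
  have hcard : (Fintype.card (Fin s → Fin N) : ℝ) = (N : ℝ) ^ s := by simp
  rw [hcard] at h1
  have h2 : ∀ h : ℕ, ‖∑ a : Fin s → Fin N, ee (h * ∑ i, β i * (((a i : ℕ) + 1 : ℕ) : ℝ) ^ k)‖ ≤ (N : ℝ) ^ s * ∑ i, (‖SS k N (h * β i)‖ / N) ^ s := by
    intro h
    rw [prod_sums, norm_prod]
    have := prod_le_sum_pow s hs (fun i => ‖SS k N (h * β i)‖ / N) (fun i => by positivity)
    rw [Finset.prod_div_distrib, Finset.prod_const, Finset.card_univ, Fintype.card_fin, div_le_iff₀ (by positivity)] at this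
    linarith
  have h3 := h1.trans (mul_le_mul_of_nonneg_left (Finset.sum_le_sum fun h _ => h2 h) (by positivity))
  rw [← Finset.mul_sum, Finset.sum_comm] at h3
  by_contra hcon
  push Not at hcon
  have h4 : ∑ i : Fin s, ∑ h ∈ Ico 1 ((p + 1) * H + 1), (‖SS k N (h * β i)‖ / N) ^ s < ∑ i : Fin s, 1 / (4 * ((p : ℝ) + 1) * s) :=
    Finset.sum_lt_sum_of_nonempty ⟨⟨0, hs⟩, Finset.mem_univ _⟩ fun i _ => hcon i
  rw [Finset.sum_const, Finset.card_univ, Fintype.card_fin, nsmul_eq_mul] at h4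
  have h5 : (s : ℝ) * (1 / (4 * ((p : ℝ) + 1) * s)) = 1 / (4 * ((p : ℝ) + 1)) := by field_simp
  rw [h5, lt_div_iff₀ (by positivity)] at h4
  have hNs : (0 : ℝ) < (N : ℝ) ^ s := by positivity
  nlinarith

lemma main_aux (k s : ℕ) (hk : 6 ≤ k) (hs1 : 1 ≤ s) (hs2 : s ≤ k * (k - 1)) (ε : ℝ) (hε : 0 < ε) (hε1 : ε ≤ 1 / ((k : ℝ) * ((k : ℝ) - 1))) :
    ∃ N₀ : ℕ, ∀ (β : Fin s → ℝ) (N : ℕ), N₀ ≤ N → ∃ n : Fin s → ℕ, (∀ i, n i ≤ N) ∧ n ≠ 0 ∧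
      nd (∑ i, β i * (n i : ℝ) ^ k) ≤ (N : ℝ) ^ (-((s : ℝ) / ((k : ℝ) * ((k : ℝ) - 1))) + ε) := by
  have hk6 : (6 : ℝ) ≤ k := by exact_mod_cast hk
  have hKn : ((k * (k - 1) : ℕ) : ℝ) = (k : ℝ) * ((k : ℝ) - 1) := by rw [Nat.cast_mul, Nat.cast_sub (by omega)]; simp
  set K : ℝ := (k : ℝ) * ((k : ℝ) - 1) with hK
  have hK0 : 0 < K := by rw [hK]; apply mul_pos <;> linarith
  have hK1 : 1 ≤ K := by rw [hK]; nlinarith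
  have hsK : (s : ℝ) ≤ K := by rw [← hKn]; exact_mod_cast hs2
  have hs1' : (1 : ℝ) ≤ s := by exact_mod_cast hs1
  have hσ1 : (s : ℝ) / K ≤ 1 := (div_le_one hK0).2 hsK
  have hσε : ε ≤ (s : ℝ) / K := hε1.trans (by gcongr)
  set σ := (s : ℝ) / K with hσ
  obtain ⟨p, hp⟩ := exists_nat_ge (2 / ε)
  have hp' : 2 ≤ p * ε := by rwa [div_le_iff₀ hε] at hp
  obtain ⟨Na, hNa⟩ := single k hk s hs2 (ε / 4) (by positivity) (by linarith) (1 / (4 * ((p : ℝ) + 1) * s)) (by positivity)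
  obtain ⟨Nb, hNb⟩ := ev_large (2 * ((p : ℝ) + 1)) (ε / 4) (by positivity)
  obtain ⟨Nc, hNc⟩ := ev_large (2 * ((p : ℝ) + 1)) 1 one_pos
  refine ⟨max (max Na Nb) (max Nc 1), fun β N hN => ?_⟩
  simp only [max_le_iff] at hN
  obtain ⟨⟨hNa', hNb'⟩, hNc', hN1⟩ := hN
  specialize hNa N hNa'
  specialize hNb N hNb'
  specialize hNc N hNc'
  have hL1 : (1 : ℝ) ≤ N := by exact_mod_cast hN1
  set L : ℝ := (N : ℝ) with hL
  have hL0 : 0 < L := lt_of_lt_of_le one_pos hL1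
  by_contra hcon
  push Not at hcon
  have hδ : 0 < L ^ (-σ + ε) := Real.rpow_pos_of_pos hL0 _
  set X := L ^ (σ - ε / 2) with hX
  have hX1 : 1 ≤ X := Real.one_le_rpow hL1 (by linarith)
  set H := ⌈X⌉₊ with hH
  have hHX : X ≤ H := Nat.le_ceil X
  have hHX2 : (H : ℝ) ≤ 2 * X := by
    have := Nat.ceil_lt_add_one (a := X) (by linarith)
    linarith
  have hH1 : 1 ≤ H := by
    have : (1 : ℝ) ≤ H := hX1.trans hHX
    exact_mod_cast this
  obtain ⟨i, hi⟩ := moment_lower k N s hN1 hs1 β (L ^ (-σ + ε)) hδ (by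
      intro a
      refine (hcon (fun i => (a i : ℕ) + 1) (fun i => (a i).2) ?_).le
      intro h0
      have := congrFun h0 ⟨0, hs1⟩
      simp at this) p H hH1 (by
      have h1 : 1 / (2 * L ^ (-σ + ε)) ≤ L ^ (σ - ε) := by
        rw [div_le_iff₀ (by positivity), mul_left_comm, ← Real.rpow_add hL0]
        have : σ - ε + (-σ + ε) = 0 := by ring
        rw [this, Real.rpow_zero]; norm_num
      calc 2 * ((p : ℝ) + 1) * (1 / (2 * L ^ (-σ + ε))) ^ (2 * (p + 1)) ≤ L ^ (1 : ℝ) * (L ^ (σ - ε)) ^ (2 * (p + 1)) := by gcongr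
        _ = L ^ (1 + (σ - ε) * (2 * (p + 1))) := by
          rw [← Real.rpow_natCast (L ^ (σ - ε)) (2 * (p + 1)), ← Real.rpow_mul hL0.le, ← Real.rpow_add hL0]; push_cast; rfl
        _ ≤ L ^ ((σ - ε / 2) * (2 * p + 1)) := by
          apply Real.rpow_le_rpow_of_exponent_le hL1
          nlinarith
        _ = X ^ (2 * p + 1) := by
          rw [hX, ← Real.rpow_natCast (L ^ (σ - ε / 2)) (2 * p + 1), ← Real.rpow_mul hL0.le]; push_cast; rfl
        _ ≤ _ := by gcongr)
  obtain ⟨n, hn1, hnN, hn⟩ := hNa (β i) ((p + 1) * H) (by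
      push_cast
      calc ((p : ℝ) + 1) * H ≤ ((p : ℝ) + 1) * (2 * X) := by gcongr
        _ = (2 * ((p : ℝ) + 1)) * X := by ring
        _ ≤ L ^ (ε / 4) * X := by gcongr
        _ = L ^ (σ - ε / 4) := by rw [hX, ← Real.rpow_add hL0]; congr 1; ring) hi
  have h1 := hcon (fun l => if l = i then n else 0) (fun l => by
    split_ifs <;> omega) (by
    intro h0
    have := congrFun h0 i
    simp at this; omega)
  have h2 : ∑ l, β l * (((if l = i then n else 0 : ℕ)) : ℝ) ^ k = β i * (n : ℝ) ^ k := by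
    rw [Finset.sum_eq_single i]
    · simp
    · intro l _ hl
      rw [if_neg hl]; simp; right; omega
    · intro h; exact absurd (Finset.mem_univ i) h
  rw [h2] at h1
  have h3 : L ^ (-1 : ℝ) ≤ L ^ (-σ + ε) := Real.rpow_le_rpow_of_exponent_le hL1 (by linarith)
  linarith

end SFP

/-- **Theorem 3(a) (Baker).** Let `k ≥ 6` and `1 ≤ s ≤ k(k−1)`, `ε > 0`. There is a
constant `C > 0` (depending only on `k`, `s`, `ε`) such that for all sufficiently large
`N` and all real `β₁, …, β_s` there exist integers `0 ≤ nᵢ ≤ N`, not all zero, with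
`‖β₁ n₁^k + ⋯ + β_s n_s^k‖ ≤ C · N^(−s/(k(k−1)) + ε)`. -/
theorem small_fractional_parts_additive_form (k s : ℕ) (hk : 6 ≤ k)
    (hs1 : 1 ≤ s) (hs2 : s ≤ k * (k - 1)) (ε : ℝ) (hε : 0 < ε) :
    ∃ C : ℝ, 0 < C ∧ ∃ N₀ : ℕ, ∀ (β : Fin s → ℝ) (N : ℕ), N₀ ≤ N →
      ∃ n : Fin s → ℕ, (∀ i, n i ≤ N) ∧ n ≠ 0 ∧
        nearestIntDist (∑ i, β i * (n i : ℝ) ^ k) ≤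
          C * (N : ℝ) ^ (-((s : ℝ) / ((k : ℝ) * ((k : ℝ) - 1))) + ε) := by
  
  set ε' := min ε (1 / ((k : ℝ) * ((k : ℝ) - 1))) with hε'
  have hk6 : (6 : ℝ) ≤ k := by exact_mod_cast hk
  have hK0 : 0 < (k : ℝ) * ((k : ℝ) - 1) := by apply mul_pos <;> linarith
  obtain ⟨N₀, hN₀⟩ := SFP.main_aux k s hk hs1 hs2 ε' (lt_min hε (by positivity)) (min_le_right _ _)
  refine ⟨1, one_pos, max N₀ 1, fun β N hN => ?_⟩
  obtain ⟨n, h1, h2, h3⟩ := hN₀ β N (le_trans (le_max_left _ _) hN)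
  refine ⟨n, h1, h2, ?_⟩
  have hN1 : (1 : ℝ) ≤ N := by exact_mod_cast le_trans (le_max_right _ _) hN
  rw [one_mul]
  refine le_trans h3 (Real.rpow_le_rpow_of_exponent_le hN1 ?_)
  have := min_le_left ε (1 / ((k : ℝ) * ((k : ℝ) - 1)))
  linarith
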